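/- Let a, x be positive real numbers, set 𝓛 := log(100x) + |log a|, and assume that y := 73.6·a^{1/8}·x^{3/16}·𝓛^{3/8} satisfies 1 ≤ y ≤ x/3. Let P(x) := #{m ∈ ℤ³ : (m₁² + m₂²)/a + a²·m₃² ≤ x} − (4π/3)·x^{3/2} be the lattice point discrepancy of the ellipsoid of rotation (u₁²+u₂²)/a + a²u₃² ≤ x, and let α₀ := max(a, 1/√a). Then |P(x)| ≤ 1237·a^{1/8}·x^{11/16}·𝓛^{3/8} + 12·a^{−69/64}·x^{81/128}·𝓛^{145/64} + (a^{1/4}·(134·𝓛^{5/2} + 543·𝓛^{1/4}) + 20·𝓛^{5/2}/a^{1/4})·x^{5/8} + 12·a^{−39/64}·x^{75/128}·𝓛^{139/64} + (268·𝓛/a + 159·α₀³ + 2000)·x^{1/2} + α₀³·(4.4·𝓛 + 104.5). -/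

import Mathlib

open Real

section P1sec
namespace EllAux
open MeasureTheory

noncomputable def per (g : (Fin 3 → ℝ) → ℂ) (v : Fin 3 → ℝ) : ℂ :=
  ∑' m : Fin 3 → ℤ, g (fun i => v i + m i)

noncomputable def ibox (C : ℤ) : Finset (Fin 3 → ℤ) := Fintype.piFinset (fun _ => Finset.Icc (-C) C)

lemma ibox_spec {g : (Fin 3 → ℝ) → ℂ} {B : ℝ} (hB : ∀ v, g v ≠ 0 → ∀ i, |v i| ≤ B)
    (D : ℝ) (v : Fin 3 → ℝ) (hv : ∀ i, |v i| ≤ D) (m : Fin 3 → ℤ) (hm : m ∉ ibox ⌈B + D⌉) :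
    g (fun i => v i + m i) = 0 := by
  by_contra h
  apply hm
  have h1 := hB _ h
  simp only [ibox, Fintype.mem_piFinset, Finset.mem_Icc]
  intro i
  have h2 := h1 i
  have h3 := hv i
  have h4 : |(m i : ℝ)| ≤ B + D := by
    have : (m i : ℝ) = (v i + m i) - v i := by ring
    rw [this]
    exact (abs_sub _ _).trans (by linarith)
  have h5 : ((|m i| : ℤ) : ℝ) ≤ (⌈B + D⌉ : ℝ) := by
    push_cast
    exact h4.trans (Int.le_ceil _)
  have h6 : |m i| ≤ ⌈B + D⌉ := by exact_mod_cast h5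
  exact abs_le.mp h6

lemma per_eq_sum {g : (Fin 3 → ℝ) → ℂ} {B : ℝ} (hB : ∀ v, g v ≠ 0 → ∀ i, |v i| ≤ B)
    (D : ℝ) (v : Fin 3 → ℝ) (hv : ∀ i, |v i| ≤ D) :
    per g v = ∑ m ∈ ibox ⌈B + D⌉, g (fun i => v i + m i) :=
  tsum_eq_sum (fun m hm => ibox_spec hB D v hv m hm)

lemma per_continuous {g : (Fin 3 → ℝ) → ℂ} (hc : Continuous g) {B : ℝ}
    (hB : ∀ v, g v ≠ 0 → ∀ i, |v i| ≤ B) : Continuous (per g) := by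
  rw [continuous_iff_continuousAt]
  intro v0
  have hcont : ContinuousAt
      (fun v : Fin 3 → ℝ => ∑ m ∈ ibox ⌈B + (‖v0‖ + 1)⌉, g (fun i => v i + m i)) v0 := by
    apply Continuous.continuousAt
    apply continuous_finsetSum
    intro m _
    exact hc.comp (by fun_prop)
  refine hcont.congr ?_
  filter_upwards [Metric.ball_mem_nhds v0 one_pos] with v hv
  symm
  apply per_eq_sum hB
  intro i
  have h1 : ‖v‖ ≤ ‖v0‖ + 1 := by
    have h2 : ‖v - v0‖ < 1 := by simpa [dist_eq_norm] using hv
    calc ‖v‖ = ‖v0 + (v - v0)‖ := by congr 1; abel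
      _ ≤ ‖v0‖ + ‖v - v0‖ := norm_add_le _ _
      _ ≤ _ := by linarith
  calc |v i| = ‖v i‖ := (Real.norm_eq_abs _).symm
    _ ≤ ‖v‖ := norm_le_pi_norm v i
    _ ≤ _ := h1

lemma per_add_int (g : (Fin 3 → ℝ) → ℂ) (v : Fin 3 → ℝ) (z : Fin 3 → ℤ) :
    per g (fun i => v i + z i) = per g v := by
  unfold per
  rw [← (Equiv.addLeft z).tsum_eq (fun m : Fin 3 → ℤ => g (fun i => v i + m i))]
  congr 1
  ext m
  congr 1
  ext i
  simp [add_assoc]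

/-- the projection to the torus -/
def tproj : (Fin 3 → ℝ) → UnitAddTorus (Fin 3) := fun v i => ((v i : ℝ) : UnitAddCircle)

lemma tproj_quot : IsOpenQuotientMap tproj := by
  have : tproj = Pi.map (fun _ : Fin 3 => ((↑) : ℝ → UnitAddCircle)) := rfl
  rw [this]
  exact IsOpenQuotientMap.piMap (fun i => QuotientAddGroup.isOpenQuotientMap_mk)

noncomputable def pert (g : (Fin 3 → ℝ) → ℂ) (t : UnitAddTorus (Fin 3)) : ℂ :=
  per g (fun i => Function.surjInv tproj_quot.surjective t i)

lemma pert_proj (g : (Fin 3 → ℝ) → ℂ) (v : Fin 3 → ℝ) : pert g (tproj v) = per g v := by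
  unfold pert
  set w := Function.surjInv tproj_quot.surjective (tproj v) with hw
  have h : tproj w = tproj v := Function.surjInv_eq _ _
  have h2 : ∀ i, ∃ z : ℤ, w i = v i + z := by
    intro i
    have h3 : ((w i : ℝ) : UnitAddCircle) = ((v i : ℝ) : UnitAddCircle) := congrFun h i
    have h4 : ((v i : ℝ) : UnitAddCircle) = ((w i : ℝ) : UnitAddCircle) := h3.symm
    rw [QuotientAddGroup.eq] at h4
    obtain ⟨z, hz⟩ := AddSubgroup.mem_zmultiples_iff.mp h4
    refine ⟨z, ?_⟩
    simp at hz
    linarith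
  choose z hz using h2
  have : (fun i => w i) = (fun i => v i + z i) := by ext i; exact hz i
  rw [this, per_add_int]

lemma pert_continuous {g : (Fin 3 → ℝ) → ℂ} (hc : Continuous g) {B : ℝ}
    (hB : ∀ v, g v ≠ 0 → ∀ i, |v i| ≤ B) : Continuous (pert g) := by
  rw [tproj_quot.isQuotientMap.continuous_iff]
  have : pert g ∘ tproj = per g := by ext v; exact pert_proj g v
  rw [this]
  exact per_continuous hc hB

def cube (m : Fin 3 → ℤ) : Set (Fin 3 → ℝ) := {x | ∀ i, x i ∈ Set.Ioc (m i : ℝ) (m i + 1)}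

lemma cube_meas (m : Fin 3 → ℤ) : MeasurableSet (cube m) :=
  MeasurableSet.univ_pi' (fun i => measurableSet_Ioc)

lemma cube_union : (⋃ m, cube m) = Set.univ := by
  ext x
  simp only [Set.mem_iUnion, Set.mem_univ, iff_true, cube, Set.mem_ofPred_eq]
  refine ⟨fun i => ⌈x i⌉ - 1, fun i => ?_⟩
  have h1 := Int.le_ceil (x i)
  have h2 := Int.ceil_lt_add_one (x i)
  constructor
  · push_cast; linarith
  · push_cast; linarith

lemma cube_disj : Pairwise (Function.onFun Disjoint cube) := by
  intro m m' hmm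
  rw [Function.onFun, Set.disjoint_left]
  intro x hx hx'
  apply hmm
  ext i
  have h1 := hx i
  have h2 := hx' i
  have e1 : ⌈x i⌉ = m i + 1 := by
    rw [Int.ceil_eq_iff]; push_cast; exact ⟨by linarith [h1.1], h1.2⟩
  have e2 : ⌈x i⌉ = m' i + 1 := by
    rw [Int.ceil_eq_iff]; push_cast; exact ⟨by linarith [h2.1], h2.2⟩
  omega

lemma cube_shift (φ : (Fin 3 → ℝ) → ℂ) (m : Fin 3 → ℤ) :
    ∫ v in cube m, φ v = ∫ v in cube 0, φ (fun i => v i + m i) := by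
  have h1 := (measurePreserving_add_right (volume : Measure (Fin 3 → ℝ))
    (fun i => (m i : ℝ))).setIntegral_preimage_emb
      (MeasurableEquiv.addRight (fun i => (m i : ℝ))).measurableEmbedding φ (cube m)
  rw [← h1]
  have : (fun x : Fin 3 → ℝ => x + fun i => (m i : ℝ)) ⁻¹' cube m = cube 0 := by
    ext x
    simp only [Set.mem_preimage, cube, Set.mem_ofPred_eq, Pi.add_apply, Pi.zero_apply, Int.cast_zero,
      Set.mem_Ioc]
    refine forall_congr' fun i => ?_
    constructor <;> rintro ⟨h1, h2⟩ <;> constructor <;> linarith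
  rw [this]
  rfl

lemma integral_unfold {φ : (Fin 3 → ℝ) → ℂ} (hc : Continuous φ) {B : ℝ}
    (hB : ∀ v, φ v ≠ 0 → ∀ i, |v i| ≤ B) :
    ∫ v in cube 0, per φ v = ∫ v, φ v := by
  have hcomp : HasCompactSupport φ := by
    apply HasCompactSupport.intro (K := Set.Icc (fun _ => -B) (fun _ => B)) isCompact_Icc
    intro v hv
    by_contra h
    apply hv
    have := hB v h
    exact ⟨fun i => (abs_le.mp (this i)).1, fun i => (abs_le.mp (this i)).2⟩
  have hInteg : Integrable φ := hc.integrable_of_hasCompactSupport hcomp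
  have h1 := hasSum_integral_iUnion (μ := volume) (f := φ) cube_meas cube_disj
    (by rw [cube_union]; exact hInteg.integrableOn)
  rw [cube_union, setIntegral_univ] at h1
  rw [← h1.tsum_eq]
  have hz : ∀ m ∉ ibox ⌈B + 1⌉, ∀ v ∈ cube 0, φ (fun i => v i + m i) = 0 := by
    intro m hm v hv
    apply ibox_spec hB 1 v _ m hm
    intro i
    have := hv i
    simp at this
    rw [abs_le]; constructor <;> linarith [this.1, this.2]
  rw [tsum_eq_sum (s := ibox ⌈B + 1⌉)]
  · simp_rw [cube_shift φ]
    rw [← integral_finsetSum]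
    · apply setIntegral_congr_fun (cube_meas 0)
      intro v hv
      simp only [per]
      exact tsum_eq_sum (fun m hm => hz m hm v hv)
    · intro m _
      apply Integrable.integrableOn
      have := hInteg.comp_add_right (fun i => (m i : ℝ))
      exact this
  · intro m hm
    rw [cube_shift]
    rw [setIntegral_congr_fun (g := fun _ => 0) (cube_meas 0) (fun v hv => hz m hm v hv)]
    simp

/-- the exponential `e(-k·v)` -/
noncomputable def ek (k : Fin 3 → ℤ) (v : Fin 3 → ℝ) : ℂ :=
  UnitAddTorus.mFourier (-k) (tproj v)

theorem poisson3 {g : (Fin 3 → ℝ) → ℂ} (hc : Continuous g) {B : ℝ}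
    (hB : ∀ v, g v ≠ 0 → ∀ i, |v i| ≤ B)
    (hs : Summable fun k : Fin 3 → ℤ => ∫ v, ek k v * g v) :
    HasSum (fun k : Fin 3 → ℤ => ∫ v, ek k v * g v) (∑' m : Fin 3 → ℤ, g (fun i => m i)) := by
  set f : C(UnitAddTorus (Fin 3), ℂ) := ⟨pert g, pert_continuous hc hB⟩ with hf
  have hcoef : ∀ k, UnitAddTorus.mFourierCoeff f k = ∫ v, ek k v * g v := by
    intro k
    have hek : Continuous (ek k) :=
      (UnitAddTorus.mFourier (-k)).continuous.comp tproj_quot.continuous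
    rw [UnitAddTorus.mFourierCoeff_eq_integral f k (fun _ => 0)]
    rw [← integral_unfold (φ := fun v => ek k v * g v) (hek.mul hc) (B := B)
      (fun v hv => hB v (right_ne_zero_of_mul hv))]
    have hcube : {x : Fin 3 → ℝ | ∀ i, x i ∈ Set.Ioc (0:ℝ) (0 + 1)} = cube 0 := by
      ext x; simp [cube]
    rw [hcube]
    apply setIntegral_congr_fun (cube_meas 0)
    intro v _
    show ek k v • pert g (tproj v) = per (fun v => ek k v * g v) v
    rw [pert_proj]
    unfold per
    rw [smul_eq_mul, ← tsum_mul_left]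
    congr 1
    ext m
    congr 1
    unfold ek
    congr 1
    ext i
    simp [tproj]
  have h0 := UnitAddTorus.hasSum_mFourier_series_apply_of_summable (f := f)
    (by rw [show UnitAddTorus.mFourierCoeff f = _ from funext hcoef]; exact hs) (tproj 0)
  have h1 : f (tproj 0) = ∑' m : Fin 3 → ℤ, g (fun i => m i) := by
    show pert g (tproj 0) = _
    rw [pert_proj]; simp [per]
  rw [h1] at h0
  convert! h0 using 2 with k
  rw [hcoef]
  have : UnitAddTorus.mFourier k (tproj 0) = 1 := by
    simp [UnitAddTorus.mFourier, tproj]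
  rw [this]; simp

lemma ek_eq (k : Fin 3 → ℤ) (v : Fin 3 → ℝ) :
    ek k v = Complex.exp (-(2 * π * (k 0 * v 0 + k 1 * v 1 + k 2 * v 2) * Complex.I)) := by
  unfold ek tproj
  simp only [UnitAddTorus.mFourier, ContinuousMap.coe_mk, fourier_coe_apply, Fin.prod_univ_three,
    Pi.neg_apply, ← Complex.exp_add]
  congr 1
  push_cast
  ring

end EllAux
end P1sec

section P2sec
namespace EllAux
open MeasureTheory Asymptotics

noncomputable def Gf (u s : ℝ) : ℝ := (max (u - s) 0) ^ 2 / 2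

noncomputable def Kf (u s : ℝ) : ℝ := u * (max (u - s) 0) ^ 3 / 6 - (max (u - s) 0) ^ 4 / 8

lemma Gf_cont (u : ℝ) : Continuous (Gf u) := by unfold Gf; fun_prop
lemma Kf_cont (u : ℝ) : Continuous (Kf u) := by unfold Kf; fun_prop

lemma Kf_deriv (u s : ℝ) : HasDerivAt (Kf u) (-(s * Gf u s)) s := by
  rcases lt_trichotomy s u with h | h | h
  · have h1 : Kf u =ᶠ[nhds s] fun s => u * (u - s) ^ 3 / 6 - (u - s) ^ 4 / 8 := by
      filter_upwards [Iio_mem_nhds h] with t ht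
      have : 0 ≤ u - t := by have := Set.mem_Iio.1 ht; linarith
      simp [Kf, max_eq_left this]
    refine HasDerivAt.congr_of_eventuallyEq ?_ h1
    have h2 : HasDerivAt (fun s => u - s) (-1) s := by simpa using (hasDerivAt_id s).const_sub u
    have h3 := (((h2.pow 3).const_mul u).div_const 6).sub ((h2.pow 4).div_const 8)
    have : 0 ≤ u - s := by linarith
    have e : -(s * Gf u s) = u * (((3:ℕ):ℝ) * (u - s) ^ (3 - 1) * -1) / 6 - ((4:ℕ):ℝ) * (u - s) ^ (4 - 1) * -1 / 8 := by
      simp only [Gf, max_eq_left this]; push_cast; ring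
    rw [e]
    exact h3
  · subst h
    have h0 : Gf s s = 0 := by simp [Gf]
    rw [h0]
    rw [hasDerivAt_iff_isLittleO_nhds_zero]
    have : (fun h => Kf s (s + h) - Kf s s - h • (-(s * 0))) =O[nhds 0] (fun h : ℝ => h ^ 2) := by
      rw [Asymptotics.isBigO_iff]
      refine ⟨|s| + 1, ?_⟩
      filter_upwards [Metric.ball_mem_nhds (0:ℝ) one_pos] with t ht
      have ht' : |t| < 1 := by simpa using ht
      have e : s - (s + t) = -t := by ring
      simp only [Kf, e, sub_self, max_self, smul_eq_mul]
      norm_num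
      set m := max (-t) 0 with hm
      have m0 : 0 ≤ m := le_max_right _ _
      have m1 : m ≤ |t| := max_le (neg_le_abs t) (abs_nonneg t)
      have m2 : m ^ 2 ≤ t ^ 2 := by rw [← sq_abs t]; gcongr
      have m3 : m ≤ 1 := by linarith
      have : |s * m ^ 3 / 6 - m ^ 4 / 8| ≤ |s * m ^ 3 / 6| + |m ^ 4 / 8| := abs_sub _ _
      have e1 : |s * m ^ 3 / 6| ≤ |s| * m ^ 2 := by
        rw [abs_div, abs_mul, abs_of_nonneg (pow_nonneg m0 3), abs_of_pos (by norm_num : (0:ℝ) < 6)]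
        have : m ^ 3 ≤ m ^ 2 := by nlinarith [sq_nonneg m]
        have := mul_le_mul_of_nonneg_left this (abs_nonneg s)
        have := mul_nonneg (abs_nonneg s) (sq_nonneg m)
        linarith
      have e2 : |m ^ 4 / 8| ≤ m ^ 2 := by
        rw [abs_of_nonneg (by positivity)]
        nlinarith [sq_nonneg m, mul_nonneg m0 m0, mul_nonneg (sq_nonneg m) (sub_nonneg.2 m3), mul_nonneg (mul_nonneg (sq_nonneg m) m0) (sub_nonneg.2 m3)]
      have := mul_le_mul_of_nonneg_left m2 (abs_nonneg s)
      nlinarith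
    refine this.trans_isLittleO ?_
    have := Asymptotics.isLittleO_pow_id (𝕜 := ℝ) (n := 2) (by norm_num)
    simpa using this
  · have h1 : Kf u =ᶠ[nhds s] fun s => 0 := by
      filter_upwards [Ioi_mem_nhds h] with t ht
      have : u - t ≤ 0 := by have := Set.mem_Ioi.1 ht; linarith
      simp [Kf, max_eq_right this]
    have : u - s ≤ 0 := by linarith
    have h0 : Gf u s = 0 := by simp [Gf, max_eq_right this]
    rw [h0]
    simpa using (hasDerivAt_const s (0:ℝ)).congr_of_eventuallyEq h1

/-- radial integral -/
lemma radial_int (u z : ℝ) : ∫ r in Set.Ioi (0:ℝ), r * Gf u (√(z ^ 2 + r ^ 2)) = Kf u |z| := by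
  have key := integral_Ioi_of_hasDerivAt_of_nonneg (a := 0) (l := 0)
    (g := fun r => - Kf u (√(z ^ 2 + r ^ 2))) (g' := fun r => r * Gf u (√(z ^ 2 + r ^ 2))) ?_ ?_ ?_ ?_
  · rw [key]; simp [Real.sqrt_sq_eq_abs]
  · have := Kf_cont u
    apply Continuous.continuousWithinAt
    fun_prop
  · intro r hr
    have hr : 0 < r := hr
    have hp : 0 < z ^ 2 + r ^ 2 := by positivity
    have h1 : HasDerivAt (fun r => z ^ 2 + r ^ 2) (2 * r) r := by
      simpa using (hasDerivAt_pow 2 r).const_add (z ^ 2)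
    have h2 := (Kf_deriv u (√(z ^ 2 + r ^ 2))).comp r (h1.sqrt hp.ne')
    have hs : 0 < √(z ^ 2 + r ^ 2) := Real.sqrt_pos.2 hp
    have e : r * Gf u (√(z ^ 2 + r ^ 2)) = -(-(√(z ^ 2 + r ^ 2) * Gf u √(z ^ 2 + r ^ 2)) * (2 * r / (2 * √(z ^ 2 + r ^ 2)))) := by
      field_simp
    rw [e]
    exact h2.neg
  · intro r hr
    have hr : 0 < r := hr
    have : 0 ≤ Gf u (√(z ^ 2 + r ^ 2)) := by unfold Gf; positivity
    positivity
  · apply tendsto_const_nhds.congr'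
    filter_upwards [Filter.eventually_ge_atTop (max u 0)] with r hr
    have h1 : u ≤ r := le_trans (le_max_left _ _) hr
    have h2 : 0 ≤ r := le_trans (le_max_right _ _) hr
    have h3 : r ≤ √(z ^ 2 + r ^ 2) := Real.le_sqrt_of_sq_le (by nlinarith [sq_nonneg z])
    have : u - √(z ^ 2 + r ^ 2) ≤ 0 := by linarith
    simp [Kf, max_eq_right this]

lemma inner_int (u z : ℝ) : ∫ p : Fin 2 → ℝ, Gf u (√(z ^ 2 + (p 0 ^ 2 + p 1 ^ 2))) = 2 * π * Kf u |z| := by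
  rw [← (PiLp.volume_preserving_ofLp (Fin 2)).integral_comp
    (MeasurableEquiv.toLp 2 (Fin 2 → ℝ)).symm.measurableEmbedding]
  have e : ∀ p : EuclideanSpace ℝ (Fin 2), Gf u (√(z ^ 2 + ((p.ofLp) 0 ^ 2 + (p.ofLp) 1 ^ 2)))
     = (fun r => Gf u (√(z ^ 2 + r ^ 2))) ‖p‖ := by
    intro p
    simp [EuclideanSpace.norm_sq_eq, Fin.sum_univ_two]
  rw [integral_congr_ae (Filter.Eventually.of_forall e)]
  have := integral_fun_norm_addHaar (volume : Measure (EuclideanSpace ℝ (Fin 2))) (fun r => Gf u (√(z ^ 2 + r ^ 2)))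
  refine this.trans ?_
  simp only [finrank_euclideanSpace, Fintype.card_fin]
  have : (volume : Measure (EuclideanSpace ℝ (Fin 2))).real (Metric.ball 0 1) = π := by
    simp [Measure.real, EuclideanSpace.volume_ball_fin_two, pi_pos.le]
  rw [this]
  simp only [show (2 - 1 : ℕ) = 1 from rfl, pow_one, smul_eq_mul]
  rw [radial_int]
  simp [mul_assoc]
end EllAux
end P2sec

section P3sec
namespace EllAux
open MeasureTheory Asymptotics

noncomputable def ghat (u ρ : ℝ) : ℝ :=
  u * cos (2 * π * u * ρ) / (4 * π ^ 3 * ρ ^ 4) - 3 * sin (2 * π * u * ρ) / (8 * π ^ 4 * ρ ^ 5)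
    + u / (2 * π ^ 3 * ρ ^ 4)

lemma cos_int_pos {u ρ : ℝ} (hu : 0 ≤ u) (hρ : 0 < ρ) :
    ∫ z in (0:ℝ)..u, cos (2 * π * ρ * z) * (2 * π * Kf u z) = ghat u ρ / 2 := by
  set w := 2 * π * ρ with hw
  have hw0 : w ≠ 0 := by positivity
  have key := intervalIntegral.integral_eq_sub_of_hasDerivAt (a := 0) (b := u)
    (f := fun z => (u * (u - z) ^ 3 / 6 - (u - z) ^ 4 / 8) * sin (w * z) / w
      + (- (z * (u - z) ^ 2 / 2)) * cos (w * z) / w ^ 2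
      - (- (u - z) ^ 2 / 2 + z * (u - z)) * sin (w * z) / w ^ 3
      - (2 * u - 3 * z) * cos (w * z) / w ^ 4 + (-3) * sin (w * z) / w ^ 5)
    (f' := fun z => cos (w * z) * (u * (u - z) ^ 3 / 6 - (u - z) ^ 4 / 8)) ?_ ?_
  · have : ∫ z in (0:ℝ)..u, cos (w * z) * (2 * π * Kf u z)
      = ∫ z in (0:ℝ)..u, 2 * π * (cos (w * z) * (u * (u - z) ^ 3 / 6 - (u - z) ^ 4 / 8)) := by
      apply intervalIntegral.integral_congr
      intro z hz
      rw [Set.uIcc_of_le hu] at hz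
      have : 0 ≤ u - z := by linarith [hz.2]
      simp only [Kf, max_eq_left this]; ring
    rw [this, intervalIntegral.integral_const_mul, key]
    have e : 2 * π * u * ρ = w * u := by rw [hw]; ring
    simp only [ghat, e]
    simp
    rw [hw]
    field_simp
    ring
  · intro z _
    have h1 : HasDerivAt (fun z => u - z) (-1) z := by simpa using (hasDerivAt_id z).const_sub u
    have hwz : HasDerivAt (fun z => w * z) w z := by simpa using (hasDerivAt_id z).const_mul w
    have hs := hwz.sin
    have hc := hwz.cos
    have hid : HasDerivAt (fun z : ℝ => z) 1 z := hasDerivAt_id z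
    have hp := (((h1.fun_pow 3).const_mul u).div_const 6).fun_sub ((h1.fun_pow 4).div_const 8)
    have hp1 := ((hid.fun_mul (h1.fun_pow 2)).div_const 2).fun_neg
    have hp2 := ((h1.fun_pow 2).fun_neg.div_const 2).fun_add (hid.fun_mul h1)
    have hp3 := (hid.const_mul 3).const_sub (2 * u)
    have := ((((hp.fun_mul hs).div_const w).fun_add ((hp1.fun_mul hc).div_const (w ^ 2))).fun_sub
      ((hp2.fun_mul hs).div_const (w ^ 3))).fun_sub ((hp3.fun_mul hc).div_const (w ^ 4))
    have := this.fun_add ((hs.const_mul (-3)).div_const (w ^ 5))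
    refine this.congr_deriv ?_
    push_cast
    field_simp
    ring
  · apply Continuous.intervalIntegrable; fun_prop

lemma cos_int_zero {u : ℝ} (hu : 0 ≤ u) :
    ∫ z in (0:ℝ)..u, (2 * π * Kf u z) = π * u ^ 5 / 30 := by
  have key := intervalIntegral.integral_eq_sub_of_hasDerivAt (a := 0) (b := u)
    (f := fun z => 2 * π * (-(u * (u - z) ^ 4 / 24) + (u - z) ^ 5 / 40))
    (f' := fun z => 2 * π * (u * (u - z) ^ 3 / 6 - (u - z) ^ 4 / 8)) ?_ ?_
  · have : ∫ z in (0:ℝ)..u, (2 * π * Kf u z)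
      = ∫ z in (0:ℝ)..u, 2 * π * (u * (u - z) ^ 3 / 6 - (u - z) ^ 4 / 8) := by
      apply intervalIntegral.integral_congr
      intro z hz
      rw [Set.uIcc_of_le hu] at hz
      have : 0 ≤ u - z := by linarith [hz.2]
      simp only [Kf, max_eq_left this]
    rw [this, key]
    simp
    ring
  · intro z _
    have h1 : HasDerivAt (fun z => u - z) (-1) z := by simpa using (hasDerivAt_id z).const_sub u
    have := ((((h1.fun_pow 4).const_mul u).div_const 24).fun_neg.fun_add ((h1.fun_pow 5).div_const 40)).const_mul (2 * π)
    refine this.congr_deriv ?_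
    push_cast
    ring
  · apply Continuous.intervalIntegrable; fun_prop

lemma Kf_abs_int (u ρ : ℝ) (hu : 0 ≤ u) :
    ∫ z : ℝ, cos (2 * π * ρ * z) * (2 * π * Kf u |z|)
      = 2 * ∫ z in (0:ℝ)..u, cos (2 * π * ρ * z) * (2 * π * Kf u z) := by
  have e : ∀ z : ℝ, cos (2 * π * ρ * z) * (2 * π * Kf u |z|)
     = (fun s => cos (2 * π * ρ * s) * (2 * π * Kf u s)) |z| := by
    intro z
    simp only
    rcases abs_choice z with h | h <;> rw [h]
    simp
  rw [integral_congr_ae (Filter.Eventually.of_forall e),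
    integral_comp_abs (f := fun s => cos (2 * π * ρ * s) * (2 * π * Kf u s)), intervalIntegral.integral_of_le hu]
  congr 1
  apply setIntegral_eq_of_subset_of_forall_sdiff_eq_zero measurableSet_Ioi Set.Ioc_subset_Ioi_self
  intro z hz
  have h1 : 0 < z := hz.1
  have h2 : u < z := by
    by_contra h
    exact hz.2 ⟨h1, not_lt.1 h⟩
  have : u - z ≤ 0 := by linarith
  simp [Kf, max_eq_right this]

lemma even_int (u ρ : ℝ) :
    ∫ z : ℝ, Complex.exp (-(2 * π * ρ * z) * Complex.I) * ((2 * π * Kf u |z| : ℝ) : ℂ)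
     = ((∫ z : ℝ, cos (2 * π * ρ * z) * (2 * π * Kf u |z|) : ℝ) : ℂ) := by
  set F : ℝ → ℂ := fun z => Complex.exp (-(2 * π * ρ * z) * Complex.I) * ((2 * π * Kf u |z| : ℝ) : ℂ) with hF
  have hcont : Continuous F := by
    have := Kf_cont u
    simp only [hF]; fun_prop
  have hInteg : Integrable F := by
    apply hcont.integrable_of_hasCompactSupport
    apply HasCompactSupport.intro (K := Set.Icc (-|u|) |u|) isCompact_Icc
    intro z hz
    have : u - |z| ≤ 0 := by
      by_contra h
      push Not at h
      apply hz
      have : |z| ≤ |u| := by have := le_abs_self u; linarith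
      exact abs_le.1 this
    simp [hF, Kf, max_eq_right this]
  have h1 : ∫ z, F z = ∫ z, F (-z) := (integral_neg_eq_self F volume).symm
  have h2 : ∫ z, F z = ∫ z, (1/2 : ℂ) * (F z + F (-z)) := by
    rw [integral_const_mul, integral_add hInteg hInteg.comp_neg, ← h1]; ring
  rw [h2, ← integral_complex_ofReal]
  congr 1
  ext z
  simp only [hF, abs_neg]
  rw [← add_mul]
  have : Complex.cos ((2 * π * ρ * z : ℝ) : ℂ) = _ := Complex.cos.eq_1 _
  push_cast at this ⊢
  rw [this]
  have e : -(2 * (π:ℂ) * ρ * -(z:ℂ)) * Complex.I = 2 * π * ρ * z * Complex.I := by ring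
  rw [e]
  ring_nf

end EllAux
end P3sec

section P4sec
namespace EllAux
open MeasureTheory Asymptotics

noncomputable def FE (u : ℝ) (ξ w : EuclideanSpace ℝ (Fin 3)) : ℂ :=
  Complex.exp (-(2 * π * (inner ℝ ξ w : ℝ)) * Complex.I) * ((Gf u ‖w‖ : ℝ) : ℂ)

lemma FE_rot (u : ℝ) (ξ η : EuclideanSpace ℝ (Fin 3)) (h : ‖ξ‖ = ‖η‖) :
    ∫ w, FE u ξ w = ∫ w, FE u η w := by
  set T := (Submodule.span ℝ {ξ - η})ᗮ.reflection with hT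
  have hT1 : T ξ = η := Submodule.reflection_sub h
  rw [← (T.measurePreserving).integral_comp T.toHomeomorph.measurableEmbedding (fun w => FE u η w)]
  congr 1
  ext w
  have : inner ℝ η (T w) = inner ℝ ξ w := by
    rw [← hT1, T.inner_map_map]
  simp [FE, this]

noncomputable def F3 (u : ℝ) (ξ w : Fin 3 → ℝ) : ℂ :=
  Complex.exp (-(2 * π * (ξ 0 * w 0 + ξ 1 * w 1 + ξ 2 * w 2 : ℝ)) * Complex.I)
    * ((Gf u (√(w 0 ^ 2 + w 1 ^ 2 + w 2 ^ 2)) : ℝ) : ℂ)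

lemma F3_cont (u : ℝ) (ξ : Fin 3 → ℝ) : Continuous (F3 u ξ) := by
  have := Gf_cont u
  unfold F3
  fun_prop

lemma F3_eq (u : ℝ) (ξ : Fin 3 → ℝ) : ∫ w, F3 u ξ w = ∫ w, FE u (WithLp.toLp 2 ξ) w := by
  rw [← (PiLp.volume_preserving_ofLp (Fin 3)).integral_comp
    (MeasurableEquiv.toLp 2 (Fin 3 → ℝ)).symm.measurableEmbedding]
  apply integral_congr_ae
  refine Filter.Eventually.of_forall (fun w => ?_)
  simp only [F3, FE, EuclideanSpace.norm_eq, PiLp.inner_apply, Fin.sum_univ_three]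
  simp [mul_comm]

lemma F3_red (u : ℝ) (ξ : Fin 3 → ℝ) :
    ∫ w, F3 u ξ w = ∫ w, F3 u ![√(ξ 0 ^ 2 + ξ 1 ^ 2 + ξ 2 ^ 2), 0, 0] w := by
  rw [F3_eq, F3_eq]
  apply FE_rot
  simp only [EuclideanSpace.norm_eq, Fin.sum_univ_three]
  simp

lemma F3_axis (u ρ : ℝ) : ∫ w, F3 u ![ρ, 0, 0] w
    = ((∫ z : ℝ, cos (2 * π * ρ * z) * (2 * π * Kf u |z|) : ℝ) : ℂ) := by
  have hInteg : Integrable (F3 u ![ρ, 0, 0]) := by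
    apply (F3_cont u _).integrable_of_hasCompactSupport
    apply HasCompactSupport.intro (K := Set.pi Set.univ (fun _ => Set.Icc (-|u|) |u|))
      (isCompact_univ_pi (fun _ => isCompact_Icc))
    intro w hw
    simp only [F3]
    have : u - √(w 0 ^ 2 + w 1 ^ 2 + w 2 ^ 2) ≤ 0 := by
      by_contra h
      push Not at h
      apply hw
      intro i _
      apply abs_le.1
      have h1 : |w i| ≤ √(w 0 ^ 2 + w 1 ^ 2 + w 2 ^ 2) := by
        apply Real.le_sqrt_of_sq_le
        rw [sq_abs]
        fin_cases i <;> simp <;> nlinarith [sq_nonneg (w 0), sq_nonneg (w 1), sq_nonneg (w 2)]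
      have := le_abs_self u
      linarith
    simp [Gf, max_eq_right this]
  rw [← even_int]
  have mp := volume_preserving_piFinSuccAbove (fun _ : Fin 3 => ℝ) 0
  rw [← mp.symm.integral_comp (MeasurableEquiv.measurableEmbedding _), Measure.volume_eq_prod, integral_prod]
  · congr 1
    ext z
    rw [← inner_int]
    rw [← integral_complex_ofReal, ← integral_const_mul]
    congr 1
    ext p
    simp only [MeasurableEquiv.piFinSuccAbove_symm_apply, F3]
    simp [Fin.insertNthEquiv]
    have e : (Fin.cons z p : Fin 3 → ℝ) 2 = p 1 := rfl
    rw [e, add_assoc, ← mul_assoc (2 * (π:ℂ))]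
  · exact (mp.symm.integrable_comp_emb (MeasurableEquiv.measurableEmbedding _)).2 hInteg


lemma F3_int {u : ℝ} (hu : 0 ≤ u) (ξ : Fin 3 → ℝ) (h : 0 < √(ξ 0 ^ 2 + ξ 1 ^ 2 + ξ 2 ^ 2)) :
    ∫ w, F3 u ξ w = ((ghat u (√(ξ 0 ^ 2 + ξ 1 ^ 2 + ξ 2 ^ 2)) : ℝ) : ℂ) := by
  rw [F3_red, F3_axis, Kf_abs_int _ _ hu, cos_int_pos hu h]
  congr 1; ring

lemma F3_int_zero {u : ℝ} (hu : 0 ≤ u) :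
    ∫ w, F3 u 0 w = ((π * u ^ 5 / 15 : ℝ) : ℂ) := by
  rw [F3_red, F3_axis, Kf_abs_int _ _ hu]
  congr 1
  simp [cos_int_zero hu]
  ring

noncomputable def Qn (a : ℝ) (v : Fin 3 → ℝ) : ℝ := √((v 0 ^ 2 + v 1 ^ 2) / a + a ^ 2 * v 2 ^ 2)

lemma ft_eq {a : ℝ} (ha : 0 < a) (u : ℝ) (k : Fin 3 → ℤ) :
    ∫ v, ek k v * ((Gf u (Qn a v) : ℝ) : ℂ) = ∫ w, F3 u ![√a * k 0, √a * k 1, k 2 / a] w := by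
  have hs : 0 < √a := Real.sqrt_pos.2 ha
  have hsq : √a * √a = a := Real.mul_self_sqrt ha.le
  set D : Fin 3 → ℝ := ![1 / √a, 1 / √a, a] with hD
  have hdet : (Matrix.diagonal D).det = 1 := by
    rw [Matrix.det_diagonal, Fin.prod_univ_three]
    simp [hD]
    field_simp
    nlinarith
  have h1 := Real.smul_map_diagonal_volume_pi (D := D) (by rw [hdet]; norm_num)
  rw [hdet] at h1
  simp only [abs_one, ENNReal.ofReal_one, one_smul] at h1
  conv_rhs => rw [← h1]
  rw [integral_map]
  · congr 1
    ext v
    rw [ek_eq, F3]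
    have e : ∀ i, (Matrix.toLin' (Matrix.diagonal D)) v i = D i * v i := by
      intro i; simp [Matrix.mulVec_diagonal]
    simp only [e]
    congr 2
    · simp only [hD]
      push_cast
      simp
      have : (√a : ℂ) ≠ 0 := by exact_mod_cast hs.ne'
      have : (a : ℂ) ≠ 0 := by exact_mod_cast ha.ne'
      field_simp
    · simp only [hD, Qn]
      simp
      congr 2
      have : √a ^ 2 = a := by rw [sq]; exact hsq
      field_simp
      rw [this]
      ring
  · exact (LinearMap.continuous_of_finiteDimensional _).measurable.aemeasurable
  · exact (F3_cont u _).aestronglyMeasurable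

/-- frequency modulus -/
noncomputable def rho (a : ℝ) (k : Fin 3 → ℤ) : ℝ := √(a * ((k 0 : ℝ) ^ 2 + (k 1 : ℝ) ^ 2) + (k 2 : ℝ) ^ 2 / a ^ 2)

lemma rho_pos {a : ℝ} (ha : 0 < a) {k : Fin 3 → ℤ} (hk : k ≠ 0) : 0 < rho a k := by
  apply Real.sqrt_pos.2
  by_contra h
  push Not at h
  have e0 : 0 ≤ (k 0 : ℝ) ^ 2 := sq_nonneg _
  have e1 : 0 ≤ (k 1 : ℝ) ^ 2 := sq_nonneg _
  have e2 : 0 ≤ (k 2 : ℝ) ^ 2 / a ^ 2 := by positivity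
  have e3 : 0 ≤ a * ((k 0 : ℝ) ^ 2 + (k 1 : ℝ) ^ 2) := by positivity
  have z2 : (k 2 : ℝ) ^ 2 / a ^ 2 = 0 := by linarith
  have z01 : a * ((k 0 : ℝ) ^ 2 + (k 1 : ℝ) ^ 2) = 0 := by linarith
  have z01' : (k 0 : ℝ) ^ 2 + (k 1 : ℝ) ^ 2 = 0 := by
    rcases mul_eq_zero.1 z01 with h | h
    · exact absurd h ha.ne'
    · exact h
  have z0 : (k 0 : ℝ) ^ 2 = 0 := by linarith
  have z1 : (k 1 : ℝ) ^ 2 = 0 := by linarith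
  apply hk
  ext i
  fin_cases i
  · simpa using z0
  · simpa using z1
  · simpa [ha.ne'] using z2

lemma ft_pos {a : ℝ} (ha : 0 < a) {u : ℝ} (hu : 0 ≤ u) {k : Fin 3 → ℤ} (hk : k ≠ 0) :
    ∫ v, ek k v * ((Gf u (Qn a v) : ℝ) : ℂ) = ((ghat u (rho a k) : ℝ) : ℂ) := by
  have e : √((![√a * k 0, √a * k 1, k 2 / a] : Fin 3 → ℝ) 0 ^ 2 + (![√a * k 0, √a * k 1, k 2 / a] : Fin 3 → ℝ) 1 ^ 2
      + (![√a * k 0, √a * k 1, k 2 / a] : Fin 3 → ℝ) 2 ^ 2) = rho a k := by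
    simp only [rho]
    simp [mul_pow, div_pow, Real.sq_sqrt ha.le]
    congr 1; ring
  rw [ft_eq ha, F3_int hu, e]
  rw [e]; exact rho_pos ha hk

lemma ft_zero {a : ℝ} (ha : 0 < a) {u : ℝ} (hu : 0 ≤ u) :
    ∫ v, ek 0 v * ((Gf u (Qn a v) : ℝ) : ℂ) = ((π * u ^ 5 / 15 : ℝ) : ℂ) := by
  rw [ft_eq ha, ← F3_int_zero hu]
  congr 1
  ext w
  congr 1
  ext i
  fin_cases i <;> simp

lemma Qn_cont (a : ℝ) : Continuous (Qn a) := by unfold Qn; fun_prop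

lemma poisson_N2 {a : ℝ} (ha : 0 < a) {u : ℝ} (hu : 0 ≤ u)
    (hs : Summable fun k : Fin 3 → ℤ => if k = 0 then π * u ^ 5 / 15 else ghat u (rho a k)) :
    HasSum (fun k : Fin 3 → ℤ => if k = 0 then π * u ^ 5 / 15 else ghat u (rho a k))
      (∑' m : Fin 3 → ℤ, Gf u (Qn a (fun i => m i))) := by
  have e : (fun k : Fin 3 → ℤ => ∫ v, ek k v * ((Gf u (Qn a v) : ℝ) : ℂ))
     = fun k : Fin 3 → ℤ => (((if k = 0 then π * u ^ 5 / 15 else ghat u (rho a k)) : ℝ) : ℂ) := by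
    ext k
    split_ifs with h
    · rw [h]; exact ft_zero ha hu
    · exact ft_pos ha hu h
  have hc : Continuous (fun v => ((Gf u (Qn a v) : ℝ) : ℂ)) := by
    have := Gf_cont u
    have := Qn_cont a
    fun_prop
  have := poisson3 (g := fun v => ((Gf u (Qn a v) : ℝ) : ℂ)) hc (B := max (u * √a) (u / a)) ?_ ?_
  · rw [e] at this
    rw [← Complex.ofReal_tsum] at this
    exact Complex.hasSum_ofReal.1 this
  · intro v hv
    have hQ : Qn a v < u := by
      by_contra h
      push Not at h
      apply hv
      have : u - Qn a v ≤ 0 := by linarith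
      simp [Gf, max_eq_right this]
    have hQ2 : (v 0 ^ 2 + v 1 ^ 2) / a + a ^ 2 * v 2 ^ 2 ≤ u ^ 2 := by
      have h0 : 0 ≤ (v 0 ^ 2 + v 1 ^ 2) / a + a ^ 2 * v 2 ^ 2 := by positivity
      rw [← Real.sq_sqrt h0]
      have : 0 ≤ Qn a v := Real.sqrt_nonneg _
      exact pow_le_pow_left₀ this hQ.le 2
    have h2 : 0 ≤ a ^ 2 * v 2 ^ 2 := by positivity
    have h01 : (v 0 ^ 2 + v 1 ^ 2) / a ≤ u ^ 2 := by linarith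
    rw [div_le_iff₀ ha] at h01
    have h0 : 0 ≤ (v 0 ^ 2 + v 1 ^ 2) / a := by positivity
    have hsq : (u * √a) ^ 2 = u ^ 2 * a := by rw [mul_pow, Real.sq_sqrt ha.le]
    intro i
    fin_cases i
    · apply le_max_of_le_left
      apply abs_le_of_sq_le_sq _ (by positivity)
      rw [hsq]; simp; nlinarith [sq_nonneg (v 1)]
    · apply le_max_of_le_left
      apply abs_le_of_sq_le_sq _ (by positivity)
      rw [hsq]; simp; nlinarith [sq_nonneg (v 0)]
    · apply le_max_of_le_right
      apply abs_le_of_sq_le_sq _ (by positivity)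
      rw [div_pow, le_div_iff₀ (by positivity)]
      simp; linarith
  · rw [e]; exact_mod_cast hs

end EllAux
end P4sec

section P5sec
namespace EllAux
open MeasureTheory Asymptotics

noncomputable def mx (k : ℤ) : ℝ := max 1 |(k:ℝ)|

lemma mx_pos (k : ℤ) : 0 < mx k := lt_of_lt_of_le one_pos (le_max_left _ _)

lemma mx_summable : Summable (fun k : ℤ => mx k ^ (-(4/3) : ℝ)) := by
  refine Summable.of_norm_bounded_eventually (Real.summable_abs_int_rpow (b := 4/3) (by norm_num)) ?_
  have : {k : ℤ | k = 0}ᶜ ∈ (Filter.cofinite : Filter ℤ) := by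
    rw [Filter.mem_cofinite]; simp
  filter_upwards [this] with k hk
  have hk : k ≠ 0 := by simpa using hk
  have h1 : (1:ℝ) ≤ |(k:ℝ)| := by
    have := Int.one_le_abs hk
    exact_mod_cast this
  rw [Real.norm_of_nonneg (Real.rpow_nonneg (mx_pos k).le _)]
  simp [mx, max_eq_right h1]

lemma prod_summable : Summable (fun k : Fin 3 → ℤ => ∏ i, mx (k i) ^ (-(4/3) : ℝ)) := by
  apply summable_of_sum_le (c := ∏ _i : Fin 3, ∑' k : ℤ, mx k ^ (-(4/3) : ℝ))
  · intro k
    exact Finset.prod_nonneg (fun i _ => Real.rpow_nonneg (mx_pos _).le _)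
  · intro s
    set t : Fin 3 → Finset ℤ := fun i => s.image (fun k => k i) with ht
    have hst : s ⊆ Fintype.piFinset t := by
      intro k hk
      rw [Fintype.mem_piFinset]
      intro i
      exact Finset.mem_image_of_mem _ hk
    calc _ ≤ ∑ k ∈ Fintype.piFinset t, ∏ i, mx (k i) ^ (-(4/3) : ℝ) :=
          Finset.sum_le_sum_of_subset_of_nonneg hst
            (fun k _ _ => Finset.prod_nonneg (fun i _ => Real.rpow_nonneg (mx_pos _).le _))
      _ = ∏ i, ∑ j ∈ t i, mx j ^ (-(4/3) : ℝ) := by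
          rw [Finset.prod_univ_sum]
      _ ≤ _ := by
          apply Finset.prod_le_prod
          · intro i _
            exact Finset.sum_nonneg (fun j _ => Real.rpow_nonneg (mx_pos _).le _)
          · intro i _
            exact mx_summable.sum_le_tsum _ (fun j _ => Real.rpow_nonneg (mx_pos _).le _)

lemma rho4_bound {a : ℝ} (ha : 0 < a) : ∃ c > 0, ∀ k : Fin 3 → ℤ, k ≠ 0 →
    c ≤ rho a k ∧ (rho a k ^ 4)⁻¹ ≤ c⁻¹ ^ 4 * ∏ i, mx (k i) ^ (-(4/3) : ℝ) := by
  refine ⟨√(min a (1 / a ^ 2)), Real.sqrt_pos.2 (by positivity), ?_⟩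
  intro k hk
  set m := min a (1 / a ^ 2) with hm
  have hm0 : 0 < m := by positivity
  have hr : ∀ i, m * (k i : ℝ) ^ 2 ≤ rho a k ^ 2 := by
    intro i
    have h0 : 0 ≤ a * ((k 0 : ℝ) ^ 2 + (k 1 : ℝ) ^ 2) + (k 2 : ℝ) ^ 2 / a ^ 2 := by positivity
    rw [rho, Real.sq_sqrt h0]
    have q0 : m * (k 0 : ℝ) ^ 2 ≤ a * (k 0 : ℝ) ^ 2 := by gcongr; exact min_le_left _ _
    have q1 : m * (k 1 : ℝ) ^ 2 ≤ a * (k 1 : ℝ) ^ 2 := by gcongr; exact min_le_left _ _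
    have q2 : m * (k 2 : ℝ) ^ 2 ≤ (1 / a ^ 2) * (k 2 : ℝ) ^ 2 := by gcongr; exact min_le_right _ _
    have e2 : (1 / a ^ 2) * (k 2 : ℝ) ^ 2 = (k 2 : ℝ) ^ 2 / a ^ 2 := by ring
    have p0 : 0 ≤ m * (k 0 : ℝ) ^ 2 := by positivity
    have p1 : 0 ≤ m * (k 1 : ℝ) ^ 2 := by positivity
    have p2 : 0 ≤ m * (k 2 : ℝ) ^ 2 := by positivity
    fin_cases i <;> simp <;> nlinarith
  have hρ := rho_pos ha hk
  have hs : 0 < √m := Real.sqrt_pos.2 hm0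
  have hmx : ∀ i, √m * |(k i : ℝ)| ≤ rho a k := by
    intro i
    apply le_of_sq_le_sq _ hρ.le
    rw [mul_pow, Real.sq_sqrt hm0.le, sq_abs]
    exact hr i
  have h1 : √m ≤ rho a k := by
    obtain ⟨i, hi⟩ : ∃ i, k i ≠ 0 := by
      by_contra h; push Not at h; exact hk (funext h)
    have h1 : (1:ℝ) ≤ |(k i:ℝ)| := by
      have := Int.one_le_abs hi
      exact_mod_cast this
    nlinarith [hmx i]
  refine ⟨h1, ?_⟩
  have h2 : ∀ i, mx (k i) ≤ (√m)⁻¹ * rho a k := by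
    intro i
    rw [le_inv_mul_iff₀ hs, mx, mul_max_of_nonneg _ _ hs.le]
    exact max_le (by simpa using h1) (hmx i)
  have h3 : ∀ i, ((√m)⁻¹ * rho a k) ^ (-(4/3) : ℝ) ≤ mx (k i) ^ (-(4/3) : ℝ) := by
    intro i
    exact Real.rpow_le_rpow_of_nonpos (mx_pos _) (h2 i) (by norm_num)
  have h4 : (((√m)⁻¹ * rho a k) ^ 4)⁻¹ ≤ ∏ i, mx (k i) ^ (-(4/3) : ℝ) := by
    calc _ = ∏ _i : Fin 3, ((√m)⁻¹ * rho a k) ^ (-(4/3) : ℝ) := by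
          rw [Finset.prod_const]
          simp only [Finset.card_univ, Fintype.card_fin]
          rw [← Real.rpow_natCast, ← Real.rpow_natCast, ← Real.rpow_mul (by positivity), ← Real.rpow_neg (by positivity)]
          norm_num
      _ ≤ _ := Finset.prod_le_prod (fun i _ => by positivity) (fun i _ => h3 i)
  calc (rho a k ^ 4)⁻¹ = (√m)⁻¹ ^ 4 * (((√m)⁻¹ * rho a k) ^ 4)⁻¹ := by
        field_simp
    _ ≤ _ := by gcongr

lemma ghat_abs {u ρ : ℝ} (hu : 0 ≤ u) (hρ : 0 < ρ) :
    |ghat u ρ| ≤ (3 * u / (4 * π ^ 3)) * (ρ ^ 4)⁻¹ + 3 / (8 * π ^ 4) * (ρ ^ 5)⁻¹ := by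
  have hπ := pi_pos
  unfold ghat
  have c := abs_le.1 (abs_cos_le_one (2 * π * u * ρ))
  have s := abs_le.1 (abs_sin_le_one (2 * π * u * ρ))
  have e1 : |u * cos (2 * π * u * ρ) / (4 * π ^ 3 * ρ ^ 4)| ≤ u / (4 * π ^ 3 * ρ ^ 4) := by
    rw [abs_div, abs_mul, abs_of_nonneg hu, abs_of_pos (by positivity : 0 < 4 * π ^ 3 * ρ ^ 4)]
    gcongr
    exact mul_le_of_le_one_right hu (abs_cos_le_one _)
  have e2 : |3 * sin (2 * π * u * ρ) / (8 * π ^ 4 * ρ ^ 5)| ≤ 3 / (8 * π ^ 4 * ρ ^ 5) := by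
    rw [abs_div, abs_mul, abs_of_pos (by norm_num : (0:ℝ) < 3), abs_of_pos (by positivity : 0 < 8 * π ^ 4 * ρ ^ 5)]
    gcongr
    exact mul_le_of_le_one_right (by norm_num) (abs_sin_le_one _)
  have e3 : |u / (2 * π ^ 3 * ρ ^ 4)| = u / (2 * π ^ 3 * ρ ^ 4) := abs_of_nonneg (by positivity)
  have := abs_add_le (u * cos (2 * π * u * ρ) / (4 * π ^ 3 * ρ ^ 4) - 3 * sin (2 * π * u * ρ) / (8 * π ^ 4 * ρ ^ 5)) (u / (2 * π ^ 3 * ρ ^ 4))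
  have := abs_sub (u * cos (2 * π * u * ρ) / (4 * π ^ 3 * ρ ^ 4)) (3 * sin (2 * π * u * ρ) / (8 * π ^ 4 * ρ ^ 5))
  have e4 : (3 * u / (4 * π ^ 3)) * (ρ ^ 4)⁻¹ + 3 / (8 * π ^ 4) * (ρ ^ 5)⁻¹
    = u / (4 * π ^ 3 * ρ ^ 4) + u / (2 * π ^ 3 * ρ ^ 4) + 3 / (8 * π ^ 4 * ρ ^ 5) := by
    field_simp; ring
  rw [e4]
  linarith

lemma ghat_summable {a : ℝ} (ha : 0 < a) {u : ℝ} (hu : 0 ≤ u) :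
    Summable fun k : Fin 3 → ℤ => if k = 0 then π * u ^ 5 / 15 else ghat u (rho a k) := by
  obtain ⟨c, hc, h⟩ := rho4_bound ha
  refine Summable.of_norm_bounded_eventually
    (g := fun k : Fin 3 → ℤ => ((3 * u / (4 * π ^ 3)) + 3 / (8 * π ^ 4) * c⁻¹) * (c⁻¹ ^ 4 * ∏ i, mx (k i) ^ (-(4/3) : ℝ)))
    ((prod_summable.mul_left _).mul_left _) ?_
  have : {k : Fin 3 → ℤ | k = 0}ᶜ ∈ (Filter.cofinite : Filter (Fin 3 → ℤ)) := by
    rw [Filter.mem_cofinite]; simp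
  filter_upwards [this] with k hk
  have hk : k ≠ 0 := by simpa using hk
  obtain ⟨h1, h2⟩ := h k hk
  have hρ := rho_pos ha hk
  rw [if_neg hk, Real.norm_eq_abs]
  refine (ghat_abs hu hρ).trans ?_
  have h3 : (rho a k ^ 5)⁻¹ ≤ c⁻¹ * (rho a k ^ 4)⁻¹ := by
    rw [pow_succ, mul_inv, mul_comm]
    gcongr
  calc _ ≤ (3 * u / (4 * π ^ 3)) * (rho a k ^ 4)⁻¹ + 3 / (8 * π ^ 4) * (c⁻¹ * (rho a k ^ 4)⁻¹) := by gcongr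
    _ = ((3 * u / (4 * π ^ 3)) + 3 / (8 * π ^ 4) * c⁻¹) * (rho a k ^ 4)⁻¹ := by ring
    _ ≤ _ := by gcongr

noncomputable def N2 (a u : ℝ) : ℝ := ∑' m : Fin 3 → ℤ, Gf u (Qn a (fun i => m i))

theorem N2_hasSum {a : ℝ} (ha : 0 < a) {u : ℝ} (hu : 0 ≤ u) :
    HasSum (fun k : Fin 3 → ℤ => if k = 0 then π * u ^ 5 / 15 else ghat u (rho a k)) (N2 a u) :=
  poisson_N2 ha hu (ghat_summable ha hu)

end EllAux
end P5sec

section P6sec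
namespace EllAux
open MeasureTheory Asymptotics

lemma sand_up {δ s : ℝ} (hδ : 0 < δ) : (if 0 ≤ s then δ ^ 2 else 0) ≤
    (max (s + 2 * δ) 0) ^ 2 / 2 - 2 * ((max (s + δ) 0) ^ 2 / 2) + (max s 0) ^ 2 / 2 := by
  split_ifs with h
  · rw [max_eq_left h, max_eq_left (by linarith), max_eq_left (by linarith)]
    apply le_of_eq; ring
  · push Not at h
    rw [max_eq_right h.le]
    rcases le_total (-δ) s with h1 | h1
    · rw [max_eq_left (by linarith), max_eq_left (by linarith)]
      nlinarith
    · rw [max_eq_right (by linarith : s + δ ≤ 0)]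
      have := sq_nonneg (max (s + 2 * δ) 0)
      norm_num; linarith

lemma sand_lo {δ s : ℝ} (hδ : 0 < δ) :
    (max s 0) ^ 2 / 2 - 2 * ((max (s - δ) 0) ^ 2 / 2) + (max (s - 2 * δ) 0) ^ 2 / 2
      ≤ (if 0 ≤ s then δ ^ 2 else 0)  := by
  split_ifs with h
  · rw [max_eq_left h]
    rcases le_total δ s with h1 | h1
    · rw [max_eq_left (by linarith : 0 ≤ s - δ)]
      rcases le_total (2 * δ) s with h2 | h2
      · rw [max_eq_left (by linarith)]; apply le_of_eq; ring
      · rw [max_eq_right (by linarith)]; nlinarith [sq_nonneg (s - 2 * δ)]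
    · rw [max_eq_right (by linarith : s - δ ≤ 0), max_eq_right (by linarith)]
      nlinarith
  · push Not at h
    rw [max_eq_right h.le, max_eq_right (by linarith), max_eq_right (by linarith)]
    simp

lemma Qn_bound {a : ℝ} (ha : 0 < a) (v : Fin 3 → ℝ) {u : ℝ} (hu : 0 ≤ u) (h : Qn a v ≤ u) (i : Fin 3) :
    |v i| ≤ max (u * √a) (u / a) := by
  have hQ2 : (v 0 ^ 2 + v 1 ^ 2) / a + a ^ 2 * v 2 ^ 2 ≤ u ^ 2 := by
    have h0 : 0 ≤ (v 0 ^ 2 + v 1 ^ 2) / a + a ^ 2 * v 2 ^ 2 := by positivity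
    rw [← Real.sq_sqrt h0]
    have : 0 ≤ Qn a v := Real.sqrt_nonneg _
    exact pow_le_pow_left₀ this h 2
  have h2 : 0 ≤ a ^ 2 * v 2 ^ 2 := by positivity
  have h01 : (v 0 ^ 2 + v 1 ^ 2) / a ≤ u ^ 2 := by linarith
  rw [div_le_iff₀ ha] at h01
  have h0 : 0 ≤ (v 0 ^ 2 + v 1 ^ 2) / a := by positivity
  have hsq : (u * √a) ^ 2 = u ^ 2 * a := by rw [mul_pow, Real.sq_sqrt ha.le]
  fin_cases i
  · apply le_max_of_le_left
    apply abs_le_of_sq_le_sq _ (by positivity)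
    rw [hsq]; simp; nlinarith [sq_nonneg (v 1)]
  · apply le_max_of_le_left
    apply abs_le_of_sq_le_sq _ (by positivity)
    rw [hsq]; simp; nlinarith [sq_nonneg (v 0)]
  · apply le_max_of_le_right
    apply abs_le_of_sq_le_sq _ (by positivity)
    rw [div_pow, le_div_iff₀ (by positivity)]
    simp; linarith

/-- the number of lattice points -/
noncomputable def Nc (a R : ℝ) : ℝ := (Set.ncard {m : Fin 3 → ℤ | Qn a (fun i => (m i : ℝ)) ≤ R} : ℝ)

lemma exists_box {a : ℝ} (ha : 0 < a) {u : ℝ} (hu : 0 ≤ u) : ∃ s : Finset (Fin 3 → ℤ),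
    ∀ m : Fin 3 → ℤ, Qn a (fun i => (m i : ℝ)) ≤ u → m ∈ s := by
  refine ⟨ibox ⌈max (u * √a) (u / a)⌉, fun m hm => ?_⟩
  simp only [ibox, Fintype.mem_piFinset, Finset.mem_Icc]
  intro i
  have := Qn_bound ha _ hu hm i
  have h2 : |(m i : ℝ)| ≤ (⌈max (u * √a) (u / a)⌉ : ℝ) := this.trans (Int.le_ceil _)
  have h3 := abs_le.1 h2
  constructor
  · exact_mod_cast h3.1
  · exact_mod_cast h3.2

lemma N2_finsum {a u v : ℝ} {s : Finset (Fin 3 → ℤ)}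
    (hs : ∀ m : Fin 3 → ℤ, Qn a (fun i => (m i : ℝ)) ≤ v → m ∈ s) (huv : u ≤ v) :
    N2 a u = ∑ m ∈ s, Gf u (Qn a (fun i => (m i : ℝ))) := by
  apply tsum_eq_sum
  intro m hm
  have : ¬ Qn a (fun i => (m i : ℝ)) ≤ v := fun h => hm (hs m h)
  have : u - Qn a (fun i => (m i : ℝ)) ≤ 0 := by linarith
  simp [Gf, max_eq_right this]

lemma Nc_finsum {a R v : ℝ} {s : Finset (Fin 3 → ℤ)}
    (hs : ∀ m : Fin 3 → ℤ, Qn a (fun i => (m i : ℝ)) ≤ v → m ∈ s) (huv : R ≤ v) :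
    Nc a R = ∑ m ∈ s, if 0 ≤ R - Qn a (fun i => (m i : ℝ)) then (1:ℝ) else 0 := by
  classical
  have : {m : Fin 3 → ℤ | Qn a (fun i => (m i : ℝ)) ≤ R}
     = ((s.filter (fun m => 0 ≤ R - Qn a (fun i => (m i : ℝ))) : Finset (Fin 3 → ℤ)) : Set (Fin 3 → ℤ)) := by
    ext m
    simp only [Set.mem_ofPred_eq, Finset.coe_filter]
    constructor
    · intro h; exact ⟨hs m (h.trans huv), by linarith⟩
    · rintro ⟨_, h⟩; linarith
  rw [Nc, this, Set.ncard_coe_finset, Finset.sum_boole]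

lemma sandwich_up {a R δ : ℝ} (ha : 0 < a) (hR : 0 ≤ R) (hδ : 0 < δ) :
    Nc a R * δ ^ 2 ≤ N2 a (R + 2 * δ) - 2 * N2 a (R + δ) + N2 a R := by
  obtain ⟨s, hs⟩ := exists_box ha (u := R + 2 * δ) (by linarith)
  rw [Nc_finsum hs (by linarith), N2_finsum hs le_rfl, N2_finsum hs (u := R + δ) (by linarith),
    N2_finsum hs (u := R) (by linarith), Finset.sum_mul, Finset.mul_sum, ← Finset.sum_sub_distrib,
    ← Finset.sum_add_distrib]
  apply Finset.sum_le_sum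
  intro m _
  have := sand_up (s := R - Qn a (fun i => (m i : ℝ))) hδ
  simp only [Gf]
  rw [ite_mul, one_mul, zero_mul, add_sub_right_comm, add_sub_right_comm]
  exact this

lemma sandwich_lo {a R δ : ℝ} (ha : 0 < a) (hR : 0 ≤ R) (hδ : 0 < δ) :
    N2 a R - 2 * N2 a (R - δ) + N2 a (R - 2 * δ) ≤ Nc a R * δ ^ 2 := by
  obtain ⟨s, hs⟩ := exists_box ha (u := R) hR
  rw [Nc_finsum hs le_rfl, N2_finsum hs le_rfl, N2_finsum hs (u := R - δ) (by linarith),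
    N2_finsum hs (u := R - 2 * δ) (by linarith), Finset.sum_mul, Finset.mul_sum, ← Finset.sum_sub_distrib,
    ← Finset.sum_add_distrib]
  apply Finset.sum_le_sum
  intro m _
  have := sand_lo (s := R - Qn a (fun i => (m i : ℝ))) hδ
  simp only [Gf]
  rw [ite_mul, one_mul, zero_mul, sub_right_comm, sub_right_comm R (2 * δ)]
  exact this

/-- second difference -/
noncomputable def tau (c δ ρ : ℝ) : ℝ := ghat (c + δ) ρ - 2 * ghat c ρ + ghat (c - δ) ρ

lemma ghat_zero (u : ℝ) : ghat u 0 = 0 := by simp [ghat]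

noncomputable def rh (a : ℝ) (n k : ℕ) : ℝ := √(a * n + (k:ℝ) ^ 2 / a ^ 2)

noncomputable def zt (c δ : ℝ) : ℝ := π * (c + δ) ^ 5 / 15 - 2 * (π * c ^ 5 / 15) + π * (c - δ) ^ 5 / 15

lemma tau_hasSum {a c δ : ℝ} (ha : 0 < a) (hδ : 0 < δ) (hc : δ ≤ c) :
    HasSum (fun k : Fin 3 → ℤ => tau c δ (rho a k) + if k = 0 then zt c δ else 0)
      (N2 a (c + δ) - 2 * N2 a c + N2 a (c - δ)) := by
  have h := ((N2_hasSum ha (u := c + δ) (by linarith)).sub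
    ((N2_hasSum ha (u := c) (by linarith)).mul_left 2)).add (N2_hasSum ha (u := c - δ) (by linarith))
  refine h.congr_fun fun k => ?_
  by_cases hk : k = 0
  · have : rho a 0 = 0 := by simp [rho]
    simp [hk, this, tau, ghat_zero, zt]
  · simp [hk, tau]

lemma tau_hasSum' {a c δ : ℝ} (ha : 0 < a) (hδ : 0 < δ) (hc : δ ≤ c) :
    HasSum (fun k : Fin 3 → ℤ => tau c δ (rho a k))
      (N2 a (c + δ) - 2 * N2 a c + N2 a (c - δ) - zt c δ) := by
  have h := (tau_hasSum ha hδ hc).sub (hasSum_ite_eq (0 : Fin 3 → ℤ) (zt c δ))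
  simpa using h

/-- number of representations as a sum of two squares -/
noncomputable def r2 (n : ℕ) : ℕ :=
  (((Finset.Icc (-(n:ℤ)) n) ×ˢ (Finset.Icc (-(n:ℤ)) n)).filter (fun p => p.1 ^ 2 + p.2 ^ 2 = (n:ℤ))).card

noncomputable def bsum (a c δ : ℝ) (M : ℕ) : ℝ :=
  ∑ n ∈ Finset.range M, (r2 n : ℝ) * (tau c δ (rh a n 0) + 2 * ∑ k ∈ Finset.Ico 1 M, tau c δ (rh a n k))

noncomputable def discF (M : ℕ) : Finset (ℤ × ℤ) :=
  ((Finset.Icc (-(M:ℤ)) M) ×ˢ (Finset.Icc (-(M:ℤ)) M)).filter (fun p => p.1 ^ 2 + p.2 ^ 2 < (M:ℤ))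

lemma abs_le_of_sq_eq {p q n : ℤ} (h : p ^ 2 + q ^ 2 = n) : -n ≤ p ∧ p ≤ n := by
  constructor <;> nlinarith [sq_nonneg p, sq_nonneg q, sq_nonneg (p-1), sq_nonneg (p+1), mul_self_nonneg p, Int.le_self_sq p, Int.le_self_sq (-p)]

lemma discF_sum (M : ℕ) (f : ℕ → ℝ) :
    ∑ p ∈ discF M, f (p.1 ^ 2 + p.2 ^ 2).toNat = ∑ n ∈ Finset.range M, (r2 n : ℝ) * f n := by
  rw [← Finset.sum_fiberwise_of_maps_to (s := discF M) (t := Finset.range M)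
    (g := fun p => (p.1 ^ 2 + p.2 ^ 2).toNat)]
  · apply Finset.sum_congr rfl
    intro n hn
    have hn := Finset.mem_range.1 hn
    rw [Finset.sum_congr rfl (g := fun _ => f n)]
    · rw [Finset.sum_const, nsmul_eq_mul]
      congr 2
      rw [r2]
      congr 1
      ext ⟨p, q⟩
      simp only [discF, Finset.mem_filter, Finset.mem_product, Finset.mem_Icc]
      constructor
      · rintro ⟨⟨_, h2⟩, h3⟩
        have h4 : p ^ 2 + q ^ 2 = n := by
          have : 0 ≤ p ^ 2 + q ^ 2 := by positivity
          omega
        have h5 : q ^ 2 + p ^ 2 = n := by omega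
        exact ⟨⟨abs_le_of_sq_eq h4, abs_le_of_sq_eq h5⟩, h4⟩
      · rintro ⟨⟨⟨a1, a2⟩, ⟨a3, a4⟩⟩, h4⟩
        refine ⟨⟨⟨⟨by omega, by omega⟩, ⟨by omega, by omega⟩⟩, by omega⟩, by omega⟩
    · intro p hp
      rw [(Finset.mem_filter.1 hp).2]
  · intro p hp
    simp only [discF, Finset.mem_filter] at hp
    have : 0 ≤ p.1 ^ 2 + p.2 ^ 2 := by positivity
    simp only [Finset.mem_range]
    omega

lemma symm_sum (M : ℕ) (hM : 1 ≤ M) (f : ℕ → ℝ) :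
    ∑ k ∈ Finset.Ioo (-(M:ℤ)) M, f k.natAbs = f 0 + 2 * ∑ k ∈ Finset.Ico 1 M, f k := by
  induction M, hM using Nat.le_induction with
  | base => 
    have : Finset.Ioo (-((1:ℕ):ℤ)) (1:ℕ) = {0} := by decide
    rw [this]; simp
  | succ M hM ih =>
    have : Finset.Ioo (-((M+1:ℕ):ℤ)) (M+1:ℕ) = insert (M:ℤ) (insert (-(M:ℤ)) (Finset.Ioo (-(M:ℤ)) M)) := by
      ext k; simp only [Finset.mem_Ioo, Finset.mem_insert]; push_cast; omega
    rw [this, Finset.sum_insert, Finset.sum_insert, ih, Finset.sum_Ico_succ_top hM]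
    · simp; ring
    · simp
    · simp; omega

def e3 : (ℤ × ℤ) × ℤ ≃ (Fin 3 → ℤ) where
  toFun p := ![p.1.1, p.1.2, p.2]
  invFun k := ((k 0, k 1), k 2)
  left_inv p := by simp
  right_inv k := by ext i; fin_cases i <;> rfl

lemma bsum_eq (a c δ : ℝ) (M : ℕ) (hM : 1 ≤ M) :
    ∑ p ∈ discF M ×ˢ Finset.Ioo (-(M:ℤ)) M, tau c δ (rho a (e3 p)) = bsum a c δ M := by
  rw [Finset.sum_product, bsum, ← discF_sum M (fun n => tau c δ (rh a n 0) + 2 * ∑ k ∈ Finset.Ico 1 M, tau c δ (rh a n k))]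
  apply Finset.sum_congr rfl
  intro p _
  rw [← symm_sum M hM (fun k => tau c δ (rh a (p.1 ^ 2 + p.2 ^ 2).toNat k))]
  apply Finset.sum_congr rfl
  intro k _
  congr 1
  simp only [rho, rh, e3]
  have h0 : 0 ≤ p.1 ^ 2 + p.2 ^ 2 := by positivity
  have h1 : (((p.1 ^ 2 + p.2 ^ 2).toNat : ℕ) : ℝ) = (p.1:ℝ) ^ 2 + (p.2 : ℝ) ^ 2 := by
    have : (((p.1 ^ 2 + p.2 ^ 2).toNat : ℕ) : ℤ) = p.1 ^ 2 + p.2 ^ 2 := Int.toNat_of_nonneg h0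
    have : ((((p.1 ^ 2 + p.2 ^ 2).toNat : ℕ) : ℤ) : ℝ) = ((p.1 ^ 2 + p.2 ^ 2 : ℤ) : ℝ) := by rw [this]
    push_cast at this
    simpa using this
  have h2 : ((k.natAbs : ℕ) : ℝ) ^ 2 = (k:ℝ) ^ 2 := by
    rw [Nat.cast_natAbs, Int.cast_abs, sq_abs]
  rw [h1, h2]
  simp

lemma limit_bound {a c δ E : ℝ} (ha : 0 < a) (hδ : 0 < δ) (hc : δ ≤ c)
    (hE : ∀ m : ℕ, |bsum a c δ (2 ^ m)| ≤ E) :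
    |N2 a (c + δ) - 2 * N2 a c + N2 a (c - δ) - zt c δ| ≤ E := by
  have h := (e3.hasSum_iff (f := fun k => tau c δ (rho a k))).2 (tau_hasSum' ha hδ hc)
  have hT : Filter.Tendsto (fun m : ℕ => discF (2 ^ m) ×ˢ Finset.Ioo (-((2 ^ m : ℕ):ℤ)) (2 ^ m : ℕ))
      Filter.atTop Filter.atTop := by
    apply Filter.tendsto_atTop_finset_of_monotone
    · intro m n hmn p hp
      have : (2 ^ m : ℕ) ≤ 2 ^ n := Nat.pow_le_pow_right (by norm_num) hmn
      have : ((2 ^ m : ℕ) : ℤ) ≤ (2 ^ n : ℕ) := by exact_mod_cast this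
      simp only [discF, Finset.mem_product, Finset.mem_filter, Finset.mem_Icc, Finset.mem_Ioo] at hp ⊢
      omega
    · rintro ⟨⟨p, q⟩, k⟩
      obtain ⟨m, hm⟩ : ∃ m : ℕ, (p ^ 2 + q ^ 2 + k ^ 2 + |p| + |q| + |k|).toNat < 2 ^ m := ⟨_, Nat.lt_two_pow_self⟩
      refine ⟨m, ?_⟩
      have h1 : p ^ 2 + q ^ 2 + k ^ 2 + |p| + |q| + |k| < ((2 ^ m : ℕ) : ℤ) := by omega
      have a1 := sq_nonneg p
      have a2 := sq_nonneg q
      have a3 := sq_nonneg k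
      have b1 := le_abs_self p
      have b2 := le_abs_self q
      have b3 := le_abs_self k
      have c1 := neg_abs_le p
      have c2 := neg_abs_le q
      have c3 := neg_abs_le k
      simp only [discF, Finset.mem_product, Finset.mem_filter, Finset.mem_Icc, Finset.mem_Ioo]
      refine ⟨⟨⟨⟨?_, ?_⟩, ?_, ?_⟩, ?_⟩, ?_, ?_⟩ <;> linarith
  have h2 := (h.comp hT).abs
  refine le_of_tendsto h2 (Filter.Eventually.of_forall (fun m => ?_))
  have := hE m
  rw [← bsum_eq _ _ _ _ Nat.one_le_two_pow] at this
  exact this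

end EllAux
end P6sec

section M1sec
namespace EllAux

noncomputable def ee (t : ℝ) : ℂ := Complex.exp (2 * π * t * Complex.I)

lemma ee_norm (t : ℝ) : ‖ee t‖ = 1 := by
  have : (2 * π * t * Complex.I : ℂ) = ((2 * π * t : ℝ) : ℂ) * Complex.I := by push_cast; ring
  rw [ee, this, Complex.norm_exp_ofReal_mul_I]

lemma ee_add (s t : ℝ) : ee (s + t) = ee s * ee t := by
  rw [ee, ee, ee, ← Complex.exp_add]; congr 1; push_cast; ring

lemma ee_int (n : ℤ) : ee n = 1 := by
  rw [ee]
  have : (2 * π * ((n:ℝ):ℂ) * Complex.I : ℂ) = n * (2 * π * Complex.I) := by push_cast; ring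
  rw [this, Complex.exp_int_mul_two_pi_mul_I]

lemma ee_neg (t : ℝ) : ee (-t) = (starRingEnd ℂ) (ee t) := by
  rw [ee, ee, ← Complex.exp_conj]; congr 1; simp [map_ofNat]

noncomputable def Gk (d : ℝ) : ℂ := -(1/2) - (Complex.I / 2) * ((cos (π * d) / sin (π * d) : ℝ) : ℂ)

lemma Gk_mul (d : ℝ) (h : sin (π * d) ≠ 0) : ee d * Gk d = 1 + Gk d := by
  have e : ee d = ((cos (π * d) : ℝ) + (sin (π * d) : ℝ) * Complex.I : ℂ) ^ 2 := by
    rw [ee]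
    have : (2 * π * d * Complex.I : ℂ) = ((2:ℕ):ℂ) * (((π * d : ℝ) : ℂ) * Complex.I) := by push_cast; ring
    rw [this, Complex.exp_nat_mul, Complex.exp_mul_I, Complex.ofReal_cos, Complex.ofReal_sin]
  rw [e, Gk]
  push_cast [← Complex.ofReal_cos, ← Complex.ofReal_sin]
  set c := cos (π * d)
  set s := sin (π * d)
  have hs : (s : ℂ) ≠ 0 := by exact_mod_cast h
  have hcs : (c : ℂ) ^ 2 + (s : ℂ) ^ 2 = 1 := by
    exact_mod_cast (cos_sq_add_sin_sq (π * d))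
  have hI : Complex.I ^ 2 = -1 := Complex.I_sq
  field_simp
  linear_combination (c + s * Complex.I) * (-Complex.I) * hcs + (-(c + s * Complex.I) * c * s - s) * hI

lemma Gk_norm (d : ℝ) (h : 0 < sin (π * d)) : ‖Gk d‖ = 1 / (2 * sin (π * d)) := by
  have : ‖Gk d‖ ^ 2 = (1 / (2 * sin (π * d))) ^ 2 := by
    rw [Complex.sq_norm, Gk, Complex.normSq_apply]
    simp [-Complex.ofReal_div]
    field_simp
    linear_combination (cos_sq_add_sin_sq (π * d))
  exact (sq_eq_sq₀ (norm_nonneg _) (by positivity)).1 this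

lemma Gk_norm' (d : ℝ) (h : 0 < sin (π * d)) : ‖1 + Gk d‖ = 1 / (2 * sin (π * d)) := by
  rw [← Gk_mul d h.ne', norm_mul, ee_norm, one_mul, Gk_norm d h]

lemma half_cot {y t : ℝ} (ht : 0 < t) (h1 : t ≤ y) (h2 : y < π) : (1 + cos y) / sin y ≤ 2 / t := by
  have hy : 0 < y := by linarith
  have hs : 0 < sin (y / 2) := sin_pos_of_pos_of_lt_pi (by linarith) (by linarith)
  have hc : 0 < cos (y / 2) := cos_pos_of_mem_Ioo ⟨by linarith, by linarith⟩
  have h3 := Real.lt_tan (x := y / 2) (by linarith) (by linarith)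
  rw [Real.tan_eq_sin_div_cos, lt_div_iff₀ hc] at h3
  have e1 : cos y = 2 * cos (y / 2) ^ 2 - 1 := by rw [← cos_two_mul]; congr 1; ring
  have e2 : sin y = 2 * sin (y / 2) * cos (y / 2) := by rw [← sin_two_mul]; congr 1; ring
  have e3 : (1 + cos y) / sin y = cos (y / 2) / sin (y / 2) := by
    rw [e1, e2]; field_simp; ring
  rw [e3, div_le_div_iff₀ hs ht]
  nlinarith

lemma half_tan {y t : ℝ} (ht : 0 < t) (h0 : 0 < y) (h1 : y ≤ π - t) : (1 - cos y) / sin y ≤ 2 / t := by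
  have := half_cot (y := π - y) ht (by linarith) (by linarith)
  rwa [cos_pi_sub, sin_pi_sub, ← sub_eq_add_neg] at this

lemma cot_diff {x y : ℝ} (h0 : 0 < x) (hxy : x ≤ y) (hy : y < π) :
    cos y / sin y ≤ cos x / sin x := by
  have hs : 0 < sin x := sin_pos_of_pos_of_lt_pi h0 (by linarith)
  have hs' : 0 < sin y := sin_pos_of_pos_of_lt_pi (by linarith) hy
  rw [div_le_div_iff₀ hs' hs]
  have := sin_nonneg_of_nonneg_of_le_pi (x := y - x) (by linarith) (by linarith)
  rw [sin_sub] at this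
  linarith

lemma Gk_diff {x y : ℝ} (h0 : 0 < x) (hxy : x ≤ y) (hy : y < 1) :
    ‖Gk x - Gk y‖ = (cos (π * x) / sin (π * x) - cos (π * y) / sin (π * y)) / 2 := by
  have hπ := pi_pos
  have h := cot_diff (x := π * x) (y := π * y) (by positivity) (by gcongr) (by nlinarith)
  have e : Gk x - Gk y = (((cos (π * x) / sin (π * x) - cos (π * y) / sin (π * y)) / 2 : ℝ) : ℂ) * (-Complex.I) := by
    simp only [Gk]; push_cast; ring
  rw [e, norm_mul, norm_neg, Complex.norm_I, mul_one, Complex.norm_real, Real.norm_of_nonneg]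
  linarith

/-- Kuzmin-Landau, normalised -/
lemma kl0 {θ : ℝ} (hθ : 0 < θ) (f : ℕ → ℝ) (m : ℕ)
    (hd : ∀ i, i ≤ m → θ ≤ f (i + 1) - f i ∧ f (i + 1) - f i ≤ 1 - θ)
    (hm : ∀ i, i < m → f (i + 1) - f i ≤ f (i + 2) - f (i + 1)) :
    ‖∑ i ∈ Finset.range (m + 1), ee (f i) - ee (f (m + 1)) * Gk (f (m + 1) - f m)‖
      ≤ 1 / (2 * sin (π * (f 1 - f 0))) + (cos (π * (f 1 - f 0)) / sin (π * (f 1 - f 0))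
        - cos (π * (f (m + 1) - f m)) / sin (π * (f (m + 1) - f m))) / 2 := by
  have hπ := pi_pos
  have hsin : ∀ d, θ ≤ d → d ≤ 1 - θ → 0 < sin (π * d) := fun d h1 h2 =>
    sin_pos_of_pos_of_lt_pi (by nlinarith) (by nlinarith)
  have hE : ∀ i, i ≤ m → ee (f (i + 1)) * Gk (f (i + 1) - f i) = ee (f i) * (1 + Gk (f (i + 1) - f i)) := by
    intro i hi
    have h := hd i hi
    rw [← Gk_mul _ (hsin _ h.1 h.2).ne', ← mul_assoc, ← ee_add]
    congr 2; ring
  induction m with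
  | zero =>
    have h := hd 0 le_rfl
    have h2 := hE 0 le_rfl
    simp only [zero_add] at h2 h ⊢
    rw [Finset.sum_range_one, h2, sub_self, zero_div, add_zero]
    have : ee (f 0) - ee (f 0) * (1 + Gk (f 1 - f 0)) = - (ee (f 0) * Gk (f 1 - f 0)) := by ring
    rw [this, norm_neg, norm_mul, ee_norm, one_mul, Gk_norm _ (hsin _ h.1 h.2)]
  | succ m ih =>
    have ih := ih (fun i hi => hd i (by omega)) (fun i hi => hm i (by omega)) (fun i hi => hE i (by omega))
    have h1 := hE (m + 1) le_rfl
    rw [Finset.sum_range_succ, h1]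
    have e : ∑ i ∈ Finset.range (m + 1), ee (f i) + ee (f (m + 1)) - ee (f (m + 1)) * (1 + Gk (f (m + 1 + 1) - f (m + 1)))
      = (∑ i ∈ Finset.range (m + 1), ee (f i) - ee (f (m + 1)) * Gk (f (m + 1) - f m))
        + ee (f (m + 1)) * (Gk (f (m + 1) - f m) - Gk (f (m + 1 + 1) - f (m + 1))) := by ring
    rw [e]
    refine (norm_add_le _ _).trans ?_
    have a1 := hd m (by omega)
    have a2 := hd (m + 1) le_rfl
    rw [norm_mul, ee_norm, one_mul, Gk_diff (by linarith) (hm m (by omega)) (by linarith)]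
    linarith

lemma kl1 {θ : ℝ} (hθ : 0 < θ) (f : ℕ → ℝ) (M : ℕ)
    (hd : ∀ i, i + 1 < M → θ ≤ f (i + 1) - f i ∧ f (i + 1) - f i ≤ 1 - θ)
    (hm : ∀ i, i + 2 < M → f (i + 1) - f i ≤ f (i + 2) - f (i + 1)) (hθ1 : θ ≤ 1) :
    ‖∑ i ∈ Finset.range M, ee (f i)‖ ≤ 1 / θ := by
  have hπ := pi_pos
  have h1θ : 1 ≤ 1 / θ := by rw [le_div_iff₀ hθ]; linarith
  rcases M with _ | _ | m
  · simp; exact hθ.le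
  · simp [ee_norm]; simpa using h1θ
  have h := kl0 hθ f m (fun i hi => hd i (by omega)) (fun i hi => hm i (by omega))
  rw [Finset.sum_range_succ]
  have e : ∑ i ∈ Finset.range (m + 1), ee (f i) + ee (f (m + 1))
    = (∑ i ∈ Finset.range (m + 1), ee (f i) - ee (f (m + 1)) * Gk (f (m + 1) - f m))
      + ee (f (m + 1)) * (1 + Gk (f (m + 1) - f m)) := by ring
  rw [e]
  refine (norm_add_le _ _).trans ?_
  have a0 := hd 0 (by omega)
  have a1 := hd m (by omega)
  simp only [zero_add] at a0
  have hs1 : 0 < sin (π * (f (m + 1) - f m)) := sin_pos_of_pos_of_lt_pi (by nlinarith) (by nlinarith)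
  have hs0 : 0 < sin (π * (f 1 - f 0)) := sin_pos_of_pos_of_lt_pi (by nlinarith) (by nlinarith)
  rw [norm_mul, ee_norm, one_mul, Gk_norm' _ hs1]
  have b0 := half_cot (y := π * (f 1 - f 0)) (t := π * θ) (by positivity) (by nlinarith) (by nlinarith)
  have b1 := half_tan (y := π * (f (m + 1) - f m)) (t := π * θ) (by positivity) (by nlinarith) (by nlinarith)
  have b2 : 2 / (π * θ) ≤ 1 / θ := by
    rw [div_le_div_iff₀ (by positivity) hθ]
    nlinarith [pi_gt_three]
  rw [add_div] at b0
  rw [sub_div] at b1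
  have c0 : 1 / (2 * sin (π * (f 1 - f 0))) = (1 / sin (π * (f 1 - f 0))) / 2 := by field_simp
  have c1 : 1 / (2 * sin (π * (f (m + 1) - f m))) = (1 / sin (π * (f (m + 1) - f m))) / 2 := by field_simp
  rw [c0] at h
  rw [c1]
  linarith

/-- Kuzmin-Landau -/
theorem kuzmin_landau {θ : ℝ} (hθ : 0 < θ) (hθ1 : θ ≤ 1) (f : ℕ → ℝ) (M : ℕ) (ν : ℤ)
    (hd : ∀ i, i + 1 < M → ν + θ ≤ f (i + 1) - f i ∧ f (i + 1) - f i ≤ ν + 1 - θ)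
    (hm : ∀ i, i + 2 < M → f (i + 1) - f i ≤ f (i + 2) - f (i + 1)) :
    ‖∑ i ∈ Finset.range M, ee (f i)‖ ≤ 1 / θ := by
  have e : ∀ i, ee (f i) = ee (f i - ν * i) := by
    intro i
    have : f i = (f i - ν * i) + ((ν * i : ℤ) : ℝ) := by push_cast; ring
    rw [this, ee_add, ee_int, mul_one]; congr 1; push_cast; ring
  rw [Finset.sum_congr rfl (fun i _ => e i)]
  apply kl1 hθ _ M _ _ hθ1
  · intro i hi
    have := hd i hi
    push_cast
    constructor <;> nlinarith
  · intro i hi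
    have := hm i hi
    push_cast
    nlinarith

end EllAux
end M1sec

section M2sec
namespace EllAux

lemma conv_eq_Ico (S : Finset ℕ) (hS : S.Nonempty)
    (hc : ∀ i j k, i ∈ S → k ∈ S → i ≤ j → j ≤ k → j ∈ S) :
    S = Finset.Ico (S.min' hS) (S.max' hS + 1) := by
  ext j
  rw [Finset.mem_Ico]
  constructor
  · intro hj
    exact ⟨Finset.min'_le _ _ hj, Nat.lt_succ_of_le (Finset.le_max' _ _ hj)⟩
  · rintro ⟨h1, h2⟩
    exact hc _ j _ (Finset.min'_mem S hS) (Finset.max'_mem S hS) h1 (Nat.lt_succ_iff.1 h2)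

lemma kl_conv {θ : ℝ} (hθ : 0 < θ) (hθ1 : θ ≤ 1) (f : ℕ → ℝ) (S : Finset ℕ) (ν : ℤ)
    (hc : ∀ i j k, i ∈ S → k ∈ S → i ≤ j → j ≤ k → j ∈ S)
    (hd : ∀ i ∈ S, ν + θ ≤ f (i + 1) - f i ∧ f (i + 1) - f i ≤ ν + 1 - θ)
    (hm : ∀ i, i ∈ S → i + 1 ∈ S → f (i + 1) - f i ≤ f (i + 2) - f (i + 1)) :
    ‖∑ i ∈ S, ee (f i)‖ ≤ 1 / θ := by
  rcases S.eq_empty_or_nonempty with h | h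
  · simp [h]; exact hθ.le
  have e := conv_eq_Ico S h hc
  set p := S.min' h
  set q := S.max' h + 1
  have hmem : ∀ i, i < q - p → p + i ∈ S := by
    intro i hi; rw [e, Finset.mem_Ico]; omega
  rw [e, Finset.sum_Ico_eq_sum_range]
  apply kuzmin_landau hθ hθ1 (fun i => f (p + i)) (q - p) ν
  · intro i hi
    exact hd (p + i) (hmem i (by omega))
  · intro i hi
    exact hm (p + i) (hmem i (by omega)) (hmem (i + 1) (by omega))

lemma near_conv {θ lam ν : ℝ} (hl : 0 < lam) (hθ : 0 < θ) (d : ℕ → ℝ) (S : Finset ℕ)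
    (hd : ∀ i ∈ S, ν - θ ≤ d i ∧ d i ≤ ν + θ)
    (hm : ∀ i j, i ∈ S → j ∈ S → i ≤ j → lam * ((j:ℝ) - i) ≤ d j - d i) :
    (S.card : ℝ) ≤ 2 * θ / lam + 1 := by
  rcases S.eq_empty_or_nonempty with h | h
  · simp [h]; positivity
  have e : S ⊆ Finset.Icc (S.min' h) (S.max' h) := fun j hj =>
    Finset.mem_Icc.2 ⟨Finset.min'_le _ _ hj, Finset.le_max' _ _ hj⟩
  have h1 := Finset.card_le_card e
  rw [Nat.card_Icc] at h1
  have hmin := Finset.min'_mem S h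
  have hmax := Finset.max'_mem S h
  have hle : S.min' h ≤ S.max' h := Finset.min'_le _ _ hmax
  have h2 := hm _ _ hmin hmax hle
  have h3 := hd _ hmin
  have h4 := hd _ hmax
  have h5 : (S.card : ℝ) ≤ (S.max' h : ℝ) - S.min' h + 1 := by
    have : S.card + S.min' h ≤ S.max' h + 1 := by omega
    have : (S.card : ℝ) + S.min' h ≤ S.max' h + 1 := by exact_mod_cast this
    linarith
  have h6 : (S.max' h : ℝ) - S.min' h ≤ 2 * θ / lam := by
    rw [le_div_iff₀ hl]; linarith
  linarith

/-- discrete second derivative test -/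
theorem second_test {lam μ : ℝ} (hl : 0 < lam) (hlm : lam ≤ μ) (f : ℕ → ℝ) (M : ℕ)
    (h : ∀ i, i + 2 < M → lam ≤ (f (i + 2) - f (i + 1)) - (f (i + 1) - f i) ∧
      (f (i + 2) - f (i + 1)) - (f (i + 1) - f i) ≤ μ) :
    ‖∑ i ∈ Finset.range M, ee (f i)‖ ≤ 5 * (μ * M + 2) / √lam := by
  have hμ : 0 ≤ μ := by linarith
  have hs : 0 < √lam := Real.sqrt_pos.2 hl
  have hss : √lam * √lam = lam := Real.mul_self_sqrt hl.le
  have hM0 : (0:ℝ) ≤ M := by positivity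
  have triv : ‖∑ i ∈ Finset.range M, ee (f i)‖ ≤ M := by
    refine (norm_sum_le _ _).trans ?_
    simp [ee_norm]
  rcases lt_or_ge (1/4) lam with hl4 | hl4
  · refine triv.trans ?_
    rw [le_div_iff₀ hs]
    have : 1/2 ≤ √lam := by
      apply Real.le_sqrt_of_sq_le; norm_num; linarith
    have h1 : (M:ℝ) * √lam ≤ M * (2 * lam) := by
      gcongr; nlinarith
    nlinarith [mul_le_mul_of_nonneg_right hlm hM0]
  have hθ2 : √lam ≤ 1 / 2 := by
    apply Real.sqrt_le_iff.2; constructor <;> norm_num; linarith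
  obtain ⟨θ, hθdef⟩ : ∃ θ, θ = √lam := ⟨_, rfl⟩
  rw [← hθdef] at hs hss hθ2 ⊢
  rcases le_or_gt M 1 with hM | hM
  · refine triv.trans ?_
    rw [le_div_iff₀ hs]
    have : (M:ℝ) ≤ 1 := by exact_mod_cast hM
    nlinarith [mul_nonneg hμ hM0]
  obtain ⟨m, rfl⟩ : ∃ m, M = m + 2 := ⟨M - 2, by omega⟩
  set d : ℕ → ℝ := fun i => f (i + 1) - f i with hd
  have hlo : ∀ i j, i ≤ j → j ≤ m → lam * ((j:ℝ) - i) ≤ d j - d i := by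
    intro i j hij
    induction j, hij using Nat.le_induction with
    | base => intro _; simp
    | succ j hj ih =>
      intro hjm
      have h1 := ih (by omega)
      have h2 := (h j (by omega)).1
      push_cast
      simp only [hd] at h1 ⊢
      linarith
  have hup : ∀ i j, i ≤ j → j ≤ m → d j - d i ≤ μ * ((j:ℝ) - i) := by
    intro i j hij
    induction j, hij using Nat.le_induction with
    | base => intro _; simp
    | succ j hj ih =>
      intro hjm
      have h1 := ih (by omega)
      have h2 := (h j (by omega)).2
      push_cast
      simp only [hd] at h1 ⊢
      linarith
  have hmono : ∀ i j, i ≤ j → j ≤ m → d i ≤ d j := by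
    intro i j hij hj
    have h1 := hlo i j hij hj
    have : (i:ℝ) ≤ j := by exact_mod_cast hij
    nlinarith
  set c : ℕ → ℤ := fun i => ⌊d i + 1 / 2⌋ with hcdef
  have hcmono : ∀ i j, i ≤ j → j ≤ m → c i ≤ c j := fun i j hij hj =>
    Int.floor_le_floor (by linarith [hmono i j hij hj])
  rw [Finset.sum_range_succ]
  have hcell : ∀ ν : ℤ, ‖∑ i ∈ (Finset.range (m + 1)).filter (fun i => c i = ν), ee (f i)‖ ≤ 4.5 / θ := by
    intro ν
    set F := (Finset.range (m + 1)).filter (fun i => c i = ν) with hF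
    have hFm : ∀ i, i ∈ F ↔ i ≤ m ∧ c i = ν := by
      intro i; rw [hF, Finset.mem_filter, Finset.mem_range]; omega
    have hFd : ∀ i ∈ F, (ν:ℝ) - 1/2 ≤ d i ∧ d i ≤ ν + 1/2 := by
      intro i hi
      have h1 := ((hFm i).1 hi).2
      have h2 := Int.floor_eq_iff.1 h1
      constructor <;> linarith [h2.1, h2.2]
    have hFc : ∀ i j k, i ∈ F → k ∈ F → i ≤ j → j ≤ k → j ∈ F := by
      intro i j k hi hk hij hjk
      rw [hFm] at hi hk ⊢
      have h1 := hcmono i j hij (by omega)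
      have h2 := hcmono j k hjk (by omega)
      omega
    rw [← Finset.sum_filter_add_sum_filter_not F (fun i => d i ≤ ν - θ)]
    rw [← Finset.sum_filter_add_sum_filter_not (F.filter (fun i => ¬ d i ≤ ν - θ)) (fun i => ν + θ ≤ d i)]
    have b1 : ‖∑ i ∈ F.filter (fun i => d i ≤ ν - θ), ee (f i)‖ ≤ 1 / θ := by
      apply kl_conv hs (by linarith) f _ (ν - 1)
      · intro i j k hi hk hij hjk
        rw [Finset.mem_filter] at hi hk ⊢
        have hkm := ((hFm k).1 hk.1).1
        exact ⟨hFc i j k hi.1 hk.1 hij hjk, (hmono j k hjk hkm).trans hk.2⟩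
      · intro i hi
        rw [Finset.mem_filter] at hi
        have h1 := hFd i hi.1
        have h2 := hi.2
        simp only [hd] at h1 h2
        push_cast
        constructor <;> linarith
      · intro i hi hi1
        rw [Finset.mem_filter] at hi1
        have := ((hFm _).1 hi1.1).1
        exact hmono i (i + 1) (by omega) this
    have b2 : ‖∑ i ∈ (F.filter (fun i => ¬ d i ≤ ν - θ)).filter (fun i => ν + θ ≤ d i), ee (f i)‖ ≤ 1 / θ := by
      apply kl_conv hs (by linarith) f _ ν
      · intro i j k hi hk hij hjk
        simp only [Finset.mem_filter] at hi hk ⊢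
        have hkm := ((hFm k).1 hk.1.1).1
        have h1 := hmono i j hij (by omega)
        refine ⟨⟨hFc i j k hi.1.1 hk.1.1 hij hjk, ?_⟩, ?_⟩
        · intro h2; exact hi.1.2 (h1.trans h2)
        · exact hi.2.trans h1
      · intro i hi
        simp only [Finset.mem_filter] at hi
        have h1 := hFd i hi.1.1
        have h2 := hi.2
        simp only [hd] at h1 h2
        constructor <;> linarith
      · intro i hi hi1
        simp only [Finset.mem_filter] at hi1
        have := ((hFm _).1 hi1.1.1).1
        exact hmono i (i + 1) (by omega) this
    have b3 : ‖∑ i ∈ (F.filter (fun i => ¬ d i ≤ ν - θ)).filter (fun i => ¬ ν + θ ≤ d i), ee (f i)‖ ≤ 2 * θ / lam + 1 := by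
      refine le_trans ?_ (near_conv hl hs d ((F.filter (fun i => ¬ d i ≤ ν - θ)).filter (fun i => ¬ ν + θ ≤ d i)) (ν := ν) ?_ ?_)
      · refine (norm_sum_le _ _).trans ?_
        simp [ee_norm]
      · intro i hi
        simp only [Finset.mem_filter, not_le] at hi
        exact ⟨hi.1.2.le, hi.2.le⟩
      · intro i j hi hj hij
        simp only [Finset.mem_filter] at hj
        exact hlo i j hij ((hFm _).1 hj.1.1).1
    have b4 : 2 * θ / lam + 1 ≤ 2.5 / θ := by
      rw [← hss]
      have : 2 * θ / (θ * θ) = 2 / θ := by field_simp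
      rw [this]
      have : 1 ≤ 0.5 / θ := by rw [le_div_iff₀ hs]; linarith
      have e : (2.5:ℝ) / θ = 2 / θ + 0.5 / θ := by ring
      linarith
    have e : (4.5:ℝ) / θ = 1 / θ + (1 / θ + 2.5 / θ) := by ring
    rw [e]
    refine (norm_add_le _ _).trans (add_le_add b1 ((norm_add_le _ _).trans (add_le_add b2 (b3.trans b4))))
  have hmain : ‖∑ i ∈ Finset.range (m + 1), ee (f i)‖ ≤ (μ * m + 2) * (4.5 / θ) := by
    rw [← Finset.sum_fiberwise_of_maps_to (s := Finset.range (m + 1)) (t := Finset.Icc (c 0) (c m)) (g := c)]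
    · refine (norm_sum_le _ _).trans ((Finset.sum_le_sum (fun ν _ => hcell ν)).trans ?_)
      rw [Finset.sum_const, nsmul_eq_mul]
      gcongr
      rw [Int.card_Icc]
      have h1 := hcmono 0 m (by omega) le_rfl
      have h2 : (((c m + 1 - c 0).toNat : ℕ) : ℝ) = (c m : ℝ) + 1 - c 0 := by
        have : (((c m + 1 - c 0).toNat : ℕ) : ℤ) = c m + 1 - c 0 := Int.toNat_of_nonneg (by omega)
        have : ((((c m + 1 - c 0).toNat : ℕ) : ℤ) : ℝ) = ((c m + 1 - c 0 : ℤ) : ℝ) := by rw [this]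
        push_cast at this
        simpa using this
      rw [h2]
      have h3 := Int.floor_le (d m + 1 / 2)
      have h4 := Int.lt_floor_add_one (d 0 + 1 / 2)
      have h5 := hup 0 m (by omega) le_rfl
      simp only [hcdef]
      push_cast at h5
      linarith
    · intro i hi
      have := Finset.mem_range.1 hi
      rw [Finset.mem_Icc]
      exact ⟨hcmono 0 i (by omega) (by omega), hcmono i m (by omega) le_rfl⟩
  refine (norm_add_le _ _).trans ?_
  rw [ee_norm]
  have h9 : (μ * m + 2) * (4.5 / θ) = 4.5 * (μ * m + 2) / θ := by ring
  rw [h9] at hmain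
  have h10 : 1 ≤ 0.5 * 2 / θ := by rw [le_div_iff₀ hs]; linarith
  have h11 : 5 * (μ * ((m + 2 : ℕ) : ℝ) + 2) / θ - 4.5 * (μ * m + 2) / θ - 0.5 * 2 / θ = (0.5 * μ * m + 10 * μ) / θ := by
    push_cast; ring
  have h12 : 0 ≤ (0.5 * μ * m + 10 * μ) / θ := by positivity
  linarith

end EllAux
end M2sec

section M3sec
namespace EllAux

lemma sum_window (K H : ℕ) (g : ℕ → ℂ) (h : ℕ) (hh : h ≤ H) (n : ℕ) (hn : n ≤ K) :
    ∑ t ∈ Finset.range (K + H), (if h ≤ t ∧ t - h < n then g (t - h) else 0) = ∑ k ∈ Finset.range n, g k := by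
  have hsub : Finset.Ico h (h + n) ⊆ Finset.range (K + H) := by
    intro t ht
    rw [Finset.mem_Ico] at ht
    rw [Finset.mem_range]; omega
  rw [← Finset.sum_subset hsub]
  · rw [Finset.sum_Ico_eq_sum_range]
    have : h + n - h = n := by omega
    rw [this]
    apply Finset.sum_congr rfl
    intro i hi
    have hi := Finset.mem_range.1 hi
    rw [if_pos (by omega)]
    congr 1; omega
  · intro t _ ht
    rw [Finset.mem_Ico] at ht
    rw [if_neg (by omega)]

lemma abs_diff_sum (H h : ℕ) (hh : h < H) (g : ℕ → ℝ) (hg : ∀ j, 0 ≤ g j) :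
    ∑ h' ∈ Finset.range H, g ((h' - h) + (h - h')) ≤ g 0 + 2 * ∑ j ∈ Finset.Ico 1 H, g j := by
  have e : Finset.range H = Finset.Ico 0 H := Finset.range_eq_Ico _
  rw [e, ← Finset.sum_Ico_consecutive _ (Nat.zero_le h) hh.le]
  have h1 : ∑ h' ∈ Finset.Ico 0 h, g ((h' - h) + (h - h')) ≤ ∑ j ∈ Finset.Ico 1 H, g j := by
    rw [← Finset.sum_image (s := Finset.Ico 0 h) (g := fun h' => (h' - h) + (h - h')) (f := g)]
    · apply Finset.sum_le_sum_of_subset_of_nonneg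
      · intro j hj
        rw [Finset.mem_image] at hj
        obtain ⟨h', hh', rfl⟩ := hj
        rw [Finset.mem_Ico] at hh' ⊢
        omega
      · intro j _ _; exact hg j
    · intro x hx y hy hxy
      simp only [Finset.coe_Ico, Set.mem_Ico] at hx hy
      simp only at hxy
      omega
  have h2 : ∑ h' ∈ Finset.Ico h H, g ((h' - h) + (h - h')) ≤ g 0 + ∑ j ∈ Finset.Ico 1 H, g j := by
    rw [Finset.sum_eq_sum_Ico_succ_bot hh]
    simp only [Nat.sub_self, add_zero]
    gcongr
    rw [← Finset.sum_image (s := Finset.Ico (h+1) H) (g := fun h' => (h' - h) + (h - h')) (f := g)]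
    · apply Finset.sum_le_sum_of_subset_of_nonneg
      · intro j hj
        rw [Finset.mem_image] at hj
        obtain ⟨h', hh', rfl⟩ := hj
        rw [Finset.mem_Ico] at hh' ⊢
        omega
      · intro j _ _; exact hg j
    · intro x hx y hy hxy
      simp only [Finset.coe_Ico, Set.mem_Ico] at hx hy
      simp only at hxy
      omega
  linarith

theorem weyl_vdc {ι : Type*} (s : Finset ι) (z : ι → ℕ → ℂ) (K H : ℕ) (hH : 1 ≤ H) (hHK : H ≤ K) :
    ∑ n ∈ s, ‖∑ k ∈ Finset.range K, z n k‖ ^ 2 ≤ (2 * K / H : ℝ) *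
      (‖∑ n ∈ s, ∑ k ∈ Finset.range K, z n k * (starRingEnd ℂ) (z n k)‖
        + 2 * ∑ j ∈ Finset.Ico 1 H, ‖∑ n ∈ s, ∑ k ∈ Finset.range (K - j), z n (k + j) * (starRingEnd ℂ) (z n k)‖) := by
  set Γ : ℕ → ℂ := fun j => ∑ n ∈ s, ∑ k ∈ Finset.range (K - j), z n (k + j) * (starRingEnd ℂ) (z n k) with hΓ
  have hΓ0 : ∑ n ∈ s, ∑ k ∈ Finset.range K, z n k * (starRingEnd ℂ) (z n k) = Γ 0 := by simp [hΓ]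
  rw [hΓ0]
  set y : ι → ℕ → ℕ → ℂ := fun n t h => if h ≤ t ∧ t - h < K then z n (t - h) else 0 with hy
  have h1 : ∀ n h, h < H → ∑ t ∈ Finset.range (K + H), y n t h = ∑ k ∈ Finset.range K, z n k :=
    fun n h hh => sum_window K H (z n) h hh.le K le_rfl
  have h2 : ∀ h j, h + j < H → ∑ n ∈ s, ∑ t ∈ Finset.range (K + H), y n t h * (starRingEnd ℂ) (y n t (h + j)) = Γ j := by
    intro h j hj
    simp only [hΓ]
    apply Finset.sum_congr rfl
    intro n _
    rw [← sum_window K H (fun k => z n (k + j) * (starRingEnd ℂ) (z n k)) (h + j) hj.le (K - j) (by omega)]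
    apply Finset.sum_congr rfl
    intro t _
    simp only [hy]
    by_cases hc : h + j ≤ t ∧ t - (h + j) < K - j
    · rw [if_pos hc, if_pos (by omega), if_pos (by omega)]
      congr 2; omega
    · rw [if_neg hc]
      by_cases hc2 : h + j ≤ t ∧ t - (h + j) < K
      · rw [if_neg (by omega : ¬ (h ≤ t ∧ t - h < K)), zero_mul]
      · rw [if_neg hc2, map_zero, mul_zero]
  set X : ℕ → ℕ → ℂ := fun h h' => ∑ n ∈ s, ∑ t ∈ Finset.range (K + H), y n t h * (starRingEnd ℂ) (y n t h') with hX
  have hXc : ∀ h h', X h h' = (starRingEnd ℂ) (X h' h) := by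
    intro h h'
    simp only [hX, map_sum, map_mul, Complex.conj_conj]
    simp only [mul_comm]
  have hXn : ∀ h h', h < H → h' < H → ‖X h h'‖ = ‖Γ ((h' - h) + (h - h'))‖ := by
    intro h h' hh hh'
    rcases le_total h h' with hle | hle
    · obtain ⟨j, rfl⟩ := Nat.exists_eq_add_of_le hle
      have : (h + j - h) + (h - (h + j)) = j := by omega
      rw [this, ← h2 h j hh']
    · obtain ⟨j, rfl⟩ := Nat.exists_eq_add_of_le hle
      have : (h' - (h' + j)) + (h' + j - h') = j := by omega
      rw [this, ← h2 h' j hh, hXc, Complex.norm_conj]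
  -- expand squares
  have h4 : ∑ n ∈ s, ∑ t ∈ Finset.range (K + H), ‖∑ h ∈ Finset.range H, y n t h‖ ^ 2
      ≤ H * (‖Γ 0‖ + 2 * ∑ j ∈ Finset.Ico 1 H, ‖Γ j‖) := by
    have e : ((∑ n ∈ s, ∑ t ∈ Finset.range (K + H), ‖∑ h ∈ Finset.range H, y n t h‖ ^ 2 : ℝ) : ℂ)
        = ∑ h ∈ Finset.range H, ∑ h' ∈ Finset.range H, X h h' := by
      push_cast
      have e1 : ∀ n t, (‖∑ h ∈ Finset.range H, y n t h‖ : ℂ) ^ 2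
          = ∑ h ∈ Finset.range H, ∑ h' ∈ Finset.range H, y n t h * (starRingEnd ℂ) (y n t h') := by
        intro n t
        rw [← Complex.mul_conj', map_sum, Finset.sum_mul_sum]
      simp only [e1, hX]
      have e2 : ∀ n ∈ s, ∑ t ∈ Finset.range (K + H), ∑ h ∈ Finset.range H, ∑ h' ∈ Finset.range H, y n t h * (starRingEnd ℂ) (y n t h')
        = ∑ h ∈ Finset.range H, ∑ h' ∈ Finset.range H, ∑ t ∈ Finset.range (K + H), y n t h * (starRingEnd ℂ) (y n t h') := by
        intro n _
        rw [Finset.sum_comm]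
        apply Finset.sum_congr rfl
        intro h _
        rw [Finset.sum_comm]
      rw [Finset.sum_congr rfl e2, Finset.sum_comm]
      apply Finset.sum_congr rfl
      intro h _
      rw [Finset.sum_comm]
    have hnn : 0 ≤ ∑ n ∈ s, ∑ t ∈ Finset.range (K + H), ‖∑ h ∈ Finset.range H, y n t h‖ ^ 2 :=
      Finset.sum_nonneg (fun _ _ => Finset.sum_nonneg (fun _ _ => by positivity))
    have e3 : ∑ n ∈ s, ∑ t ∈ Finset.range (K + H), ‖∑ h ∈ Finset.range H, y n t h‖ ^ 2
       = ‖∑ h ∈ Finset.range H, ∑ h' ∈ Finset.range H, X h h'‖ := by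
      rw [← e, Complex.norm_real, Real.norm_of_nonneg hnn]
    rw [e3]
    refine (norm_sum_le _ _).trans ?_
    have : ∀ h ∈ Finset.range H, ‖∑ h' ∈ Finset.range H, X h h'‖ ≤ ‖Γ 0‖ + 2 * ∑ j ∈ Finset.Ico 1 H, ‖Γ j‖ := by
      intro h hh
      have hh := Finset.mem_range.1 hh
      refine (norm_sum_le _ _).trans ?_
      refine le_trans (le_of_eq ?_) (abs_diff_sum H h hh (fun j => ‖Γ j‖) (fun j => norm_nonneg _))
      apply Finset.sum_congr rfl
      intro h' hh'
      exact hXn h h' hh (Finset.mem_range.1 hh')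
    refine (Finset.sum_le_sum this).trans ?_
    rw [Finset.sum_const, Finset.card_range, nsmul_eq_mul]
  have hHr : (0:ℝ) < H := by exact_mod_cast hH
  have hKr : (H:ℝ) ≤ K := by exact_mod_cast hHK
  have h5 : ∀ n ∈ s, (H:ℝ) ^ 2 * ‖∑ k ∈ Finset.range K, z n k‖ ^ 2
      ≤ (2 * K) * ∑ t ∈ Finset.range (K + H), ‖∑ h ∈ Finset.range H, y n t h‖ ^ 2 := by
    intro n _
    have e : (H : ℂ) * ∑ k ∈ Finset.range K, z n k = ∑ t ∈ Finset.range (K + H), ∑ h ∈ Finset.range H, y n t h := by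
      rw [Finset.sum_comm, Finset.sum_congr rfl (fun h hh => h1 n h (Finset.mem_range.1 hh))]
      simp
    have e2 : (H:ℝ) * ‖∑ k ∈ Finset.range K, z n k‖ ≤ ∑ t ∈ Finset.range (K + H), ‖∑ h ∈ Finset.range H, y n t h‖ := by
      have := norm_sum_le (Finset.range (K + H)) (fun t => ∑ h ∈ Finset.range H, y n t h)
      rw [← e, norm_mul, Complex.norm_natCast] at this
      exact this
    have e3 := sq_sum_le_card_mul_sum_sq (s := Finset.range (K + H)) (f := fun t => ‖∑ h ∈ Finset.range H, y n t h‖)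
    rw [Finset.card_range] at e3
    have hnn : 0 ≤ ∑ t ∈ Finset.range (K + H), ‖∑ h ∈ Finset.range H, y n t h‖ ^ 2 :=
      Finset.sum_nonneg (fun _ _ => by positivity)
    calc (H:ℝ) ^ 2 * ‖∑ k ∈ Finset.range K, z n k‖ ^ 2 = ((H:ℝ) * ‖∑ k ∈ Finset.range K, z n k‖) ^ 2 := by ring
      _ ≤ (∑ t ∈ Finset.range (K + H), ‖∑ h ∈ Finset.range H, y n t h‖) ^ 2 := by gcongr
      _ ≤ ((K + H : ℕ) : ℝ) * ∑ t ∈ Finset.range (K + H), ‖∑ h ∈ Finset.range H, y n t h‖ ^ 2 := e3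
      _ ≤ _ := by gcongr; push_cast; linarith
  have h6 := Finset.sum_le_sum h5
  rw [← Finset.mul_sum, ← Finset.mul_sum] at h6
  have h7 : (H:ℝ) ^ 2 * ∑ n ∈ s, ‖∑ k ∈ Finset.range K, z n k‖ ^ 2 ≤ (2 * K) * (H * (‖Γ 0‖ + 2 * ∑ j ∈ Finset.Ico 1 H, ‖Γ j‖)) :=
    h6.trans (by gcongr)
  rw [div_mul_eq_mul_div, le_div_iff₀ hHr]
  have : H * ((∑ n ∈ s, ‖∑ k ∈ Finset.range K, z n k‖ ^ 2) * H) ≤ H * (2 * K * (‖Γ 0‖ + 2 * ∑ j ∈ Finset.Ico 1 H, ‖Γ j‖)) := by nlinarith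
  exact le_of_mul_le_mul_left this hHr

end EllAux
end M3sec

section M4sec
namespace EllAux

lemma second_diff_mvt {φ φ' φ'' : ℝ → ℝ} {s h : ℝ} (hh : 0 < h)
    (h1 : ∀ t ∈ Set.Icc s (s + 2 * h), HasDerivAt φ (φ' t) t)
    (h2 : ∀ t ∈ Set.Icc s (s + 2 * h), HasDerivAt φ' (φ'' t) t) :
    ∃ η ∈ Set.Icc s (s + 2 * h), φ (s + 2 * h) - 2 * φ (s + h) + φ s = h ^ 2 * φ'' η := by
  have hd : ∀ t ∈ Set.Icc s (s + h), HasDerivAt (fun t => φ (t + h) - φ t) (φ' (t + h) - φ' t) t := by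
    intro t ht
    rw [Set.mem_Icc] at ht
    have e1 := (h1 (t + h) ⟨by linarith, by linarith⟩).comp_add_const t h
    exact e1.sub (h1 t ⟨by linarith, by linarith⟩)
  obtain ⟨ξ, hξ, e1⟩ := exists_hasDerivAt_eq_slope (fun t => φ (t + h) - φ t) (fun t => φ' (t + h) - φ' t)
    (by linarith : s < s + h) (fun t ht => (hd t ht).continuousAt.continuousWithinAt)
    (fun t ht => hd t (Set.Ioo_subset_Icc_self ht))
  rw [Set.mem_Ioo] at hξ
  obtain ⟨η, hη, e2⟩ := exists_hasDerivAt_eq_slope φ' φ'' (by linarith : ξ < ξ + h)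
    (fun t ht => (h2 t ⟨by linarith [ht.1], by linarith [ht.2]⟩).continuousAt.continuousWithinAt)
    (fun t ht => h2 t ⟨by linarith [ht.1], by linarith [ht.2]⟩)
  refine ⟨η, ⟨by linarith [hη.1], by linarith [hη.2]⟩, ?_⟩
  have e3 : φ' (ξ + h) - φ' ξ = φ'' η * h := by
    rw [e2, add_sub_cancel_left, div_mul_cancel₀ _ hh.ne']
  have e4 : φ (s + h + h) - φ (s + h) - (φ (s + h) - φ s) = (φ'' η * h) * h := by
    rw [← e3, e1, add_sub_cancel_left, div_mul_cancel₀ _ hh.ne']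
  have : s + 2 * h = s + h + h := by ring
  rw [this]
  linarith

lemma cube_inv_diff {ρ ρ' Z D : ℝ} (hZ : 0 < Z) (h1 : Z ≤ ρ) (h2 : ρ ≤ ρ') (h3 : ρ' ≤ 2 * Z)
    (hD : ρ' ^ 2 - ρ ^ 2 = D) :
    3 * D / (64 * Z ^ 5) ≤ 1 / ρ ^ 3 - 1 / ρ' ^ 3 ∧ 1 / ρ ^ 3 - 1 / ρ' ^ 3 ≤ 3 * D / (2 * Z ^ 5) := by
  have hρ : 0 < ρ := by linarith
  have hρ' : 0 < ρ' := by linarith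
  have hD0 : 0 ≤ D := by rw [← hD]; nlinarith
  have e : 1 / ρ ^ 3 - 1 / ρ' ^ 3 = D * ((ρ' ^ 2 + ρ' * ρ + ρ ^ 2) / ((ρ + ρ') * (ρ ^ 3 * ρ' ^ 3))) := by
    rw [← hD]; field_simp; ring
  rw [e]
  constructor
  · have k1 : 3 / (64 * Z ^ 5) ≤ (ρ' ^ 2 + ρ' * ρ + ρ ^ 2) / ((ρ + ρ') * (ρ ^ 3 * ρ' ^ 3)) := by
      calc 3 / (64 * Z ^ 5) = 3 / (2 * ((2 * Z) ^ 2 * (2 * Z) ^ 3)) := by ring_nf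
        _ ≤ 3 / (2 * (ρ ^ 2 * ρ' ^ 3)) := by gcongr; linarith
        _ ≤ _ := by
          rw [div_le_div_iff₀ (by positivity) (by positivity)]
          have : 3 * ρ * (ρ + ρ') ≤ 2 * (ρ' ^ 2 + ρ' * ρ + ρ ^ 2) := by nlinarith
          calc 3 * ((ρ + ρ') * (ρ ^ 3 * ρ' ^ 3)) = (3 * ρ * (ρ + ρ')) * (ρ ^ 2 * ρ' ^ 3) := by ring
            _ ≤ (2 * (ρ' ^ 2 + ρ' * ρ + ρ ^ 2)) * (ρ ^ 2 * ρ' ^ 3) := by gcongr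
            _ = _ := by ring
    calc 3 * D / (64 * Z ^ 5) = D * (3 / (64 * Z ^ 5)) := by ring
      _ ≤ _ := by gcongr
  · have k1 : (ρ' ^ 2 + ρ' * ρ + ρ ^ 2) / ((ρ + ρ') * (ρ ^ 3 * ρ' ^ 3)) ≤ 3 / (2 * Z ^ 5) := by
      calc _ ≤ 3 / (2 * (ρ ^ 3 * ρ' ^ 2)) := by
            rw [div_le_div_iff₀ (by positivity) (by positivity)]
            have : 2 * (ρ' ^ 2 + ρ' * ρ + ρ ^ 2) ≤ 3 * ρ' * (ρ + ρ') := by nlinarith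
            calc (ρ' ^ 2 + ρ' * ρ + ρ ^ 2) * (2 * (ρ ^ 3 * ρ' ^ 2)) = (2 * (ρ' ^ 2 + ρ' * ρ + ρ ^ 2)) * (ρ ^ 3 * ρ' ^ 2) := by ring
            _ ≤ (3 * ρ' * (ρ + ρ')) * (ρ ^ 3 * ρ' ^ 2) := by gcongr
            _ = _ := by ring
        _ ≤ 3 / (2 * (Z ^ 3 * Z ^ 2)) := by gcongr; linarith
        _ = _ := by ring_nf
    calc _ ≤ D * (3 / (2 * Z ^ 5)) := by gcongr
      _ = _ := by ring

/-- second difference bounds of the differenced phase -/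
lemma phase_second_diff {a u p p' Z D t : ℝ} (ha : 0 < a) (hu : 0 < u) (hZ : 0 < Z) (hp : p ≤ p')
    (hD : p' - p = D) (h1 : Z ^ 2 ≤ a * t + p) (h2 : a * (t + 2) + p' ≤ 4 * Z ^ 2) :
    u * a ^ 2 * (3 * D / (256 * Z ^ 5)) ≤
      u * (√(a * (t + 2) + p') - √(a * (t + 2) + p)) - 2 * (u * (√(a * (t + 1) + p') - √(a * (t + 1) + p)))
        + u * (√(a * t + p') - √(a * t + p)) ∧
      u * (√(a * (t + 2) + p') - √(a * (t + 2) + p)) - 2 * (u * (√(a * (t + 1) + p') - √(a * (t + 1) + p)))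
        + u * (√(a * t + p') - √(a * t + p)) ≤ u * a ^ 2 * (3 * D / (8 * Z ^ 5)) := by
  have hZ2 : 0 < Z ^ 2 := by positivity
  have d1 : ∀ q, p ≤ q → ∀ τ, t ≤ τ → HasDerivAt (fun τ => √(a * τ + q)) (a / 2 * (√(a * τ + q))⁻¹) τ := by
    intro q hq τ hτ
    have hpos : 0 < a * τ + q := by nlinarith
    have hl : HasDerivAt (fun τ => a * τ + q) a τ := by
      simpa using ((hasDerivAt_id τ).const_mul a).add_const q
    have := hl.sqrt hpos.ne'
    convert this using 1
    rw [div_mul_eq_mul_div, ← div_eq_mul_inv, div_div, mul_comm]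
  have d2 : ∀ q, p ≤ q → ∀ τ, t ≤ τ → HasDerivAt (fun τ => a / 2 * (√(a * τ + q))⁻¹) (-(a ^ 2 / 4) * (1 / √(a * τ + q) ^ 3)) τ := by
    intro q hq τ hτ
    have hpos : 0 < a * τ + q := by nlinarith
    have hs : 0 < √(a * τ + q) := Real.sqrt_pos.2 hpos
    have := ((d1 q hq τ hτ).inv hs.ne').const_mul (a / 2)
    refine HasDerivAt.congr_deriv this ?_
    rw [div_eq_mul_inv (-(a / 2 * (√(a * τ + q))⁻¹)), one_div, ← inv_pow, ← inv_pow]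
    ring
  obtain ⟨η, hη, e⟩ := second_diff_mvt (φ := fun τ => u * (√(a * τ + p') - √(a * τ + p)))
    (φ' := fun τ => u * (a / 2 * (√(a * τ + p'))⁻¹ - a / 2 * (√(a * τ + p))⁻¹))
    (φ'' := fun τ => u * (-(a ^ 2 / 4) * (1 / √(a * τ + p') ^ 3) - -(a ^ 2 / 4) * (1 / √(a * τ + p) ^ 3)))
    (s := t) (h := 1) one_pos
    (fun τ hτ => ((d1 p' hp τ hτ.1).sub (d1 p le_rfl τ hτ.1)).const_mul u)
    (fun τ hτ => ((d2 p' hp τ hτ.1).sub (d2 p le_rfl τ hτ.1)).const_mul u)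
  simp only [mul_one] at e
  rw [e]
  rw [Set.mem_Icc] at hη
  have q1 : 0 ≤ a * η + p := by nlinarith [hη.1]
  have q2 : 0 ≤ a * η + p' := by linarith
  have c := cube_inv_diff (ρ := √(a * η + p)) (ρ' := √(a * η + p')) (Z := Z) (D := D) hZ
    (Real.le_sqrt_of_sq_le (by nlinarith [hη.1])) (Real.sqrt_le_sqrt (by linarith))
    (by rw [show 2 * Z = √(4 * Z ^ 2) by
          rw [show 4 * Z ^ 2 = (2 * Z) ^ 2 by ring, Real.sqrt_sq (by positivity)]]
        exact Real.sqrt_le_sqrt (by nlinarith [hη.2]))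
    (by rw [Real.sq_sqrt q1, Real.sq_sqrt q2]; linarith)
  have hua : 0 < u * a ^ 2 / 4 := by positivity
  constructor
  · have := mul_le_mul_of_nonneg_left c.1 hua.le
    calc _ = u * a ^ 2 / 4 * (3 * D / (64 * Z ^ 5)) := by ring
      _ ≤ _ := this
      _ = _ := by ring
  · have := mul_le_mul_of_nonneg_left c.2 hua.le
    calc _ = u * a ^ 2 / 4 * (1 / √(a * η + p) ^ 3 - 1 / √(a * η + p') ^ 3) := by ring
      _ ≤ _ := this
      _ = _ := by ring

end EllAux
end M4sec

section M5sec
namespace EllAux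

lemma exists_isqrt (N : ℕ) (hN : 1 ≤ N) : ∃ m : ℕ, 1 ≤ m ∧ m ^ 2 + 1 ≤ 2 * N ∧ ∀ c : ℤ, c ^ 2 < 2 * N → c.natAbs ≤ m := by
  refine ⟨Nat.sqrt (2 * N - 1), ?_, ?_, ?_⟩
  · rw [Nat.le_sqrt]; omega
  · have := Nat.sqrt_le' (2 * N - 1); omega
  · intro c hc
    rw [Nat.le_sqrt']
    have : (c.natAbs : ℤ) ^ 2 = c ^ 2 := Int.natAbs_sq c
    zify
    have h2 : (1:ℕ) ≤ 2 * N := by omega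
    push_cast [Nat.cast_sub h2]
    rw [← Int.natCast_natAbs, this]; omega

/-- the representations of n -/
noncomputable def Dn (n : ℕ) : Finset (ℤ × ℤ) :=
  ((Finset.Icc (-(n:ℤ)) n) ×ˢ (Finset.Icc (-(n:ℤ)) n)).filter (fun p => p.1 ^ 2 + p.2 ^ 2 = (n:ℤ))

lemma r2_eq (n : ℕ) : r2 n = (Dn n).card := rfl

lemma mem_Dn {n : ℕ} {p : ℤ × ℤ} (h : p ∈ Dn n) : p.1 ^ 2 + p.2 ^ 2 = (n:ℤ) := (Finset.mem_filter.1 h).2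

lemma sum_r2 (N : ℕ) (hN : 1 ≤ N) : ∑ n ∈ Finset.Ico N (2 * N), r2 n ≤ 12 * N := by
  obtain ⟨m, hm1, hm2, hm3⟩ := exists_isqrt N hN
  have e : ∑ n ∈ Finset.Ico N (2 * N), r2 n = ((Finset.Ico N (2 * N)).sigma Dn).card := by
    rw [Finset.card_sigma]; rfl
  rw [e]
  have : ((Finset.Ico N (2 * N)).sigma Dn).card ≤ ((Finset.Icc (-(m:ℤ)) m) ×ˢ (Finset.Icc (-(m:ℤ)) m)).card := by
    apply Finset.card_le_card_of_injOn (fun q => q.2)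
    · intro q hq
      have hq := Finset.mem_sigma.1 (Finset.mem_coe.1 hq)
      have h1 := mem_Dn hq.2
      have h2 := (Finset.mem_Ico.1 hq.1).2
      have h2' : (q.1 : ℤ) < 2 * N := by exact_mod_cast h2
      have a1 := hm3 q.2.1 (by nlinarith [sq_nonneg q.2.2])
      have a2 := hm3 q.2.2 (by nlinarith [sq_nonneg q.2.1])
      simp only [Finset.coe_product, Set.mem_prod, Finset.coe_Icc, Set.mem_Icc]
      omega
    · intro q hq q' hq' h
      have hq := Finset.mem_sigma.1 (Finset.mem_coe.1 hq)
      have hq' := Finset.mem_sigma.1 (Finset.mem_coe.1 hq')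
      have h1 := mem_Dn hq.2
      have h1' := mem_Dn hq'.2
      simp only at h
      have h3 : q.1 = q'.1 := by
        rw [h, h1'] at h1; exact_mod_cast h1.symm
      cases q; cases q'; simp_all
  refine this.trans ?_
  rw [Finset.card_product, Int.card_Icc]
  have e2 : ((m:ℤ) + 1 - -(m:ℤ)).toNat = 2 * m + 1 := by omega
  rw [e2]
  nlinarith

/-- quadruples of positives with uv = wz -/
noncomputable def Quad (B : ℕ) : Finset ((ℕ × ℕ) × (ℕ × ℕ)) :=
  (((Finset.Icc 1 B) ×ˢ (Finset.Icc 1 B)) ×ˢ ((Finset.Icc 1 B) ×ˢ (Finset.Icc 1 B))).filter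
    (fun q => q.1.1 * q.1.2 = q.2.1 * q.2.2)

lemma quad_card (B : ℕ) : ((Quad B).card : ℝ) ≤ 2 * (B:ℝ) ^ 2 * (1 + Real.log B) := by
  have h1 : (Quad B).card ≤ (((Finset.Icc 1 B) ×ˢ (Finset.Icc 1 B)).sigma
      (fun p : ℕ × ℕ => (Finset.Icc 1 (B / max p.1 p.2)) ×ˢ (Finset.Icc 1 (B / max p.1 p.2)))).card := by
    apply Finset.card_le_card_of_injOn (fun q => ⟨(q.1.1 / Nat.gcd q.1.1 q.2.1, q.2.1 / Nat.gcd q.1.1 q.2.1),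
      (Nat.gcd q.1.1 q.2.1, q.1.2 / (q.2.1 / Nat.gcd q.1.1 q.2.1))⟩)
    · rintro ⟨⟨u, v⟩, ⟨w, z⟩⟩ hq
      have hq := Finset.mem_filter.1 (Finset.mem_coe.1 hq)
      simp only [Finset.mem_product, Finset.mem_Icc] at hq
      obtain ⟨⟨⟨⟨u1, u2⟩, v1, v2⟩, ⟨w1, w2⟩, z1, z2⟩, h⟩ := hq
      obtain ⟨g, u', w', hg, hc, rfl, rfl⟩ := Nat.exists_coprime' (Nat.gcd_pos_of_pos_left w u1)
      have hu' : 0 < u' := Nat.pos_of_ne_zero (by rintro rfl; simp at u1)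
      have hw' : 0 < w' := Nat.pos_of_ne_zero (by rintro rfl; simp at w1)
      have hgg : Nat.gcd (u' * g) (w' * g) = g := by
        rw [Nat.gcd_mul_right, hc.gcd_eq_one, one_mul]
      have h' : u' * v = w' * z := by
        apply Nat.eq_of_mul_eq_mul_right hg
        calc u' * v * g = u' * g * v := by ring
          _ = w' * g * z := h
          _ = _ := by ring
      obtain ⟨t, rfl⟩ : w' ∣ v := hc.symm.dvd_of_dvd_mul_left ⟨z, h'⟩
      have hz : z = u' * t := by
        apply Nat.eq_of_mul_eq_mul_left hw'
        rw [← h']; ring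
      subst hz
      have ht : 0 < t := Nat.pos_of_ne_zero (by rintro rfl; simp at v1)
      simp only [hgg, Nat.mul_div_cancel _ hg, Nat.mul_div_cancel_left _ hw', Finset.coe_sigma, Set.mem_sigma_iff,
        Finset.coe_product, Set.mem_prod, Finset.coe_Icc, Set.mem_Icc]
      have hmx : 0 < max u' w' := lt_of_lt_of_le hu' (le_max_left _ _)
      rw [Nat.le_div_iff_mul_le hmx, Nat.le_div_iff_mul_le hmx]
      refine ⟨⟨⟨hu', by nlinarith⟩, hw', by nlinarith⟩, ⟨hg, ?_⟩, ht, ?_⟩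
      · rcases max_cases u' w' with h | h <;> rw [h.1] <;> nlinarith
      · rcases max_cases u' w' with h | h <;> rw [h.1] <;> nlinarith
    · rintro ⟨⟨u, v⟩, ⟨w, z⟩⟩ hq ⟨⟨u2, v2⟩, ⟨w2, z2⟩⟩ hq2 heq
      have hq := Finset.mem_filter.1 (Finset.mem_coe.1 hq)
      have hq2 := Finset.mem_filter.1 (Finset.mem_coe.1 hq2)
      simp only [Finset.mem_product, Finset.mem_Icc] at hq hq2
      simp only [Sigma.mk.injEq, Prod.mk.injEq, heq_eq_eq] at heq
      obtain ⟨⟨e1, e2⟩, e3, e4⟩ := heq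
      have aux : ∀ u v w z : ℕ, 1 ≤ u → 1 ≤ w → u * v = w * z →
          u = (u / Nat.gcd u w) * Nat.gcd u w ∧ w = (w / Nat.gcd u w) * Nat.gcd u w ∧
          v = (w / Nat.gcd u w) * (v / (w / Nat.gcd u w)) := by
        intro u v w z u1 w1 h
        refine ⟨(Nat.div_mul_cancel (Nat.gcd_dvd_left _ _)).symm, (Nat.div_mul_cancel (Nat.gcd_dvd_right _ _)).symm, ?_⟩
        have hg := Nat.gcd_pos_of_pos_left w u1
        have hc := Nat.coprime_div_gcd_div_gcd hg
        refine (Nat.mul_div_cancel' ?_).symm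
        refine hc.symm.dvd_of_dvd_mul_left ⟨z, ?_⟩
        apply Nat.eq_of_mul_eq_mul_right hg
        calc u / Nat.gcd u w * v * Nat.gcd u w = (u / Nat.gcd u w * Nat.gcd u w) * v := by ring
          _ = u * v := by rw [Nat.div_mul_cancel (Nat.gcd_dvd_left _ _)]
          _ = w * z := h
          _ = (w / Nat.gcd u w * Nat.gcd u w) * z := by rw [Nat.div_mul_cancel (Nat.gcd_dvd_right _ _)]
          _ = _ := by ring
      have A := aux u v w z hq.1.1.1.1 hq.1.2.1.1 hq.2
      have A2 := aux u2 v2 w2 z2 hq2.1.1.1.1 hq2.1.2.1.1 hq2.2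
      have hu : u = u2 := by rw [A.1, A2.1, e1, e3]
      have hw : w = w2 := by rw [A.2.1, A2.2.1, e2, e3]
      have hv : v = v2 := by rw [A.2.2, A2.2.2, e4, e2]
      subst hu hw hv
      have hz : z = z2 := by
        apply Nat.eq_of_mul_eq_mul_left hq.1.2.1.1
        rw [← hq.2, ← hq2.2]
      rw [hz]
  have h2 : (((((Finset.Icc 1 B) ×ˢ (Finset.Icc 1 B)).sigma
      (fun p : ℕ × ℕ => (Finset.Icc 1 (B / max p.1 p.2)) ×ˢ (Finset.Icc 1 (B / max p.1 p.2)))).card : ℕ) : ℝ)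
      ≤ ∑ p ∈ (Finset.Icc 1 B) ×ˢ (Finset.Icc 1 B), ((if p.2 ≤ p.1 then (B:ℝ) ^ 2 / (p.1:ℝ) ^ 2 else 0)
          + (if p.1 ≤ p.2 then (B:ℝ) ^ 2 / (p.2:ℝ) ^ 2 else 0)) := by
    rw [Finset.card_sigma]
    push_cast
    apply Finset.sum_le_sum
    rintro ⟨p, q⟩ -
    rw [Finset.card_product, Nat.card_Icc]
    simp only [Nat.add_sub_cancel]
    push_cast
    have hb : ∀ m : ℕ, ((B / m : ℕ) : ℝ) * ((B / m : ℕ) : ℝ) ≤ (B:ℝ) ^ 2 / (m:ℝ) ^ 2 := by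
      intro m
      rw [← div_pow, sq]
      have := @Nat.cast_div_le ℝ _ _ _ B m
      gcongr
    rcases le_total q p with h | h
    · rw [max_eq_left h, if_pos h]
      have : (0:ℝ) ≤ (if p ≤ q then (B:ℝ) ^ 2 / (q:ℝ) ^ 2 else 0) := by split_ifs <;> positivity
      linarith [hb p]
    · rw [max_eq_right h, if_pos h]
      have : (0:ℝ) ≤ (if q ≤ p then (B:ℝ) ^ 2 / (p:ℝ) ^ 2 else 0) := by split_ifs <;> positivity
      linarith [hb q]
  have h3 : ∀ p ∈ Finset.Icc 1 B, ∑ q ∈ Finset.Icc 1 B, (if q ≤ p then (B:ℝ) ^ 2 / (p:ℝ) ^ 2 else 0) = (B:ℝ) ^ 2 * (p:ℝ)⁻¹ := by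
    intro p hp
    rw [Finset.mem_Icc] at hp
    rw [← Finset.sum_filter, Finset.sum_const]
    have : (Finset.Icc 1 B).filter (fun q => q ≤ p) = Finset.Icc 1 p := by
      ext q; simp only [Finset.mem_filter, Finset.mem_Icc]; omega
    rw [this, Nat.card_Icc, Nat.add_sub_cancel, nsmul_eq_mul]
    have : (0:ℝ) < p := by exact_mod_cast hp.1
    field_simp
  have h4 : ∑ p ∈ (Finset.Icc 1 B) ×ˢ (Finset.Icc 1 B), ((if p.2 ≤ p.1 then (B:ℝ) ^ 2 / (p.1:ℝ) ^ 2 else 0)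
          + (if p.1 ≤ p.2 then (B:ℝ) ^ 2 / (p.2:ℝ) ^ 2 else 0)) = 2 * ((B:ℝ) ^ 2 * ∑ p ∈ Finset.Icc 1 B, (p:ℝ)⁻¹) := by
    rw [Finset.sum_add_distrib, two_mul]
    congr 1
    · rw [Finset.sum_product, Finset.sum_congr rfl h3, Finset.mul_sum]
    · rw [Finset.sum_product_right, Finset.sum_congr rfl h3, Finset.mul_sum]
  have h5 : ∑ p ∈ Finset.Icc 1 B, (p:ℝ)⁻¹ ≤ 1 + Real.log B := by
    have := harmonic_le_one_add_log B
    rw [harmonic_eq_sum_Icc] at this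
    push_cast at this
    exact this
  calc ((Quad B).card : ℝ) ≤ _ := by exact_mod_cast h1
    _ ≤ _ := h2
    _ = _ := h4
    _ ≤ 2 * ((B:ℝ) ^ 2 * (1 + Real.log B)) := by gcongr
    _ = _ := by ring

end EllAux
end M5sec

section M6sec
namespace EllAux

noncomputable def QT (N : ℕ) : Finset (Σ _ : ℕ, (ℤ × ℤ) × (ℤ × ℤ)) :=
  (Finset.Ico N (2 * N)).sigma (fun n => Dn n ×ˢ Dn n)

lemma mem_QT {N : ℕ} {q : Σ _ : ℕ, (ℤ × ℤ) × (ℤ × ℤ)} (hq : q ∈ QT N) :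
    q.1 ∈ Finset.Ico N (2 * N) ∧ q.2.1 ∈ Dn q.1 ∧ q.2.2 ∈ Dn q.1 := by
  have hq := Finset.mem_sigma.1 hq
  exact ⟨hq.1, Finset.mem_product.1 hq.2⟩

lemma QT_zero (N : ℕ) (hN : 1 ≤ N) :
    ((QT N).filter (fun q => (q.2.1.1 - q.2.2.1) * (q.2.1.1 + q.2.2.1) = 0)).card ≤ 48 * N := by
  have : ((QT N).filter (fun q => (q.2.1.1 - q.2.2.1) * (q.2.1.1 + q.2.2.1) = 0)).card
     ≤ (((Finset.Ico N (2 * N)).sigma Dn) ×ˢ (Finset.univ : Finset (Bool × Bool))).card := by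
    apply Finset.card_le_card_of_injOn
      (fun q => ((⟨q.1, q.2.1⟩ : Σ _ : ℕ, ℤ × ℤ), (decide (q.2.1.1 = q.2.2.1), decide (q.2.1.2 = q.2.2.2))))
    · intro q hq
      have hq := mem_QT (Finset.mem_filter.1 (Finset.mem_coe.1 hq)).1
      simp only [Finset.coe_product, Set.mem_prod, Finset.mem_coe, Finset.mem_univ, and_true]
      exact Finset.mem_sigma.2 ⟨hq.1, hq.2.1⟩
    · rintro ⟨n, ⟨a, b⟩, ⟨c, d⟩⟩ hq ⟨n', ⟨a', b'⟩, ⟨c', d'⟩⟩ hq' h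
      have h0 := (Finset.mem_filter.1 (Finset.mem_coe.1 hq)).2
      have h0' := (Finset.mem_filter.1 (Finset.mem_coe.1 hq')).2
      have hq := mem_QT (Finset.mem_filter.1 (Finset.mem_coe.1 hq)).1
      have hq' := mem_QT (Finset.mem_filter.1 (Finset.mem_coe.1 hq')).1
      simp only at h h0 h0'
      have k1 := mem_Dn hq.2.1
      have k2 := mem_Dn hq.2.2
      have k1' := mem_Dn hq'.2.1
      have k2' := mem_Dn hq'.2.2
      simp only at k1 k2 k1' k2'
      simp only [Prod.mk.injEq, Sigma.mk.injEq, heq_eq_eq, decide_eq_decide] at h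
      obtain ⟨⟨rfl, rfl, rfl⟩, h1, h2⟩ := h
      have z1 : (b - d) * (b + d) = 0 := by nlinarith
      have z1' : (b - d') * (b + d') = 0 := by nlinarith
      have hc : c = c' := by
        rcases mul_eq_zero.1 h0 with e | e <;> rcases mul_eq_zero.1 h0' with e' | e' <;> omega
      have hd : d = d' := by
        rcases mul_eq_zero.1 z1 with e | e <;> rcases mul_eq_zero.1 z1' with e' | e' <;> omega
      rw [hc, hd]
  refine this.trans ?_
  rw [Finset.card_product, Finset.card_sigma]
  have h1 := sum_r2 N hN
  have h2 : ∑ n ∈ Finset.Ico N (2 * N), (Dn n).card = ∑ n ∈ Finset.Ico N (2 * N), r2 n := rfl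
  rw [h2]
  have h3 : (Finset.univ : Finset (Bool × Bool)).card = 4 := by decide
  rw [h3]; omega

lemma natAbs_dec {s t : ℤ} (h : s.natAbs = t.natAbs) (h2 : 0 < s ↔ 0 < t) (_ : s ≠ 0) : s = t := by omega

lemma QT_nonzero (N m : ℕ) (hm3 : ∀ c : ℤ, c ^ 2 < 2 * N → c.natAbs ≤ m) :
    ((QT N).filter (fun q => ¬ (q.2.1.1 - q.2.2.1) * (q.2.1.1 + q.2.2.1) = 0)).card ≤ 8 * (Quad (2 * m)).card := by
  have : ((QT N).filter (fun q => ¬ (q.2.1.1 - q.2.2.1) * (q.2.1.1 + q.2.2.1) = 0)).card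
     ≤ ((Finset.univ : Finset (Bool × Bool × Bool)) ×ˢ Quad (2 * m)).card := by
    apply Finset.card_le_card_of_injOn
      (fun q => ((decide (0 < q.2.1.1 - q.2.2.1), decide (0 < q.2.1.1 + q.2.2.1), decide (0 < q.2.2.2 - q.2.1.2)),
        (((q.2.1.1 - q.2.2.1).natAbs, (q.2.1.1 + q.2.2.1).natAbs), ((q.2.2.2 - q.2.1.2).natAbs, (q.2.2.2 + q.2.1.2).natAbs))))
    · rintro ⟨n, ⟨a, b⟩, ⟨c, d⟩⟩ hq
      have h0 := (Finset.mem_filter.1 (Finset.mem_coe.1 hq)).2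
      have hq := mem_QT (Finset.mem_filter.1 (Finset.mem_coe.1 hq)).1
      have k1 := mem_Dn hq.2.1
      have k2 := mem_Dn hq.2.2
      have k3 := (Finset.mem_Ico.1 hq.1).2
      simp only at k1 k2 h0 k3
      have k3' : (n:ℤ) < 2 * N := by exact_mod_cast k3
      have ba := hm3 a (by nlinarith [sq_nonneg b])
      have bb := hm3 b (by nlinarith [sq_nonneg a])
      have bc := hm3 c (by nlinarith [sq_nonneg d])
      have bd := hm3 d (by nlinarith [sq_nonneg c])
      have hp : (a - c) * (a + c) = (d - b) * (d + b) := by nlinarith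
      have n1 : a - c ≠ 0 := left_ne_zero_of_mul h0
      have n2 : a + c ≠ 0 := right_ne_zero_of_mul h0
      rw [hp] at h0
      have n3 : d - b ≠ 0 := left_ne_zero_of_mul h0
      have n4 : d + b ≠ 0 := right_ne_zero_of_mul h0
      simp only [Finset.coe_product, Set.mem_prod, Finset.mem_coe, Finset.mem_univ, true_and]
      refine Finset.mem_filter.2 ⟨?_, ?_⟩
      · simp only [Finset.mem_product, Finset.mem_Icc]
        omega
      · simp only
        rw [← Int.natAbs_mul, ← Int.natAbs_mul, hp]
    · rintro ⟨n, ⟨a, b⟩, ⟨c, d⟩⟩ hq ⟨n', ⟨a', b'⟩, ⟨c', d'⟩⟩ hq' h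
      have h0 := (Finset.mem_filter.1 (Finset.mem_coe.1 hq)).2
      have h0' := (Finset.mem_filter.1 (Finset.mem_coe.1 hq')).2
      have hq := mem_QT (Finset.mem_filter.1 (Finset.mem_coe.1 hq)).1
      have hq' := mem_QT (Finset.mem_filter.1 (Finset.mem_coe.1 hq')).1
      simp only at h h0 h0'
      have k1 := mem_Dn hq.2.1
      have k2 := mem_Dn hq.2.2
      have k1' := mem_Dn hq'.2.1
      have k2' := mem_Dn hq'.2.2
      simp only at k1 k2 k1' k2'
      simp only [Prod.mk.injEq, decide_eq_decide] at h
      obtain ⟨⟨s1, s2, s3⟩, ⟨e1, e2⟩, e3, e4⟩ := h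
      have hp : (a - c) * (a + c) = (d - b) * (d + b) := by nlinarith
      have hp' : (a' - c') * (a' + c') = (d' - b') * (d' + b') := by nlinarith
      have n1 : a - c ≠ 0 := left_ne_zero_of_mul h0
      have n2 : a + c ≠ 0 := right_ne_zero_of_mul h0
      have h00 := h0
      rw [hp] at h00
      have n3 : d - b ≠ 0 := left_ne_zero_of_mul h00
      have r1 := natAbs_dec e1 s1 n1
      have r2 := natAbs_dec e2 s2 n2
      have r3 := natAbs_dec e3 s3 n3
      have r4 : d + b = d' + b' := by
        apply mul_left_cancel₀ n3
        rw [← hp, r1, r2, hp', r3]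
      have ea : a = a' := by omega
      have ec : c = c' := by omega
      have eb : b = b' := by omega
      have ed : d = d' := by omega
      subst ea eb ec ed
      have : n = n' := by rw [k1] at k1'; exact_mod_cast k1'
      rw [this]
  refine this.trans ?_
  rw [Finset.card_product]
  have h3 : (Finset.univ : Finset (Bool × Bool × Bool)).card = 8 := by decide
  rw [h3]

theorem sum_r2_sq (N : ℕ) (hN : 1 ≤ N) :
    ∑ n ∈ Finset.Ico N (2 * N), (r2 n : ℝ) ^ 2 ≤ 64 * N * Real.log N + 310 * N := by
  obtain ⟨m, hm1, hm2, hm3⟩ := exists_isqrt N hN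
  have e : ∑ n ∈ Finset.Ico N (2 * N), (r2 n) ^ 2 = (QT N).card := by
    rw [QT, Finset.card_sigma]
    apply Finset.sum_congr rfl
    intro n _
    rw [Finset.card_product, sq]; rfl
  have h1 := Finset.card_filter_add_card_filter_not (s := QT N) (fun q => (q.2.1.1 - q.2.2.1) * (q.2.1.1 + q.2.2.1) = 0)
  have h2 := QT_zero N hN
  have h3 := QT_nonzero N m hm3
  have h4 : ∑ n ∈ Finset.Ico N (2 * N), (r2 n) ^ 2 ≤ 48 * N + 8 * (Quad (2 * m)).card := by omega
  have h5 : ∑ n ∈ Finset.Ico N (2 * N), (r2 n : ℝ) ^ 2 ≤ 48 * N + 8 * ((Quad (2 * m)).card : ℝ) := by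
    exact_mod_cast h4
  have h6 := quad_card (2 * m)
  push_cast at h6
  have hN' : (1:ℝ) ≤ N := by exact_mod_cast hN
  have hm' : (1:ℝ) ≤ m := by exact_mod_cast hm1
  have hm2' : (m:ℝ) ^ 2 + 1 ≤ 2 * N := by exact_mod_cast hm2
  have h7 : 2 * Real.log (2 * (m:ℝ)) ≤ 3 * Real.log 2 + Real.log N := by
    have e1 : 2 * Real.log (2 * (m:ℝ)) = Real.log ((2 * (m:ℝ)) ^ 2) := by rw [Real.log_pow]; norm_num
    have e2 : 3 * Real.log 2 + Real.log N = Real.log (2 ^ 3 * (N:ℝ)) := by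
      rw [Real.log_mul (by norm_num) (by positivity), Real.log_pow]; norm_num
    rw [e1, e2]
    apply Real.log_le_log (by positivity)
    nlinarith
  have hlog : 0 ≤ Real.log (2 * (m:ℝ)) := Real.log_nonneg (by linarith)
  have hl2 := Real.log_two_lt_d9
  calc _ ≤ _ := h5
    _ ≤ 48 * N + 8 * (2 * (2 * (m:ℝ)) ^ 2 * (1 + Real.log (2 * m))) := by gcongr
    _ ≤ 48 * N + 8 * (2 * (8 * (N:ℝ)) * (1 + Real.log (2 * m))) := by gcongr; nlinarith
    _ = 48 * N + 128 * N + 64 * N * (2 * Real.log (2 * m)) := by ring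
    _ ≤ 48 * N + 128 * N + 64 * N * (3 * 0.6931471808 + Real.log N) := by
        gcongr; linarith
    _ ≤ _ := by nlinarith

end EllAux
end M6sec

section M7sec
namespace EllAux

lemma sum_sqrt_le (H : ℕ) : ∑ j ∈ Finset.Ico 1 H, √(j:ℝ) ≤ 2 / 3 * (H * √(H:ℝ)) := by
  induction H with
  | zero => simp
  | succ H ih =>
    rcases Nat.eq_zero_or_pos H with rfl | hH
    · simp; norm_num
    rw [Finset.sum_Ico_succ_top hH]
    have hp := Real.sq_sqrt (Nat.cast_nonneg (α := ℝ) H)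
    have hq := Real.sq_sqrt (Nat.cast_nonneg (α := ℝ) (H + 1))
    have hp0 := Real.sqrt_nonneg (H:ℝ)
    have hq0 := Real.sqrt_nonneg ((H + 1 : ℕ):ℝ)
    push_cast at hq hq0 ⊢
    set p := √(H:ℝ)
    set q := √((H:ℝ) + 1)
    have e : (H:ℝ) = p ^ 2 := hp.symm
    have e2 : q ^ 2 = p ^ 2 + 1 := by rw [hq, hp]
    rw [e] at ih ⊢
    have : 0 ≤ (q - p) ^ 2 * (2 * q + p) := by positivity
    nlinarith

lemma sum_inv_sqrt_le (H : ℕ) : ∑ j ∈ Finset.Ico 1 (H + 1), 1 / √(j:ℝ) ≤ 2 * √(H:ℝ) := by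
  induction H with
  | zero => simp
  | succ H ih =>
    rw [Finset.sum_Ico_succ_top (by omega)]
    have hp := Real.sq_sqrt (Nat.cast_nonneg (α := ℝ) H)
    have hq := Real.sq_sqrt (Nat.cast_nonneg (α := ℝ) (H + 1))
    have hp0 := Real.sqrt_nonneg (H:ℝ)
    have hq0 : 0 < √((H + 1 : ℕ):ℝ) := Real.sqrt_pos.2 (by positivity)
    push_cast at hq hq0 ih ⊢
    set p := √(H:ℝ)
    set q := √((H:ℝ) + 1)
    have e2 : q ^ 2 = p ^ 2 + 1 := by rw [hq, hp]
    have : 1 / q ≤ 2 * (q - p) := by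
      rw [div_le_iff₀ hq0]
      nlinarith [sq_nonneg (q - p)]
    linarith

lemma rh_diff (a : ℝ) (n k : ℕ) : rh a n k = √(a * n + (k:ℝ) ^ 2 / a ^ 2) := rfl

lemma inner_bound {a u Z s : ℝ} (ha : 0 < a) (hu : 0 < u) (hZ : 0 < Z) (hs : 0 < s) {N K : ℕ} (hK : 1 ≤ K)
    (hZ2 : Z ^ 2 = a * N + (K:ℝ) ^ 2 / a ^ 2) (hs2 : s ^ 2 = 3 * u * K / (128 * Z ^ 5))
    {N' k j : ℕ} (hN' : N' ≤ N) (hk : K ≤ k) (hj : 1 ≤ j) (hkj : k + j ≤ 2 * K) :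
    ‖∑ i ∈ Finset.range N', ee (u * rh a (N + i) (k + j) - u * rh a (N + i) k)‖ ≤ 320 * N * s * √(j:ℝ) + 10 / s * (1 / √(j:ℝ)) := by
  have hjr : (1:ℝ) ≤ j := by exact_mod_cast hj
  have hKr : (1:ℝ) ≤ K := by exact_mod_cast hK
  have hkr : (K:ℝ) ≤ k := by exact_mod_cast hk
  have hkjr : (k:ℝ) + j ≤ 2 * K := by exact_mod_cast hkj
  have hNr : (N':ℝ) ≤ N := by exact_mod_cast hN'
  have hlam : 0 < s ^ 2 * j := by positivity
  have key := second_test (lam := s ^ 2 * j) (μ := 64 * (s ^ 2 * j)) hlam (by linarith)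
    (fun i => u * rh a (N + i) (k + j) - u * rh a (N + i) k) N' (by
      intro i hi
      have hir : (i:ℝ) + 2 ≤ N := by
        have : i + 2 ≤ N := by omega
        exact_mod_cast this
      set D : ℝ := (((k + j : ℕ) : ℝ) ^ 2 / a ^ 2) - (k:ℝ) ^ 2 / a ^ 2 with hD
      have hDe : D = (j * (2 * k + j)) / a ^ 2 := by rw [hD]; push_cast; ring
      have hZ5 : 0 < Z ^ 5 := by positivity
      have ph := phase_second_diff (a := a) (u := u) (p := (k:ℝ) ^ 2 / a ^ 2) (p' := ((k + j : ℕ) : ℝ) ^ 2 / a ^ 2)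
        (Z := Z) (D := D) (t := (N:ℝ) + i) ha hu hZ (by gcongr; omega) rfl
        (by rw [hZ2]
            have : (K:ℝ) ^ 2 / a ^ 2 ≤ (k:ℝ) ^ 2 / a ^ 2 := by gcongr
            have : 0 ≤ a * i := by positivity
            linarith)
        (by rw [hZ2]
            have h1 : ((k + j : ℕ) : ℝ) ^ 2 / a ^ 2 ≤ (2 * (K:ℝ)) ^ 2 / a ^ 2 := by push_cast; gcongr
            have h2 : (2 * (K:ℝ)) ^ 2 / a ^ 2 = 4 * ((K:ℝ) ^ 2 / a ^ 2) := by ring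
            have h3 : a * ((N:ℝ) + i + 2) ≤ a * (2 * N) := by gcongr; linarith
            have h4 : 0 ≤ a * N := by positivity
            linarith)
      have b1 : s ^ 2 * j ≤ u * a ^ 2 * (3 * D / (256 * Z ^ 5)) := by
        rw [hs2, hDe]
        have : u * a ^ 2 * (3 * ((j * (2 * k + j)) / a ^ 2) / (256 * Z ^ 5)) = 3 * u * j * (2 * k + j) / (256 * Z ^ 5) := by
          field_simp
        rw [this, div_mul_eq_mul_div, div_le_div_iff₀ (by positivity) (by positivity)]
        have h6 : 3 * u * K * j * 2 ≤ 3 * u * j * (2 * k + j) := by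
          have : 3 * u * j * (2 * K) ≤ 3 * u * j * (2 * k + j) := by
            gcongr; linarith
          linarith
        have := mul_le_mul_of_nonneg_right h6 (by positivity : (0:ℝ) ≤ 128 * Z ^ 5)
        linarith
      have b2 : u * a ^ 2 * (3 * D / (8 * Z ^ 5)) ≤ 64 * (s ^ 2 * j) := by
        rw [hs2, hDe]
        have : u * a ^ 2 * (3 * ((j * (2 * k + j)) / a ^ 2) / (8 * Z ^ 5)) = 3 * u * j * (2 * k + j) / (8 * Z ^ 5) := by
          field_simp
        have h7 : 64 * (3 * u * K / (128 * Z ^ 5) * j) = 3 * u * j * (4 * K) / (8 * Z ^ 5) := by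
          field_simp; ring
        rw [this, h7]
        gcongr
        linarith
      have e : ∀ m : ℕ, rh a (N + (i + m)) (k + j) = √(a * ((N:ℝ) + i + m) + ((k + j : ℕ) : ℝ) ^ 2 / a ^ 2) := by
        intro m; rw [rh]; push_cast; ring_nf
      have e' : ∀ m : ℕ, rh a (N + (i + m)) k = √(a * ((N:ℝ) + i + m) + (k : ℝ) ^ 2 / a ^ 2) := by
        intro m; rw [rh]; push_cast; ring_nf
      have e0 := e 0
      have e0' := e' 0
      have e1 := e 1
      have e1' := e' 1
      have e2 := e 2
      have e2' := e' 2
      simp only [Nat.cast_zero, add_zero, Nat.cast_one] at e0 e0' e1 e1'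
      rw [show ((2:ℕ):ℝ) = 2 by norm_num] at e2 e2'
      simp only [e0, e0', e1, e1', e2, e2']
      constructor
      · linarith [ph.1]
      · linarith [ph.2])
  refine key.trans ?_
  have hsq : √(s ^ 2 * j) = s * √(j:ℝ) := by rw [Real.sqrt_mul (by positivity), Real.sqrt_sq hs.le]
  rw [hsq]
  have hj0 : 0 < √(j:ℝ) := Real.sqrt_pos.2 (by linarith)
  have hj2 : (j:ℝ) = √(j:ℝ) ^ 2 := (Real.sq_sqrt (by linarith)).symm
  calc 5 * (64 * (s ^ 2 * j) * N' + 2) / (s * √(j:ℝ)) ≤ 5 * (64 * (s ^ 2 * j) * N + 2) / (s * √(j:ℝ)) := by gcongr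
    _ = 5 * (64 * (s ^ 2 * √(j:ℝ) ^ 2) * N + 2) / (s * √(j:ℝ)) := by rw [← hj2]
    _ = _ := by field_simp; ring

theorem box_sq {a u Z s : ℝ} (ha : 0 < a) (hu : 0 < u) (hZ : 0 < Z) (hs : 0 < s) {N K : ℕ} (hK : 1 ≤ K)
    (hZ2 : Z ^ 2 = a * N + (K:ℝ) ^ 2 / a ^ 2) (hs2 : s ^ 2 = 3 * u * K / (128 * Z ^ 5))
    {N' K' H : ℕ} (hN' : N' ≤ N) (hK' : K' ≤ K) (hH : 1 ≤ H) (hHK : H ≤ K) :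
    ∑ i ∈ Finset.range N', ‖∑ k ∈ Finset.range K', ee (u * rh a (N + i) (K + k))‖ ^ 2
      ≤ 2 * (K:ℝ) ^ 2 * (N / H + 1280 / 3 * N * s * √(H:ℝ) + 40 / (s * √(H:ℝ))) := by
  set z : ℕ → ℕ → ℂ := fun i k => if k < K' then ee (u * rh a (N + i) (K + k)) else 0 with hz
  have hzn : ∀ i k, ‖z i k‖ ≤ 1 := by
    intro i k; simp only [hz]; split_ifs
    · rw [ee_norm]
    · simp
  have e1 : ∀ i, ∑ k ∈ Finset.range K', ee (u * rh a (N + i) (K + k)) = ∑ k ∈ Finset.range K, z i k := by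
    intro i
    rw [← Finset.sum_subset (Finset.range_subset_range.2 hK')]
    · apply Finset.sum_congr rfl
      intro k hk
      simp only [hz]; rw [if_pos (Finset.mem_range.1 hk)]
    · intro k _ hk
      simp only [hz]; rw [if_neg (by simpa using hk)]
  simp only [e1]
  have hNr : (N':ℝ) ≤ N := by exact_mod_cast hN'
  have hHr : (1:ℝ) ≤ H := by exact_mod_cast hH
  refine (weyl_vdc (Finset.range N') z K H hH hHK).trans ?_
  have t0 : ‖∑ n ∈ Finset.range N', ∑ k ∈ Finset.range K, z n k * (starRingEnd ℂ) (z n k)‖ ≤ N * K := by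
    calc _ ≤ ∑ n ∈ Finset.range N', ∑ k ∈ Finset.range K, (1:ℝ) := by
          refine (norm_sum_le _ _).trans (Finset.sum_le_sum fun n _ => (norm_sum_le _ _).trans (Finset.sum_le_sum fun k _ => ?_))
          rw [norm_mul, Complex.norm_conj]
          nlinarith [hzn n k, norm_nonneg (z n k)]
      _ = N' * K := by simp
      _ ≤ _ := by gcongr
  have tj : ∀ j ∈ Finset.Ico 1 H, ‖∑ n ∈ Finset.range N', ∑ k ∈ Finset.range (K - j), z n (k + j) * (starRingEnd ℂ) (z n k)‖
      ≤ K * (320 * N * s * √(j:ℝ) + 10 / s * (1 / √(j:ℝ))) := by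
    intro j hj
    rw [Finset.mem_Ico] at hj
    rw [Finset.sum_comm]
    have hnn : 0 ≤ 320 * N * s * √(j:ℝ) + 10 / s * (1 / √(j:ℝ)) := by positivity
    calc _ ≤ ∑ k ∈ Finset.range (K - j), (320 * N * s * √(j:ℝ) + 10 / s * (1 / √(j:ℝ))) := by
          refine (norm_sum_le _ _).trans (Finset.sum_le_sum fun k hk => ?_)
          rw [Finset.mem_range] at hk
          by_cases hc : k + j < K'
          · have e2 : ∀ i, z i (k + j) * (starRingEnd ℂ) (z i k) = ee (u * rh a (N + i) (K + k + j) - u * rh a (N + i) (K + k)) := by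
              intro i
              simp only [hz]
              rw [if_pos hc, if_pos (by omega), ← ee_neg, ← ee_add, ← add_assoc, sub_eq_add_neg]
            simp only [e2]
            exact inner_bound ha hu hZ hs hK hZ2 hs2 hN' (by omega) hj.1 (by omega)
          · have e2 : ∀ i, z i (k + j) * (starRingEnd ℂ) (z i k) = 0 := by
              intro i
              simp only [hz]
              rw [if_neg hc, zero_mul]
            simp only [e2, Finset.sum_const_zero, norm_zero]
            exact hnn
      _ = ((K - j : ℕ) : ℝ) * (320 * N * s * √(j:ℝ) + 10 / s * (1 / √(j:ℝ))) := by
          rw [Finset.sum_const, Finset.card_range, nsmul_eq_mul]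
      _ ≤ _ := by gcongr; omega
  have tsum := Finset.sum_le_sum tj
  have hIco : ∑ j ∈ Finset.Ico 1 H, 1 / √(j:ℝ) ≤ 2 * √(H:ℝ) := by
    refine le_trans ?_ (sum_inv_sqrt_le H)
    apply Finset.sum_le_sum_of_subset_of_nonneg
    · apply Finset.Ico_subset_Ico_right; omega
    · intros; positivity
  have tsum2 : ∑ j ∈ Finset.Ico 1 H, (K:ℝ) * (320 * N * s * √(j:ℝ) + 10 / s * (1 / √(j:ℝ)))
      ≤ K * (320 * N * s * (2 / 3 * (H * √(H:ℝ))) + 10 / s * (2 * √(H:ℝ))) := by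
    rw [← Finset.mul_sum, Finset.sum_add_distrib, ← Finset.mul_sum, ← Finset.mul_sum]
    have := sum_sqrt_le H
    gcongr
  have hq0 : 0 < √(H:ℝ) := Real.sqrt_pos.2 (by linarith)
  have hq2 : (H:ℝ) = √(H:ℝ) ^ 2 := (Real.sq_sqrt (by linarith)).symm
  calc _ ≤ (2 * K / H : ℝ) * (N * K + 2 * (K * (320 * N * s * (2 / 3 * (H * √(H:ℝ))) + 10 / s * (2 * √(H:ℝ))))) := by
        gcongr
        exact tsum.trans tsum2
    _ = _ := by
        generalize √(H:ℝ) = q at hq0 hq2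
        rw [hq2]; field_simp; ring

theorem box_choice {a u Z w : ℝ} (ha : 0 < a) (hu : 0 < u) (hZ : 0 < Z) (hw : 0 < w) {N K : ℕ} (hK : 1 ≤ K)
    (hZ2 : Z ^ 2 = a * N + (K:ℝ) ^ 2 / a ^ 2) (hw6 : w ^ 6 = 3 * u * K / (128 * Z ^ 5))
    {N' K' : ℕ} (hN' : N' ≤ N) (hK' : K' ≤ K) :
    ∑ i ∈ Finset.range N', ‖∑ k ∈ Finset.range K', ee (u * rh a (N + i) (K + k))‖ ^ 2
      ≤ 270 * w ^ 2 * N * K ^ 2 + 539 * K ^ 2 / w ^ 2 ∨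
    (w * √(K:ℝ) ≤ 0.21 ∧ ∑ i ∈ Finset.range N', ‖∑ k ∈ Finset.range K', ee (u * rh a (N + i) (K + k))‖ ^ 2
      ≤ 9.92 * N * K + 80 * K * √(K:ℝ) / w ^ 3) := by
  have hw3 : (w ^ 3) ^ 2 = 3 * u * K / (128 * Z ^ 5) := by rw [← hw6]; ring
  have hKr : (1:ℝ) ≤ K := by exact_mod_cast hK
  have hNr : (N':ℝ) ≤ N := by exact_mod_cast hN'
  have hKr' : (K':ℝ) ≤ K := by exact_mod_cast hK'
  rcases le_or_gt (0.0441 / w ^ 2) 1 with hA | hA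
  · left
    have hA : 0.0441 ≤ w ^ 2 := by rwa [div_le_one (by positivity)] at hA
    have : ∑ i ∈ Finset.range N', ‖∑ k ∈ Finset.range K', ee (u * rh a (N + i) (K + k))‖ ^ 2 ≤ N * (K:ℝ) ^ 2 := by
      calc _ ≤ ∑ i ∈ Finset.range N', (K:ℝ) ^ 2 := by
            apply Finset.sum_le_sum
            intro i _
            gcongr
            refine (norm_sum_le _ _).trans ?_
            simp only [ee_norm]
            simpa using hKr'
        _ = N' * (K:ℝ) ^ 2 := by simp
        _ ≤ _ := by gcongr
    refine this.trans ?_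
    have h1 : (N:ℝ) * (K:ℝ) ^ 2 ≤ 270 * w ^ 2 * N * K ^ 2 := by
      have : 0 ≤ (N:ℝ) * (K:ℝ) ^ 2 := by positivity
      nlinarith
    have h2 : 0 ≤ 539 * (K:ℝ) ^ 2 / w ^ 2 := by positivity
    linarith
  rcases le_or_gt (0.0441 / w ^ 2) (K:ℝ) with hB | hB
  · left
    set H0 := 0.0441 / w ^ 2 with hH0
    set H := ⌊H0⌋₊ with hH
    have hH1 : 1 ≤ H := Nat.le_floor (by exact_mod_cast hA.le)
    have hHle : (H:ℝ) ≤ H0 := Nat.floor_le (by positivity)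
    have hHK : H ≤ K := by
      have : (H:ℝ) ≤ K := hHle.trans hB
      exact_mod_cast this
    have hlt : H0 < H + 1 := Nat.lt_floor_add_one _
    have hH1r : (1:ℝ) ≤ H := by exact_mod_cast hH1
    have hHge : H0 / 2 ≤ H := by linarith
    refine (box_sq ha hu hZ (by positivity : 0 < w ^ 3) hK hZ2 hw3 hN' hK' hH1 hHK).trans ?_
    have sH0 : √H0 = 0.21 / w := by
      rw [hH0, show (0.0441:ℝ) / w ^ 2 = (0.21 / w) ^ 2 by rw [div_pow]; norm_num, Real.sqrt_sq (by positivity)]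
    have s1 : √(H:ℝ) ≤ 0.21 / w := by rw [← sH0]; exact Real.sqrt_le_sqrt hHle
    have s2 : 0.21 / w / 1.4143 ≤ √(H:ℝ) := by
      apply Real.le_sqrt_of_sq_le
      refine le_trans ?_ hHge
      rw [hH0, div_pow, div_pow, div_right_comm]
      rw [show (0.0441:ℝ) / w ^ 2 / 2 = 0.0441 / 2 / w ^ 2 by ring]
      gcongr <;> norm_num
    have b1 : (N:ℝ) / H ≤ N * (45.36 * w ^ 2) := by
      have : (N:ℝ) / H ≤ N / (H0 / 2) := by gcongr
      refine this.trans ?_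
      rw [hH0, div_eq_mul_inv]
      gcongr
      rw [inv_div, div_div_eq_mul_div, div_le_iff₀ (by norm_num)]
      nlinarith [sq_nonneg w]
    have b2 : 1280 / 3 * N * w ^ 3 * √(H:ℝ) ≤ N * (89.6 * w ^ 2) := by
      calc _ ≤ 1280 / 3 * N * w ^ 3 * (0.21 / w) := by gcongr
        _ = _ := by field_simp; ring
    have b3 : 40 / (w ^ 3 * √(H:ℝ)) ≤ 269.4 / w ^ 2 := by
      calc _ ≤ 40 / (w ^ 3 * (0.21 / w / 1.4143)) := by gcongr
        _ = (40 * 1.4143 / 0.21) / w ^ 2 := by field_simp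
        _ ≤ _ := by gcongr; norm_num
    have hK2 : 0 ≤ 2 * (K:ℝ) ^ 2 := by positivity
    have := mul_le_mul_of_nonneg_left (add_le_add (add_le_add b1 b2) b3) hK2
    refine this.trans ?_
    have g1 : 0 ≤ w ^ 2 * N * (K:ℝ) ^ 2 := by positivity
    have g2 : 0 ≤ (K:ℝ) ^ 2 / w ^ 2 := by positivity
    have e : 2 * (K:ℝ) ^ 2 * (N * (45.36 * w ^ 2) + N * (89.6 * w ^ 2) + 269.4 / w ^ 2)
      = 269.92 * (w ^ 2 * N * (K:ℝ) ^ 2) + 538.8 * ((K:ℝ) ^ 2 / w ^ 2) := by ring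
    have e' : 270 * w ^ 2 * N * K ^ 2 + 539 * K ^ 2 / w ^ 2 = 270 * (w ^ 2 * N * (K:ℝ) ^ 2) + 539 * ((K:ℝ) ^ 2 / w ^ 2) := by ring
    rw [e, e']
    linarith
  · right
    have q0 : 0 < √(K:ℝ) := Real.sqrt_pos.2 (by linarith)
    have q2 : √(K:ℝ) ^ 2 = K := Real.sq_sqrt (by linarith)
    have hwk : w * √(K:ℝ) ≤ 0.21 := by
      rw [lt_div_iff₀ (by positivity), ← q2] at hB
      nlinarith [mul_pos hw q0]
    refine ⟨hwk, ?_⟩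
    refine (box_sq ha hu hZ (by positivity : 0 < w ^ 3) hK hZ2 hw3 hN' hK' hK le_rfl).trans ?_
    have c3 : (w * √(K:ℝ)) ^ 3 ≤ 0.21 ^ 3 := by gcongr
    generalize √(K:ℝ) = q at *
    rw [← q2]
    have e : 2 * (q ^ 2) ^ 2 * (N / q ^ 2 + 1280 / 3 * N * w ^ 3 * q + 40 / (w ^ 3 * q))
      = (2 + 2560 / 3 * (w * q) ^ 3) * N * q ^ 2 + 80 * q ^ 2 * q / w ^ 3 := by field_simp; ring
    rw [e]
    gcongr
    norm_num at c3 ⊢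
    linarith

end EllAux
end M7sec

section M8sec
namespace EllAux

set_option maxHeartbeats 1000000 in
theorem box_S {a u Z v m g : ℝ} (ha : 0 < a) (hu : 0 < u) (hZ : 0 < Z) (hv : 0 < v) (hm : 0 < m) (hg : 0 ≤ g)
    {N K : ℕ} (hK : 1 ≤ K)
    (hZ2 : Z ^ 2 = a * N + (K:ℝ) ^ 2 / a ^ 2) (hv6 : v ^ 6 = u * K / Z ^ 5) (hm8 : m ^ 8 = Z ^ 5 / u)
    (hr : ∑ n ∈ Finset.Ico N (2 * N), (r2 n : ℝ) ^ 2 ≤ g ^ 2 * N)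
    {N' K' : ℕ} (hN' : N' ≤ N) (hK' : K' ≤ K) :
    ‖∑ i ∈ Finset.range N', ∑ k ∈ Finset.range K', (r2 (N + i) : ℂ) * ee (u * rh a (N + i) (K + k))‖
      ≤ g * (8.8 * N * K * v + 43.5 * √(N:ℝ) * K / v + 1.57 * N * m + 11.4 * √(N:ℝ) * m ^ 3) := by
  have hKr : (1:ℝ) ≤ K := by exact_mod_cast hK
  set A : ℕ → ℂ := fun i => ∑ k ∈ Finset.range K', ee (u * rh a (N + i) (K + k)) with hA
  set V : ℝ := ∑ i ∈ Finset.range N', ‖A i‖ ^ 2 with hV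
  have h1 : ‖∑ i ∈ Finset.range N', ∑ k ∈ Finset.range K', (r2 (N + i) : ℂ) * ee (u * rh a (N + i) (K + k))‖
      ≤ ∑ i ∈ Finset.range N', (r2 (N + i) : ℝ) * ‖A i‖ := by
    refine (norm_sum_le _ _).trans (Finset.sum_le_sum fun i _ => ?_)
    rw [← Finset.mul_sum, norm_mul, Complex.norm_natCast]
  have h2 := Real.sum_mul_le_sqrt_mul_sqrt (Finset.range N') (fun i => (r2 (N + i) : ℝ)) (fun i => ‖A i‖)
  have h3 : ∑ i ∈ Finset.range N', (r2 (N + i) : ℝ) ^ 2 ≤ g ^ 2 * N := by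
    refine le_trans ?_ hr
    rw [Finset.sum_Ico_eq_sum_range]
    have : 2 * N - N = N := by omega
    rw [this]
    apply Finset.sum_le_sum_of_subset_of_nonneg (Finset.range_subset_range.2 hN')
    intros; positivity
  have q0 : 0 ≤ √(N:ℝ) := Real.sqrt_nonneg _
  have q2 : √(N:ℝ) ^ 2 = N := Real.sq_sqrt (by positivity)
  have h4 : √(∑ i ∈ Finset.range N', (r2 (N + i) : ℝ) ^ 2) ≤ g * √(N:ℝ) := by
    apply Real.sqrt_le_iff.2 ⟨by positivity, ?_⟩
    rw [mul_pow, q2]; exact h3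
  have fin : ∀ E : ℝ, 0 ≤ E → V ≤ E ^ 2 → ‖∑ i ∈ Finset.range N', ∑ k ∈ Finset.range K', (r2 (N + i) : ℂ) * ee (u * rh a (N + i) (K + k))‖
      ≤ g * (√(N:ℝ) * E) := by
    intro E hE hVE
    have h5 : √V ≤ E := Real.sqrt_le_iff.2 ⟨hE, hVE⟩
    calc _ ≤ _ := h1
      _ ≤ _ := h2
      _ ≤ (g * √(N:ℝ)) * E := by gcongr
      _ = _ := by ring
  set w : ℝ := (3 * u * K / (128 * Z ^ 5)) ^ ((1:ℝ) / 6) with hw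
  have hbase : 0 < 3 * u * K / (128 * Z ^ 5) := by positivity
  have hw0 : 0 < w := Real.rpow_pos_of_pos hbase _
  have hw6 : w ^ 6 = 3 * u * K / (128 * Z ^ 5) := by
    rw [hw, ← Real.rpow_natCast, ← Real.rpow_mul hbase.le]; norm_num
  have hwv : w ^ 6 = 3 / 128 * v ^ 6 := by rw [hw6, hv6]; field_simp
  have wup : w ≤ 0.535 * v := by
    refine le_of_pow_le_pow_left₀ (n := 6) (by norm_num) (by positivity) ?_
    rw [hwv, mul_pow]
    gcongr; norm_num
  have wlo : 0.5349 * v ≤ w := by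
    refine le_of_pow_le_pow_left₀ (n := 6) (by norm_num) (by positivity) ?_
    rw [hwv, mul_pow]
    gcongr; norm_num
  have hVnn : 0 ≤ V := Finset.sum_nonneg (fun _ _ => by positivity)
  rcases box_choice ha hu hZ hw0 hK hZ2 hw6 hN' hK' with hc | ⟨hc0, hc⟩
  · have hc' : V ≤ (16.44 * w * √(N:ℝ) * K + 23.22 * K / w) ^ 2 := by
      refine hc.trans ?_
      have e : (16.44 * w * √(N:ℝ) * K + 23.22 * K / w) ^ 2 = 16.44 ^ 2 * (w ^ 2 * √(N:ℝ) ^ 2 * K ^ 2)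
        + 23.22 ^ 2 * ((K:ℝ) ^ 2 / w ^ 2) + 2 * 16.44 * 23.22 * √(N:ℝ) * K ^ 2 := by
        field_simp; ring
      rw [e, q2]
      have g1 : 0 ≤ w ^ 2 * N * (K:ℝ) ^ 2 := by positivity
      have g2 : 0 ≤ (K:ℝ) ^ 2 / w ^ 2 := by positivity
      have g3 : 0 ≤ 2 * 16.44 * 23.22 * √(N:ℝ) * (K:ℝ) ^ 2 := by positivity
      have e' : 270 * w ^ 2 * N * K ^ 2 + 539 * K ^ 2 / w ^ 2 = 270 * (w ^ 2 * N * (K:ℝ) ^ 2) + 539 * ((K:ℝ) ^ 2 / w ^ 2) := by ring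
      rw [e']
      norm_num at g1 g2 g3 ⊢
      linarith
    refine (fin _ (by positivity) hc').trans ?_
    gcongr
    have b1 : √(N:ℝ) * (16.44 * w * √(N:ℝ) * K + 23.22 * K / w) = 16.44 * N * K * w + 23.22 * √(N:ℝ) * K / w := by
      have : √(N:ℝ) * (16.44 * w * √(N:ℝ) * K + 23.22 * K / w) = 16.44 * √(N:ℝ) ^ 2 * K * w + 23.22 * √(N:ℝ) * K / w := by ring
      rw [this, q2]
    rw [b1]
    have b2 : 16.44 * N * K * w ≤ 8.8 * N * K * v := by
      calc 16.44 * (N:ℝ) * K * w ≤ 16.44 * N * K * (0.535 * v) := by gcongr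
        _ = (16.44 * 0.535) * (N * K * v) := by ring
        _ ≤ 8.8 * (N * K * v) := by gcongr; norm_num
        _ = _ := by ring
    have b3 : 23.22 * √(N:ℝ) * K / w ≤ 43.5 * √(N:ℝ) * K / v := by
      calc 23.22 * √(N:ℝ) * K / w ≤ 23.22 * √(N:ℝ) * K / (0.5349 * v) := by gcongr
        _ = (23.22 / 0.5349) * (√(N:ℝ) * K / v) := by field_simp
        _ ≤ 43.5 * (√(N:ℝ) * K / v) := by gcongr; norm_num
        _ = _ := by ring
    have b4 : 0 ≤ 1.57 * N * m := by positivity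
    have b5 : 0 ≤ 11.4 * √(N:ℝ) * m ^ 3 := by positivity
    linarith
  · have p0 : 0 < √(K:ℝ) := Real.sqrt_pos.2 (by linarith)
    have p2 : √(K:ℝ) ^ 2 = K := Real.sq_sqrt (by linarith)
    have hmZ : 3 * u * K / (128 * Z ^ 5) = 3 / 128 * K / m ^ 8 := by
      rw [hm8]; field_simp
    rw [hmZ] at hw6
    have hKm : √(K:ℝ) ≤ 0.497 * m := by
      refine le_of_pow_le_pow_left₀ (n := 8) (by norm_num) (by positivity) ?_
      have := pow_le_pow_left₀ (by positivity) hc0 6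
      rw [mul_pow, hw6, div_mul_eq_mul_div, div_le_iff₀ (by positivity)] at this
      rw [mul_pow]
      nlinarith [pow_pos hm 8]
    have hw3 : 1 / w ^ 3 ≤ 6.5321 * m ^ 4 / √(K:ℝ) := by
      refine le_of_pow_le_pow_left₀ (n := 2) (by norm_num) (by positivity) ?_
      rw [div_pow, div_pow, p2, ← pow_mul, hw6, mul_pow, ← pow_mul]
      norm_num
      rw [div_le_div_iff₀ (by positivity) (by positivity)]
      have : 0 < m ^ 8 * K := by positivity
      norm_num at this ⊢
      nlinarith
    have hc' : V ≤ (1.57 * √(N:ℝ) * m + 11.4 * m ^ 3) ^ 2 := by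
      refine hc.trans ?_
      have e1 : 80 * K * √(K:ℝ) / w ^ 3 ≤ 522.57 * (K * m ^ 4) := by
        calc 80 * K * √(K:ℝ) / w ^ 3 = 80 * K * √(K:ℝ) * (1 / w ^ 3) := by ring
          _ ≤ 80 * K * √(K:ℝ) * (6.5321 * m ^ 4 / √(K:ℝ)) := by gcongr
          _ = (80 * 6.5321) * (K * m ^ 4) := by field_simp
          _ ≤ _ := by gcongr; norm_num
      have e2 : (K:ℝ) ≤ 0.247009 * m ^ 2 := by
        rw [← p2]
        calc _ ≤ (0.497 * m) ^ 2 := by gcongr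
          _ = _ := by ring
      have e3 : 9.92 * N * (K:ℝ) ≤ 2.4504 * (N * m ^ 2) := by
        calc 9.92 * N * (K:ℝ) ≤ 9.92 * N * (0.247009 * m ^ 2) := by gcongr
          _ = (9.92 * 0.247009) * (N * m ^ 2) := by ring
          _ ≤ _ := by gcongr; norm_num
      have e4 : 522.57 * (K * m ^ 4) ≤ 129.1 * m ^ 6 := by
        calc 522.57 * (K * m ^ 4) ≤ 522.57 * (0.247009 * m ^ 2 * m ^ 4) := by gcongr
          _ = (522.57 * 0.247009) * m ^ 6 := by ring
          _ ≤ _ := by gcongr; norm_num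
      have e : (1.57 * √(N:ℝ) * m + 11.4 * m ^ 3) ^ 2 = 1.57 ^ 2 * (√(N:ℝ) ^ 2 * m ^ 2)
        + 11.4 ^ 2 * m ^ 6 + 2 * 1.57 * 11.4 * √(N:ℝ) * m ^ 4 := by ring
      rw [e, q2]
      have g1 : 0 ≤ N * m ^ 2 := by positivity
      have g2 : 0 ≤ m ^ 6 := by positivity
      have g3 : 0 ≤ 2 * 1.57 * 11.4 * √(N:ℝ) * m ^ 4 := by positivity
      norm_num at g1 g2 g3 e1 e3 e4 ⊢
      linarith
    refine (fin _ (by positivity) hc').trans ?_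
    gcongr
    have b1 : √(N:ℝ) * (1.57 * √(N:ℝ) * m + 11.4 * m ^ 3) = 1.57 * √(N:ℝ) ^ 2 * m + 11.4 * √(N:ℝ) * m ^ 3 := by ring
    rw [b1, q2]
    have b4 : 0 ≤ 8.8 * N * K * v := by positivity
    have b5 : 0 ≤ 43.5 * √(N:ℝ) * K / v := by positivity
    linarith

/-! Abel summation -/

lemma abel_id (b : ℕ → ℝ) (v : ℕ → ℂ) (K : ℕ) :
    ∑ k ∈ Finset.range K, (b k : ℂ) * v k = b K * ∑ k ∈ Finset.range K, v k
      + ∑ m ∈ Finset.range K, ((b m - b (m + 1) : ℝ) : ℂ) * ∑ k ∈ Finset.range (m + 1), v k := by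
  induction K with
  | zero => simp
  | succ K ih =>
    rw [Finset.sum_range_succ, ih, Finset.sum_range_succ _ K, Finset.sum_range_succ (fun m => ((b m - b (m + 1) : ℝ) : ℂ) * _) K,
      Finset.sum_range_succ _ K]
    push_cast; ring

lemma abel_one (b : ℕ → ℝ) (v : ℕ → ℂ) (K : ℕ) (M : ℝ) (hb : ∀ k, 0 ≤ b k) (hd : ∀ k, b (k + 1) ≤ b k)
    (hM : ∀ K' ≤ K, ‖∑ k ∈ Finset.range K', v k‖ ≤ M) :
    ‖∑ k ∈ Finset.range K, (b k : ℂ) * v k‖ ≤ b 0 * M := by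
  rw [abel_id]
  have h1 : ‖(b K : ℂ) * ∑ k ∈ Finset.range K, v k‖ ≤ b K * M := by
    rw [norm_mul, Complex.norm_real, Real.norm_of_nonneg (hb K)]
    exact mul_le_mul_of_nonneg_left (hM K le_rfl) (hb K)
  have h2 : ‖∑ m ∈ Finset.range K, ((b m - b (m + 1) : ℝ) : ℂ) * ∑ k ∈ Finset.range (m + 1), v k‖
      ≤ ∑ m ∈ Finset.range K, (b m - b (m + 1)) * M := by
    refine (norm_sum_le _ _).trans (Finset.sum_le_sum fun m hm => ?_)
    rw [norm_mul, Complex.norm_real, Real.norm_of_nonneg (by linarith [hd m])]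
    exact mul_le_mul_of_nonneg_left (hM (m + 1) (Finset.mem_range.1 hm)) (by linarith [hd m])
  rw [← Finset.sum_mul, Finset.sum_range_sub'] at h2
  refine (norm_add_le _ _).trans ?_
  linarith

lemma abel_two (b : ℕ → ℕ → ℝ) (v : ℕ → ℕ → ℂ) (N K : ℕ) (M : ℝ) (hb : ∀ n k, 0 ≤ b n k)
    (hd1 : ∀ n k, b (n + 1) k ≤ b n k) (hd2 : ∀ n k, b n (k + 1) ≤ b n k)
    (hd3 : ∀ n k, b (n + 1) k - b (n + 1) (k + 1) ≤ b n k - b n (k + 1))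
    (hM : ∀ N' ≤ N, ∀ K' ≤ K, ‖∑ n ∈ Finset.range N', ∑ k ∈ Finset.range K', v n k‖ ≤ M) :
    ‖∑ n ∈ Finset.range N, ∑ k ∈ Finset.range K, (b n k : ℂ) * v n k‖ ≤ b 0 0 * M := by
  have e : ∑ n ∈ Finset.range N, ∑ k ∈ Finset.range K, (b n k : ℂ) * v n k
      = ∑ n ∈ Finset.range N, (b n K : ℂ) * ∑ k ∈ Finset.range K, v n k
        + ∑ m ∈ Finset.range K, ∑ n ∈ Finset.range N, ((b n m - b n (m + 1) : ℝ) : ℂ) * ∑ k ∈ Finset.range (m + 1), v n k := by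
    rw [Finset.sum_comm (s := Finset.range K), ← Finset.sum_add_distrib]
    exact Finset.sum_congr rfl (fun n _ => abel_id (b n) (v n) K)
  rw [e]
  have h1 := abel_one (fun n => b n K) (fun n => ∑ k ∈ Finset.range K, v n k) N M (fun n => hb n K) (fun n => hd1 n K)
    (fun N' hN' => hM N' hN' K le_rfl)
  have h2 : ‖∑ m ∈ Finset.range K, ∑ n ∈ Finset.range N, ((b n m - b n (m + 1) : ℝ) : ℂ) * ∑ k ∈ Finset.range (m + 1), v n k‖
      ≤ ∑ m ∈ Finset.range K, (b 0 m - b 0 (m + 1)) * M := by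
    refine (norm_sum_le _ _).trans (Finset.sum_le_sum fun m hm => ?_)
    exact abel_one (fun n => b n m - b n (m + 1)) (fun n => ∑ k ∈ Finset.range (m + 1), v n k) N M
      (fun n => by linarith [hd2 n m]) (fun n => hd3 n m) (fun N' hN' => hM N' hN' (m + 1) (Finset.mem_range.1 hm))
  rw [← Finset.sum_mul, Finset.sum_range_sub'] at h2
  refine (norm_add_le _ _).trans ?_
  linarith

end EllAux
end M8sec

section M9sec
namespace EllAux

lemma ee_re (t : ℝ) : (ee t).re = cos (2 * π * t) := by
  have : ee t = Complex.exp (((2 * π * t : ℝ) : ℂ) * Complex.I) := by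
    rw [ee]; push_cast; rfl
  rw [this, Complex.exp_ofReal_mul_I_re]

lemma ghat_deriv {ρ : ℝ} (hρ : 0 < ρ) (u : ℝ) :
    HasDerivAt (fun u => ghat u ρ) (-cos (2 * π * u * ρ) / (2 * π ^ 3 * ρ ^ 4) - u * sin (2 * π * u * ρ) / (2 * π ^ 2 * ρ ^ 3)
      + 1 / (2 * π ^ 3 * ρ ^ 4)) u := by
  have hl : HasDerivAt (fun u : ℝ => 2 * π * u * ρ) (2 * π * ρ) u := by
    have := ((hasDerivAt_id u).const_mul (2 * π)).mul_const ρ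
    simpa using this
  have hc := hl.cos
  have hs := hl.sin
  have h1 := ((hasDerivAt_id u).mul hc).div_const (4 * π ^ 3 * ρ ^ 4)
  have h2 := (hs.const_mul 3).div_const (8 * π ^ 4 * ρ ^ 5)
  have h3 := (hasDerivAt_id u).div_const (2 * π ^ 3 * ρ ^ 4)
  have h := (h1.sub h2).add h3
  refine HasDerivAt.congr_deriv h ?_
  have := Real.pi_pos
  simp only [id]
  field_simp
  ring

lemma ghat_deriv2 {ρ : ℝ} (hρ : 0 < ρ) (u : ℝ) :
    HasDerivAt (fun u => -cos (2 * π * u * ρ) / (2 * π ^ 3 * ρ ^ 4) - u * sin (2 * π * u * ρ) / (2 * π ^ 2 * ρ ^ 3)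
      + 1 / (2 * π ^ 3 * ρ ^ 4)) (sin (2 * π * u * ρ) / (2 * π ^ 2 * ρ ^ 3) - u * cos (2 * π * u * ρ) / (π * ρ ^ 2)) u := by
  have hl : HasDerivAt (fun u : ℝ => 2 * π * u * ρ) (2 * π * ρ) u := by
    have := ((hasDerivAt_id u).const_mul (2 * π)).mul_const ρ
    simpa using this
  have hc := hl.cos
  have hs := hl.sin
  have h1 := hc.neg.div_const (2 * π ^ 3 * ρ ^ 4)
  have h2 := ((hasDerivAt_id u).mul hs).div_const (2 * π ^ 2 * ρ ^ 3)
  have h := (h1.sub h2).add_const (1 / (2 * π ^ 3 * ρ ^ 4))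
  refine HasDerivAt.congr_deriv h ?_
  have := Real.pi_pos
  simp only [id]
  field_simp
  ring

lemma tauA {ι : Type*} (s : Finset ι) (r ρ : ι → ℝ) (hρ : ∀ p ∈ s, 0 < ρ p) {c δ : ℝ} (hδ : 0 < δ) :
    ∃ η ∈ Set.Icc (c - δ) (c + δ), ∑ p ∈ s, r p * tau c δ (ρ p) = δ ^ 2 * ∑ p ∈ s, r p *
      (sin (2 * π * η * ρ p) / (2 * π ^ 2 * ρ p ^ 3) - η * cos (2 * π * η * ρ p) / (π * ρ p ^ 2)) := by
  obtain ⟨η, hη, e⟩ := second_diff_mvt (φ := fun u => ∑ p ∈ s, r p * ghat u (ρ p))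
    (φ' := fun u => ∑ p ∈ s, r p * (-cos (2 * π * u * ρ p) / (2 * π ^ 3 * ρ p ^ 4) - u * sin (2 * π * u * ρ p) / (2 * π ^ 2 * ρ p ^ 3)
      + 1 / (2 * π ^ 3 * ρ p ^ 4)))
    (φ'' := fun u => ∑ p ∈ s, r p *
      (sin (2 * π * u * ρ p) / (2 * π ^ 2 * ρ p ^ 3) - u * cos (2 * π * u * ρ p) / (π * ρ p ^ 2))) (s := c - δ) (h := δ) hδ
    (fun t _ => HasDerivAt.fun_sum (fun p hp => (ghat_deriv (hρ p hp) t).const_mul (r p)))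
    (fun t _ => HasDerivAt.fun_sum (fun p hp => (ghat_deriv2 (hρ p hp) t).const_mul (r p)))
  have e1 : c - δ + 2 * δ = c + δ := by ring
  have e2 : c - δ + δ = c := by ring
  rw [e1] at hη e
  rw [e2] at e
  refine ⟨η, hη, ?_⟩
  rw [← e]
  simp only [tau]
  rw [Finset.mul_sum, ← Finset.sum_sub_distrib, ← Finset.sum_add_distrib]
  apply Finset.sum_congr rfl
  intro p _; ring

noncomputable def hh (u ρ : ℝ) : ℝ := u * cos (2 * π * u * ρ) / (4 * π ^ 3 * ρ ^ 4) - 3 * sin (2 * π * u * ρ) / (8 * π ^ 4 * ρ ^ 5)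

lemma tau_hh (c δ ρ : ℝ) : tau c δ ρ = hh (c + δ) ρ - 2 * hh c ρ + hh (c - δ) ρ := by
  simp only [tau, hh, ghat]; ring

lemma tauB {ι : Type*} (s : Finset ι) (r ρ : ι → ℝ) {c δ M : ℝ} (hδ : 0 < δ)
    (hM : ∀ u ∈ Set.Icc (c - δ) (c + δ), |∑ p ∈ s, r p * hh u (ρ p)| ≤ M) :
    |∑ p ∈ s, r p * tau c δ (ρ p)| ≤ 4 * M := by
  have e : ∑ p ∈ s, r p * tau c δ (ρ p) = ∑ p ∈ s, r p * hh (c + δ) (ρ p) - 2 * ∑ p ∈ s, r p * hh c (ρ p)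
      + ∑ p ∈ s, r p * hh (c - δ) (ρ p) := by
    rw [Finset.mul_sum, ← Finset.sum_sub_distrib, ← Finset.sum_add_distrib]
    apply Finset.sum_congr rfl
    intro p _; rw [tau_hh]; ring
  have h1 := abs_le.1 (hM (c + δ) ⟨by linarith, by linarith⟩)
  have h2 := abs_le.1 (hM c ⟨by linarith, by linarith⟩)
  have h3 := abs_le.1 (hM (c - δ) ⟨by linarith, by linarith⟩)
  rw [e, abs_le]
  constructor <;> linarith [h1.1, h1.2, h2.1, h2.2, h3.1, h3.2]

lemma hh_abs {u ρ : ℝ} (hu : 0 ≤ u) (hρ : 0 < ρ) : |hh u ρ| ≤ u / (4 * π ^ 3 * ρ ^ 4) + 3 / (8 * π ^ 4 * ρ ^ 5) := by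
  have hπ := Real.pi_pos
  rw [hh]
  refine (abs_sub _ _).trans ?_
  have h1 : |u * cos (2 * π * u * ρ) / (4 * π ^ 3 * ρ ^ 4)| ≤ u / (4 * π ^ 3 * ρ ^ 4) := by
    rw [abs_div, abs_mul, abs_of_nonneg hu, abs_of_pos (by positivity : 0 < 4 * π ^ 3 * ρ ^ 4)]
    gcongr
    nlinarith [Real.abs_cos_le_one (2 * π * u * ρ)]
  have h2 : |3 * sin (2 * π * u * ρ) / (8 * π ^ 4 * ρ ^ 5)| ≤ 3 / (8 * π ^ 4 * ρ ^ 5) := by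
    rw [abs_div, abs_mul, abs_of_pos (by positivity : 0 < 8 * π ^ 4 * ρ ^ 5), abs_of_pos (by norm_num : (0:ℝ) < 3)]
    gcongr
    nlinarith [Real.abs_sin_le_one (2 * π * u * ρ)]
  linarith

/-- pointwise bound B -/
lemma tau_ptB {c δ ρ : ℝ} (hδ : 0 < δ) (hc : δ ≤ c) (hρ : 0 < ρ) :
    |tau c δ ρ| ≤ c / (π ^ 3 * ρ ^ 4) + 3 / (2 * π ^ 4 * ρ ^ 5) := by
  have hπ := Real.pi_pos
  rw [tau_hh]
  have h1 := abs_le.1 (hh_abs (u := c + δ) (by linarith) hρ)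
  have h2 := abs_le.1 (hh_abs (u := c) (by linarith) hρ)
  have h3 := abs_le.1 (hh_abs (u := c - δ) (by linarith) hρ)
  have e : c / (π ^ 3 * ρ ^ 4) + 3 / (2 * π ^ 4 * ρ ^ 5) = ((c + δ) / (4 * π ^ 3 * ρ ^ 4) + 3 / (8 * π ^ 4 * ρ ^ 5))
     + 2 * (c / (4 * π ^ 3 * ρ ^ 4) + 3 / (8 * π ^ 4 * ρ ^ 5)) + ((c - δ) / (4 * π ^ 3 * ρ ^ 4) + 3 / (8 * π ^ 4 * ρ ^ 5)) := by
    field_simp; ring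
  rw [e, abs_le]
  constructor <;> linarith [h1.1, h1.2, h2.1, h2.2, h3.1, h3.2]

/-- pointwise bound A -/
lemma tau_ptA {c δ ρ : ℝ} (hδ : 0 < δ) (hc : δ ≤ c) (hρ : 0 < ρ) :
    |tau c δ ρ| ≤ δ ^ 2 * ((c + δ) / (π * ρ ^ 2) + 1 / (2 * π ^ 2 * ρ ^ 3)) := by
  have hπ := Real.pi_pos
  obtain ⟨η, hη, e⟩ := tauA ({0} : Finset ℕ) (fun _ => 1) (fun _ => ρ) (fun _ _ => hρ) (c := c) hδ
  simp only [Finset.sum_singleton, one_mul] at e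
  rw [e, abs_mul, abs_of_nonneg (by positivity)]
  rw [Set.mem_Icc] at hη
  gcongr
  refine (abs_sub _ _).trans ?_
  have h1 : |η * cos (2 * π * η * ρ) / (π * ρ ^ 2)| ≤ (c + δ) / (π * ρ ^ 2) := by
    rw [abs_div, abs_mul, abs_of_nonneg (by linarith : 0 ≤ η), abs_of_pos (by positivity : 0 < π * ρ ^ 2)]
    gcongr
    nlinarith [Real.abs_cos_le_one (2 * π * η * ρ), abs_nonneg (cos (2 * π * η * ρ))]
  have h2 : |sin (2 * π * η * ρ) / (2 * π ^ 2 * ρ ^ 3)| ≤ 1 / (2 * π ^ 2 * ρ ^ 3) := by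
    rw [abs_div, abs_of_pos (by positivity : 0 < 2 * π ^ 2 * ρ ^ 3)]
    gcongr
    exact Real.abs_sin_le_one _
  linarith

lemma inv_mixed {p α D : ℝ} (hp : 0 < p) (hα : 0 ≤ α) (hD : 0 ≤ D) :
    1 / (p + α) - 1 / (p + α + D) ≤ 1 / p - 1 / (p + D) := by
  have e1 : 1 / (p + α) - 1 / (p + α + D) = D / ((p + α) * (p + α + D)) := by field_simp; ring
  have e2 : 1 / p - 1 / (p + D) = D / (p * (p + D)) := by field_simp; ring
  rw [e1, e2]
  gcongr <;> linarith

lemma inv_mixed2 {p α D : ℝ} (hp : 0 < p) (hα : 0 ≤ α) (hD : 0 ≤ D) :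
    (1 / (p + α)) ^ 2 - (1 / (p + α + D)) ^ 2 ≤ (1 / p) ^ 2 - (1 / (p + D)) ^ 2 := by
  have e : ∀ s t : ℝ, s ^ 2 - t ^ 2 = (s - t) * (s + t) := by intros; ring
  rw [e, e]
  have h1 := inv_mixed hp hα hD
  have h2 : 1 / (p + α) ≤ 1 / p := by gcongr; linarith
  have h3 : 1 / (p + α + D) ≤ 1 / (p + D) := by gcongr; linarith
  have h4 : 0 ≤ 1 / p - 1 / (p + D) := by
    rw [sub_nonneg]; gcongr; linarith
  gcongr

lemma box_abel {a : ℝ} (ha : 0 < a) {N K : ℕ} (hN : 1 ≤ N) (u M : ℝ)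
    (hM : ∀ N' ≤ N, ∀ K' ≤ K, ‖∑ i ∈ Finset.range N', ∑ k ∈ Finset.range K', (r2 (N + i) : ℂ) * ee (u * rh a (N + i) (K + k))‖ ≤ M) :
    |∑ i ∈ Finset.range N, ∑ k ∈ Finset.range K, (r2 (N + i) : ℝ) * (cos (2 * π * u * rh a (N + i) (K + k)) / rh a (N + i) (K + k) ^ 2)|
      ≤ 1 / rh a N K ^ 2 * M ∧
    |∑ i ∈ Finset.range N, ∑ k ∈ Finset.range K, (r2 (N + i) : ℝ) * (cos (2 * π * u * rh a (N + i) (K + k)) / rh a (N + i) (K + k) ^ 4)|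
      ≤ 1 / rh a N K ^ 4 * M := by
  set p : ℕ → ℕ → ℝ := fun i k => a * ((N + i : ℕ):ℝ) + ((K + k : ℕ):ℝ) ^ 2 / a ^ 2 with hp
  have hNr : (1:ℝ) ≤ N := by exact_mod_cast hN
  have hp0 : ∀ i k, 0 < p i k := by
    intro i k; simp only [hp]; push_cast; positivity
  have hr2 : ∀ i k, rh a (N + i) (K + k) ^ 2 = p i k := fun i k => Real.sq_sqrt (hp0 i k).le
  have hr4 : ∀ i k, rh a (N + i) (K + k) ^ 4 = p i k ^ 2 := fun i k => by
    rw [← hr2]; ring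
  have pn : ∀ i k, p (i + 1) k = p i k + a := by intro i k; simp only [hp]; push_cast; ring
  have pk : ∀ i k, p i (k + 1) = p i k + (2 * (K + k) + 1) / a ^ 2 := by
    intro i k; simp only [hp]; push_cast; ring
  have hD : ∀ k : ℕ, 0 ≤ (2 * ((K:ℝ) + k) + 1) / a ^ 2 := fun k => by positivity
  have hre : ∀ i k, (((r2 (N + i) : ℂ) * ee (u * rh a (N + i) (K + k)))).re = r2 (N + i) * cos (2 * π * u * rh a (N + i) (K + k)) := by
    intro i k
    rw [← Complex.ofReal_natCast, Complex.re_ofReal_mul, ee_re]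
    congr 2; ring
  have gen : ∀ b : ℕ → ℕ → ℝ, ∑ i ∈ Finset.range N, ∑ k ∈ Finset.range K, (r2 (N + i) : ℝ) * (cos (2 * π * u * rh a (N + i) (K + k)) * b i k)
      = (∑ i ∈ Finset.range N, ∑ k ∈ Finset.range K, (b i k : ℂ) * ((r2 (N + i) : ℂ) * ee (u * rh a (N + i) (K + k)))).re := by
    intro b
    rw [Complex.re_sum]
    apply Finset.sum_congr rfl
    intro i _
    rw [Complex.re_sum]
    apply Finset.sum_congr rfl
    intro k _
    rw [Complex.re_ofReal_mul, hre]; ring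
  have e0 := hr2 0 0
  have e04 := hr4 0 0
  simp only [add_zero] at e0 e04
  constructor
  · have h := abel_two (fun i k => 1 / p i k) _ N K M (fun i k => by have := hp0 i k; positivity)
      (fun i k => by rw [pn]; have := hp0 i k; gcongr; linarith)
      (fun i k => by rw [pk]; have := hp0 i k; have := hD k; gcongr; linarith)
      (fun i k => by
        rw [pk (i + 1), pn, pk]
        exact inv_mixed (hp0 i k) ha.le (hD k)) hM
    have e : ∀ i k, cos (2 * π * u * rh a (N + i) (K + k)) / rh a (N + i) (K + k) ^ 2
        = cos (2 * π * u * rh a (N + i) (K + k)) * (1 / p i k) := by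
      intro i k; rw [hr2]; ring
    simp only [e]
    rw [gen, e0]
    exact (Complex.abs_re_le_norm _).trans h
  · have h := abel_two (fun i k => (1 / p i k) ^ 2) _ N K M (fun i k => by have := hp0 i k; positivity)
      (fun i k => by rw [pn]; have := hp0 i k; gcongr; linarith)
      (fun i k => by rw [pk]; have := hp0 i k; have := hD k; gcongr; linarith)
      (fun i k => by
        rw [pk (i + 1), pn, pk]
        exact inv_mixed2 (hp0 i k) ha.le (hD k)) hM
    have e : ∀ i k, cos (2 * π * u * rh a (N + i) (K + k)) / rh a (N + i) (K + k) ^ 4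
        = cos (2 * π * u * rh a (N + i) (K + k)) * (1 / p i k) ^ 2 := by
      intro i k; rw [hr4]; ring
    simp only [e]
    rw [gen, e04, show 1 / p 0 0 ^ 2 = (1 / p 0 0) ^ 2 by ring]
    exact (Complex.abs_re_le_norm _).trans h

end EllAux
end M9sec

section M10sec
namespace EllAux

lemma rh_sq {a : ℝ} (ha : 0 < a) (n k : ℕ) : rh a n k ^ 2 = a * n + (k:ℝ) ^ 2 / a ^ 2 :=
  Real.sq_sqrt (by positivity)

lemma rh_nonneg (a : ℝ) (n k : ℕ) : 0 ≤ rh a n k := Real.sqrt_nonneg _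

lemma rh_pos_n {a : ℝ} (ha : 0 < a) {n : ℕ} (hn : 1 ≤ n) (k : ℕ) : 0 < rh a n k := by
  have : (1:ℝ) ≤ n := by exact_mod_cast hn
  exact Real.sqrt_pos.2 (by positivity)

lemma rh_mono {a : ℝ} (ha : 0 < a) {n n' k k' : ℕ} (hn : n ≤ n') (hk : k ≤ k') : rh a n k ≤ rh a n' k' := by
  apply Real.sqrt_le_sqrt
  have : (n:ℝ) ≤ n' := by exact_mod_cast hn
  have : (k:ℝ) ≤ k' := by exact_mod_cast hk
  gcongr

lemma rh_cube {a : ℝ} (ha : 0 < a) (n k : ℕ) : 2.598 * (n * k) ≤ rh a n k ^ 3 := by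
  have h0 := rh_nonneg a n k
  have h := rh_sq ha n k
  set Z := rh a n k
  have e : (Z ^ 3) ^ 2 = (a * n + (k:ℝ) ^ 2 / a ^ 2) ^ 3 := by rw [← h]; ring
  have key : 27 / 4 * ((n:ℝ) * k) ^ 2 ≤ (Z ^ 3) ^ 2 := by
    rw [e]
    have e2 : (n * (k:ℝ)) ^ 2 = (a * n) ^ 2 * ((k:ℝ) ^ 2 / a ^ 2) := by field_simp
    rw [e2]
    set p : ℝ := a * n
    set q : ℝ := (k:ℝ) ^ 2 / a ^ 2
    have hp : 0 ≤ p := by positivity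
    have hq : 0 ≤ q := by positivity
    nlinarith [mul_nonneg (sq_nonneg (p - 2 * q)) (by linarith : 0 ≤ 4 * p + q)]
  have : (2.598 * ((n:ℝ) * k)) ^ 2 ≤ (Z ^ 3) ^ 2 := by
    have : 0 ≤ ((n:ℝ) * k) ^ 2 := by positivity
    nlinarith
  exact (pow_le_pow_iff_left₀ (by positivity) (by positivity) (by norm_num)).1 this

lemma r2box (N K : ℕ) (hN : 1 ≤ N) : ∑ i ∈ Finset.range N, ∑ _k ∈ Finset.range K, (r2 (N + i) : ℝ) ≤ 12 * N * K := by
  have h := sum_r2 N hN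
  have h' : ∑ i ∈ Finset.range N, (r2 (N + i) : ℝ) ≤ 12 * N := by
    rw [Finset.sum_Ico_eq_sum_range, show 2 * N - N = N by omega] at h
    exact_mod_cast h
  simp only [Finset.sum_const, Finset.card_range, nsmul_eq_mul, ← Finset.mul_sum]
  nlinarith [(Nat.cast_nonneg K : (0:ℝ) ≤ K)]

lemma box_sec {a : ℝ} (ha : 0 < a) {N K : ℕ} (hN : 1 ≤ N) (hK : 1 ≤ K) (f : ℕ → ℕ → ℝ) {C : ℝ} (hC : 0 ≤ C)
    (hf : ∀ i k, |f i k| ≤ C / rh a N K ^ 3) :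
    |∑ i ∈ Finset.range N, ∑ k ∈ Finset.range K, (r2 (N + i) : ℝ) * f i k| ≤ C * 4.62 := by
  have hZ := rh_pos_n ha hN K
  have hc := rh_cube ha N K
  have hNr : (1:ℝ) ≤ N := by exact_mod_cast hN
  have hKr : (1:ℝ) ≤ K := by exact_mod_cast hK
  set Z := rh a N K
  calc _ ≤ ∑ i ∈ Finset.range N, ∑ k ∈ Finset.range K, (r2 (N + i) : ℝ) * (C / Z ^ 3) := by
        refine (Finset.abs_sum_le_sum_abs _ _).trans (Finset.sum_le_sum fun i _ => ?_)
        refine (Finset.abs_sum_le_sum_abs _ _).trans (Finset.sum_le_sum fun k _ => ?_)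
        rw [abs_mul, abs_of_nonneg (by positivity : (0:ℝ) ≤ (r2 (N + i) : ℝ))]
        gcongr; exact hf i k
    _ = (∑ i ∈ Finset.range N, ∑ k ∈ Finset.range K, (r2 (N + i) : ℝ)) * (C / Z ^ 3) := by
        simp only [Finset.sum_mul]
    _ ≤ 12 * N * K * (C / Z ^ 3) := by gcongr; exact r2box N K hN
    _ ≤ C * 4.62 := by
        rw [mul_div_assoc', div_le_iff₀ (by positivity)]
        have : C * (12 * (N * K)) ≤ C * (4.62 * Z ^ 3) := mul_le_mul_of_nonneg_left (by nlinarith) hC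
        linarith

lemma box_tau {a c δ F : ℝ} (ha : 0 < a) (hδ : 0 < δ) (hc : δ < c) {N K : ℕ} (hN : 1 ≤ N) (hK : 1 ≤ K)
    (hF : ∀ u ∈ Set.Icc (c - δ) (c + δ), ∀ N' ≤ N, ∀ K' ≤ K,
      u * ‖∑ i ∈ Finset.range N', ∑ k ∈ Finset.range K', (r2 (N + i) : ℂ) * ee (u * rh a (N + i) (K + k))‖ ≤ F) :
    |∑ i ∈ Finset.range N, ∑ k ∈ Finset.range K, (r2 (N + i) : ℝ) * tau c δ (rh a (N + i) (K + k))|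
      ≤ δ ^ 2 * (F / (π * rh a N K ^ 2) * min 1 ((1 / (π * δ) / rh a N K) ^ 2) + 0.71) := by
  have hπ := Real.pi_pos
  have hπ3 := Real.pi_gt_three
  have hπ2 : 9.86 < π ^ 2 := by nlinarith [Real.pi_gt_d4]
  have hZ := rh_pos_n ha hN K
  have hZm : ∀ i k, rh a N K ≤ rh a (N + i) (K + k) := fun i k => rh_mono ha (by omega) (by omega)
  set Z := rh a N K with hZdef
  have hr : ∀ i k, 0 < rh a (N + i) (K + k) := fun i k => hZ.trans_le (hZm i k)
  have hab : ∀ u ∈ Set.Icc (c - δ) (c + δ), 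
    |u * ∑ i ∈ Finset.range N, ∑ k ∈ Finset.range K, (r2 (N + i) : ℝ) * (cos (2 * π * u * rh a (N + i) (K + k)) / rh a (N + i) (K + k) ^ 2)|
      ≤ F / Z ^ 2 ∧
    |u * ∑ i ∈ Finset.range N, ∑ k ∈ Finset.range K, (r2 (N + i) : ℝ) * (cos (2 * π * u * rh a (N + i) (K + k)) / rh a (N + i) (K + k) ^ 4)|
      ≤ F / Z ^ 4 := by
    intro u hu
    have hu0 : 0 < u := by rw [Set.mem_Icc] at hu; linarith
    have := box_abel ha (K := K) hN u (F / u) (fun N' h1 K' h2 => by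
      rw [le_div_iff₀ hu0, mul_comm]; exact hF u hu N' h1 K' h2)
    rw [abs_mul, abs_mul, abs_of_pos hu0]
    constructor
    · calc _ ≤ u * (1 / Z ^ 2 * (F / u)) := by gcongr; exact this.1
        _ = _ := by field_simp
    · calc _ ≤ u * (1 / Z ^ 4 * (F / u)) := by gcongr; exact this.2
        _ = _ := by field_simp
  have hF0 : 0 ≤ F := by
    have h := hF c ⟨by linarith, by linarith⟩ 0 (by omega) 0 (by omega)
    simpa using h
  rcases lt_or_ge Z (1 / (π * δ)) with h | h
  · rw [min_eq_left (by rw [one_le_sq_iff₀ (by positivity), le_div_iff₀ hZ]; linarith), mul_one]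
    obtain ⟨η, hη, e⟩ := tauA (Finset.range N ×ˢ Finset.range K) (fun p => (r2 (N + p.1) : ℝ)) (fun p => rh a (N + p.1) (K + p.2))
      (fun p _ => hr p.1 p.2) (c := c) hδ
    rw [Finset.sum_product, Finset.sum_product] at e
    simp only at e
    rw [e, abs_mul, abs_of_nonneg (by positivity)]
    gcongr
    have e2 : ∑ i ∈ Finset.range N, ∑ k ∈ Finset.range K, (r2 (N + i) : ℝ) *
        (sin (2 * π * η * rh a (N + i) (K + k)) / (2 * π ^ 2 * rh a (N + i) (K + k) ^ 3) - η * cos (2 * π * η * rh a (N + i) (K + k)) / (π * rh a (N + i) (K + k) ^ 2))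
      = (∑ i ∈ Finset.range N, ∑ k ∈ Finset.range K, (r2 (N + i) : ℝ) *
        (sin (2 * π * η * rh a (N + i) (K + k)) / (2 * π ^ 2 * rh a (N + i) (K + k) ^ 3))) - 
        1 / π * (η * ∑ i ∈ Finset.range N, ∑ k ∈ Finset.range K, (r2 (N + i) : ℝ) * (cos (2 * π * η * rh a (N + i) (K + k)) / rh a (N + i) (K + k) ^ 2)) := by
      simp only [Finset.mul_sum, ← Finset.sum_sub_distrib]
      refine Finset.sum_congr rfl fun i _ => Finset.sum_congr rfl fun k _ => ?_
      have := hr i k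
      field_simp
    rw [e2]
    refine (abs_sub _ _).trans ?_
    have b1 := box_sec ha hN hK (fun i k => sin (2 * π * η * rh a (N + i) (K + k)) / (2 * π ^ 2 * rh a (N + i) (K + k) ^ 3))
      (C := 1 / (2 * π ^ 2)) (by positivity) (fun i k => by
        have := hr i k
        have := hZm i k
        rw [abs_div, abs_of_pos (by positivity : 0 < 2 * π ^ 2 * rh a (N + i) (K + k) ^ 3), div_div]
        gcongr
        exact abs_sin_le_one _)
    have b2 := (hab η hη).1
    rw [abs_mul, abs_of_pos (by positivity : 0 < 1 / π)]
    have b3 : 1 / π * |η * ∑ i ∈ Finset.range N, ∑ k ∈ Finset.range K, (r2 (N + i) : ℝ) * (cos (2 * π * η * rh a (N + i) (K + k)) / rh a (N + i) (K + k) ^ 2)| ≤ 1 / π * (F / Z ^ 2) := by gcongr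
    have b4 : 1 / π * (F / Z ^ 2) = F / (π * Z ^ 2) := by field_simp
    have b5 : 1 / (2 * π ^ 2) * 4.62 ≤ 0.71 := by
      rw [div_mul_eq_mul_div, div_le_iff₀ (by positivity)]; linarith
    linarith
  · have hT : 0 < 1 / (π * δ) := by positivity
    rw [min_eq_right (by apply pow_le_one₀ (by positivity); rw [div_le_one hZ]; exact h)]
    have hδZ : 1 ≤ π * δ * Z := by rw [div_le_iff₀ (by positivity)] at h; linarith
    have key := tauB (Finset.range N ×ˢ Finset.range K) (fun p => (r2 (N + p.1) : ℝ)) (fun p => rh a (N + p.1) (K + p.2))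
      (c := c) (M := F / (4 * π ^ 3 * Z ^ 4) + 3 * δ ^ 2 / (8 * π ^ 2) * 4.62) hδ (by
      intro u hu
      rw [Finset.sum_product]
      simp only
      have e2 : ∑ i ∈ Finset.range N, ∑ k ∈ Finset.range K, (r2 (N + i) : ℝ) * hh u (rh a (N + i) (K + k))
        = 1 / (4 * π ^ 3) * (u * ∑ i ∈ Finset.range N, ∑ k ∈ Finset.range K, (r2 (N + i) : ℝ) * (cos (2 * π * u * rh a (N + i) (K + k)) / rh a (N + i) (K + k) ^ 4))
          - (∑ i ∈ Finset.range N, ∑ k ∈ Finset.range K, (r2 (N + i) : ℝ) *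
        (3 * sin (2 * π * u * rh a (N + i) (K + k)) / (8 * π ^ 4 * rh a (N + i) (K + k) ^ 5))) := by
        simp only [Finset.mul_sum, ← Finset.sum_sub_distrib, hh]
        refine Finset.sum_congr rfl fun i _ => Finset.sum_congr rfl fun k _ => ?_
        have := hr i k
        field_simp
      rw [e2]
      refine (abs_sub _ _).trans ?_
      have b1 := box_sec ha hN hK (fun i k => 3 * sin (2 * π * u * rh a (N + i) (K + k)) / (8 * π ^ 4 * rh a (N + i) (K + k) ^ 5))
        (C := 3 * δ ^ 2 / (8 * π ^ 2)) (by positivity) (fun i k => by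
          have h1 := hr i k
          have h2 := hZm i k
          rw [abs_div, abs_of_pos (by positivity : 0 < 8 * π ^ 4 * rh a (N + i) (K + k) ^ 5), abs_mul, abs_of_pos (by norm_num : (0:ℝ) < 3)]
          calc 3 * |sin (2 * π * u * rh a (N + i) (K + k))| / (8 * π ^ 4 * rh a (N + i) (K + k) ^ 5) ≤ 3 * 1 / (8 * π ^ 4 * Z ^ 5) := by
                gcongr
                exact abs_sin_le_one _
            _ = 3 / (8 * π ^ 2) / Z ^ 3 * (1 / (π * Z) ^ 2) := by field_simp
            _ ≤ 3 / (8 * π ^ 2) / Z ^ 3 * δ ^ 2 := by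
                gcongr
                rw [div_le_iff₀ (by positivity), ← mul_pow]
                apply one_le_pow₀
                linarith
            _ = _ := by rw [← hZdef]; field_simp)
      have b2 := (hab u hu).2
      rw [abs_mul, abs_of_pos (by positivity : 0 < 1 / (4 * π ^ 3))]
      have b3 : 1 / (4 * π ^ 3) * |u * ∑ i ∈ Finset.range N, ∑ k ∈ Finset.range K, (r2 (N + i) : ℝ) * (cos (2 * π * u * rh a (N + i) (K + k)) / rh a (N + i) (K + k) ^ 4)| ≤ 1 / (4 * π ^ 3) * (F / Z ^ 4) := by gcongr
      have b4 : 1 / (4 * π ^ 3) * (F / Z ^ 4) = F / (4 * π ^ 3 * Z ^ 4) := by field_simp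
      linarith)
    rw [Finset.sum_product] at key
    simp only at key
    refine key.trans ?_
    have e3 : δ ^ 2 * (F / (π * Z ^ 2) * (1 / (π * δ) / Z) ^ 2 + 0.71) = F / (π ^ 3 * Z ^ 4) + 0.71 * δ ^ 2 := by field_simp
    have e4 : 4 * (F / (4 * π ^ 3 * Z ^ 4) + 3 * δ ^ 2 / (8 * π ^ 2) * 4.62) = F / (π ^ 3 * Z ^ 4) + (6.93 / π ^ 2) * δ ^ 2 := by
      field_simp; norm_num; ring
    rw [e3, e4]
    have : 6.93 / π ^ 2 ≤ 0.71 := by rw [div_le_iff₀ (by positivity)]; linarith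
    nlinarith [sq_nonneg δ]

end EllAux
end M10sec

section M11sec
namespace EllAux

lemma exp_rp (l s : ℝ) : (exp l) ^ s = exp (l * s) := (Real.exp_mul l s).symm

lemma box_F {a u U g : ℝ} (ha : 0 < a) (hu : 0 < u) (huU : u ≤ U) (hg : 0 ≤ g) {N K : ℕ} (hN : 1 ≤ N) (hK : 1 ≤ K)
    (hr : ∑ n ∈ Finset.Ico N (2 * N), (r2 n : ℝ) ^ 2 ≤ g ^ 2 * N) {N' K' : ℕ} (hN' : N' ≤ N) (hK' : K' ≤ K) :
    u * ‖∑ i ∈ Finset.range N', ∑ k ∈ Finset.range K', (r2 (N + i) : ℂ) * ee (u * rh a (N + i) (K + k))‖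
     ≤ g * (8.8 * (N * (U ^ (7/6 : ℝ) * (K:ℝ) ^ (7/6 : ℝ) * rh a N K ^ (-5/6 : ℝ)))
        + 43.5 * (√N * (U ^ (5/6 : ℝ) * (K:ℝ) ^ (5/6 : ℝ) * rh a N K ^ (5/6 : ℝ)))
        + 1.57 * (N * (U ^ (7/8 : ℝ) * rh a N K ^ (5/8 : ℝ)))
        + 11.4 * (√N * (U ^ (5/8 : ℝ) * rh a N K ^ (15/8 : ℝ)))) := by
  have hZ := rh_pos_n ha hN K
  have hZ2 := rh_sq ha N K
  set Z := rh a N K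
  have hU : 0 < U := hu.trans_le huU
  have hKr : (0:ℝ) < K := by exact_mod_cast hK
  have hlu := Real.exp_log hu
  have hlU := Real.exp_log hU
  have hlk := Real.exp_log hKr
  have hlz := Real.exp_log hZ
  have hle : log u ≤ log U := Real.log_le_log hu huU
  set lu := log u
  set lU := log U
  set lk := log (K:ℝ)
  set lz := log Z
  have hS := box_S (a := a) (u := u) (Z := Z) (v := exp ((lu + lk - 5 * lz) / 6)) (m := exp ((5 * lz - lu) / 8)) (g := g) ha hu hZ
    (exp_pos _) (exp_pos _) hg hK hZ2
    (by rw [← hlu, ← hlk, ← hlz, ← exp_nat_mul, ← exp_nat_mul, ← exp_add, ← exp_sub]; congr 1; push_cast; ring)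
    (by rw [← hlu, ← hlz, ← exp_nat_mul, ← exp_nat_mul, ← exp_sub]; congr 1; push_cast; ring) hr hN' hK'
  have h1 : u * (K * exp ((lu + lk - 5 * lz) / 6)) ≤ U ^ (7/6 : ℝ) * (K:ℝ) ^ (7/6 : ℝ) * Z ^ (-5/6 : ℝ) := by
    rw [← hlu, ← hlk, ← hlz, ← hlU]
    simp only [exp_rp, ← exp_add]
    apply exp_le_exp.2; linarith
  have h2 : u * (K / exp ((lu + lk - 5 * lz) / 6)) ≤ U ^ (5/6 : ℝ) * (K:ℝ) ^ (5/6 : ℝ) * Z ^ (5/6 : ℝ) := by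
    rw [← hlu, ← hlk, ← hlz, ← hlU]
    simp only [exp_rp, ← exp_add, ← exp_sub]
    apply exp_le_exp.2; linarith
  have h3 : u * exp ((5 * lz - lu) / 8) ≤ U ^ (7/8 : ℝ) * Z ^ (5/8 : ℝ) := by
    rw [← hlu, ← hlz, ← hlU]
    simp only [exp_rp, ← exp_add]
    apply exp_le_exp.2; linarith
  have h4 : u * exp ((5 * lz - lu) / 8) ^ 3 ≤ U ^ (5/8 : ℝ) * Z ^ (15/8 : ℝ) := by
    rw [← exp_nat_mul, ← hlu, ← hlz, ← hlU]
    simp only [exp_rp, ← exp_add]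
    apply exp_le_exp.2; push_cast; linarith
  calc _ ≤ u * (g * (8.8 * N * K * exp ((lu + lk - 5 * lz) / 6) + 43.5 * √N * K / exp ((lu + lk - 5 * lz) / 6)
        + 1.57 * N * exp ((5 * lz - lu) / 8) + 11.4 * √N * exp ((5 * lz - lu) / 8) ^ 3)) := by gcongr
    _ = g * (8.8 * (N * (u * (K * exp ((lu + lk - 5 * lz) / 6)))) + 43.5 * (√N * (u * (K / exp ((lu + lk - 5 * lz) / 6))))
        + 1.57 * (N * (u * exp ((5 * lz - lu) / 8))) + 11.4 * (√N * (u * exp ((5 * lz - lu) / 8) ^ 3))) := by ring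
    _ ≤ _ := by gcongr

/-- two-sided geometric weight -/
noncomputable def mu (α β t : ℝ) : ℝ := min (t ^ α) (t ^ (-β))

lemma mu_nonneg (α β : ℝ) {t : ℝ} (ht : 0 ≤ t) : 0 ≤ mu α β t := le_min (Real.rpow_nonneg ht _) (Real.rpow_nonneg ht _)

lemma geo_sum {α β r p q : ℝ} (hr : 1 < r) (hα : 0 < α) (hp : p = r ^ α) (hq : q = r ^ β) (hp1 : 1 < p) (hq1 : 1 < q) (n : ℕ) :
    ∀ t : ℝ, 0 < t → (1 ≤ t → ∑ j ∈ Finset.range n, mu α β (t * r ^ j) ≤ t ^ (-β) * (q / (q - 1))) ∧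
     (t < 1 → ∑ j ∈ Finset.range n, mu α β (t * r ^ j) ≤ q / (q - 1) + p / (p - 1) - t ^ α / (p - 1)) := by
  have hp2 : 0 < p - 1 := by linarith
  have hq2 : 0 < q - 1 := by linarith
  have hQ : 0 < q / (q - 1) := by apply div_pos <;> linarith
  have hta : ∀ t : ℝ, 0 < t → t < 1 → t ^ α / (p - 1) ≤ 1 / (p - 1) := fun t h1 h2 => by
    gcongr
    exact (Real.rpow_lt_one h1.le h2 hα).le
  have hPe : p / (p - 1) = 1 + 1 / (p - 1) := by field_simp; ring
  have hQe : q / (q - 1) = 1 + 1 / (q - 1) := by field_simp; ring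
  induction n with
  | zero =>
    intro t ht
    simp only [Finset.range_zero, Finset.sum_empty]
    refine ⟨fun _ => by positivity, fun h => ?_⟩
    have := hta t ht h
    linarith
  | succ n ih =>
    intro t ht
    have e : ∑ j ∈ Finset.range (n + 1), mu α β (t * r ^ j) = mu α β t + ∑ j ∈ Finset.range n, mu α β (t * r * r ^ j) := by
      rw [Finset.sum_range_succ', add_comm]
      simp only [pow_zero, mul_one]
      congr 1
      refine Finset.sum_congr rfl fun j _ => ?_
      rw [pow_succ]; congr 1; ring
    have htr : 0 < t * r := by positivity
    obtain ⟨i1, i2⟩ := ih (t * r) htr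
    have m1 : mu α β t ≤ t ^ α := min_le_left _ _
    have m2 : mu α β t ≤ t ^ (-β) := min_le_right _ _
    rw [e]
    constructor
    · intro h
      have := i1 (by nlinarith)
      have e2 : (t * r) ^ (-β) * (q / (q - 1)) = t ^ (-β) * (1 / (q - 1)) := by
        rw [Real.mul_rpow ht.le (by linarith), Real.rpow_neg (by linarith : 0 ≤ r), ← hq]
        field_simp
      rw [e2] at this
      rw [hQe]; linarith
    · intro h
      rcases le_or_gt 1 (t * r) with h' | h'
      · have h3 := i1 h'
        have h4 : (t * r) ^ (-β) ≤ 1 := by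
          by_cases hb : 0 ≤ β
          · exact Real.rpow_le_one_of_one_le_of_nonpos h' (by linarith)
          · exfalso
            have : q ≤ 1 := by rw [hq]; exact Real.rpow_le_one_of_one_le_of_nonpos hr.le (by linarith)
            linarith
        have h5 : (t * r) ^ (-β) * (q / (q - 1)) ≤ 1 * (q / (q - 1)) := by gcongr
        have h6 : t ^ α ≤ 1 := (Real.rpow_lt_one ht.le h hα).le
        have h7 := hta t ht h
        linarith
      · have h3 := i2 h'
        have e3 : (t * r) ^ α / (p - 1) = t ^ α + t ^ α / (p - 1) := by
          rw [Real.mul_rpow ht.le (by linarith), ← hp]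
          field_simp; ring
        rw [e3] at h3
        linarith

lemma geo_sum' {α β r p q A B : ℝ} (hr : 1 < r) (hα : 0 < α) (hp : p ≤ r ^ α) (hq : q ≤ r ^ β) (hp1 : 1 < p) (hq1 : 1 < q) 
    (hA : p / (p - 1) ≤ A) (hB : q / (q - 1) ≤ B) (n : ℕ) {t : ℝ} (ht : 0 < t) :
    ∑ j ∈ Finset.range n, mu α β (t * r ^ j) ≤ A + B := by
  obtain ⟨h1, h2⟩ := geo_sum hr hα rfl rfl (hp1.trans_le hp) (hq1.trans_le hq) n t ht
  have mono : ∀ s s' : ℝ, 1 < s → s ≤ s' → s' / (s' - 1) ≤ s / (s - 1) := by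
    intro s s' h1 h2
    rw [div_le_div_iff₀ (by linarith) (by linarith)]
    nlinarith
  have hA' := (mono _ _ hp1 hp).trans hA
  have hB' := (mono _ _ hq1 hq).trans hB
  have hA0 : 0 ≤ A := le_trans (div_nonneg (by linarith) (by linarith)) hA
  have hpp := hp1.trans_le hp
  rcases le_or_gt 1 t with h | h
  · have h3 := h1 h
    have hb : 0 ≤ β := by
      by_contra hb
      have : r ^ β ≤ 1 := Real.rpow_le_one_of_one_le_of_nonpos hr.le (by linarith)
      linarith
    have h4 : t ^ (-β) ≤ 1 := Real.rpow_le_one_of_one_le_of_nonpos h (by linarith)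
    have hQ : 0 ≤ r ^ β / (r ^ β - 1) := div_nonneg (by linarith) (by linarith)
    nlinarith
  · have h3 := h2 h
    have : 0 ≤ t ^ α / (r ^ α - 1) := div_nonneg (Real.rpow_nonneg ht.le _) (by linarith)
    linarith

lemma mono_box {X Y Z T p q e : ℝ} (hX : 0 < X) (hY : 0 < Y) (hT : 0 < T) (hXZ : X ≤ Z) (hYZ : Y ≤ Z) (he : 0 ≤ e) :
    X ^ p * Y ^ q * Z ^ (-e) * min 1 ((T / Z) ^ 2) ≤ T ^ (p + q - e) * mu (p + q - e) (2 - (p + q - e)) (X / T) * mu q (e - q) (Y / X) := by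
  have hZ := hX.trans_le hXZ
  have l1 := Real.log_le_log hX hXZ
  have l2 := Real.log_le_log hY hYZ
  have hlx := Real.exp_log hX
  have hly := Real.exp_log hY
  have hlz := Real.exp_log hZ
  have hlt := Real.exp_log hT
  rw [← hlx, ← hly, ← hlz, ← hlt]
  set lx := log X
  set ly := log Y
  set lz := log Z
  set lt := log T
  have n1 := mul_le_mul_of_nonneg_left l1 he
  have n2 := mul_le_mul_of_nonneg_left l2 he
  simp only [mu, ← exp_sub, exp_rp, ← exp_nat_mul, ← exp_add]
  have m1 : min 1 (exp (((2:ℕ):ℝ) * (lt - lz))) ≤ exp 0 := by rw [exp_zero]; exact min_le_left _ _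
  have m2 : min 1 (exp (((2:ℕ):ℝ) * (lt - lz))) ≤ exp (2 * (lt - lx)) := 
    (min_le_right _ _).trans (exp_le_exp.2 (by push_cast; linarith))
  set M := min 1 (exp (((2:ℕ):ℝ) * (lt - lz)))
  rcases min_choice (exp ((lx - lt) * (p + q - e))) (exp ((lx - lt) * (-(2 - (p + q - e))))) with h | h <;>
  rcases min_choice (exp ((ly - lx) * q)) (exp ((ly - lx) * (-(e - q)))) with h' | h' <;> rw [h, h'] <;>
  simp only [← exp_add]
  · refine (mul_le_mul_of_nonneg_left m1 (exp_pos _).le).trans ?_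
    rw [← exp_add]; apply exp_le_exp.2; nlinarith
  · refine (mul_le_mul_of_nonneg_left m1 (exp_pos _).le).trans ?_
    rw [← exp_add]; apply exp_le_exp.2; nlinarith
  · refine (mul_le_mul_of_nonneg_left m2 (exp_pos _).le).trans ?_
    rw [← exp_add]; apply exp_le_exp.2; nlinarith
  · refine (mul_le_mul_of_nonneg_left m2 (exp_pos _).le).trans ?_
    rw [← exp_add]; apply exp_le_exp.2; nlinarith

lemma mono_box0 {X Z T p e : ℝ} (hX : 0 < X) (hT : 0 < T) (hXZ : X ≤ Z) (he : 0 ≤ e) :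
    X ^ p * Z ^ (-e) * min 1 ((T / Z) ^ 2) ≤ T ^ (p - e) * mu (p - e) (2 - (p - e)) (X / T) := by
  have h := mono_box (p := p) (q := 0) hX hX hT hXZ hXZ he
  have h1 : mu 0 (e - 0) (X / X) = 1 := by rw [div_self hX.ne']; simp [mu]
  rw [h1] at h
  simpa using h

end EllAux
end M11sec

section M12sec
namespace EllAux

noncomputable def FB (a U g : ℝ) (N K : ℕ) : ℝ :=
  g * (8.8 * (N * (U ^ (7/6 : ℝ) * (K:ℝ) ^ (7/6 : ℝ) * rh a N K ^ (-5/6 : ℝ)))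
        + 43.5 * (√N * (U ^ (5/6 : ℝ) * (K:ℝ) ^ (5/6 : ℝ) * rh a N K ^ (5/6 : ℝ)))
        + 1.57 * (N * (U ^ (7/8 : ℝ) * rh a N K ^ (5/8 : ℝ)))
        + 11.4 * (√N * (U ^ (5/8 : ℝ) * rh a N K ^ (15/8 : ℝ))))

lemma FB_bound {a U g T X Y : ℝ} (ha : 0 < a) (hU : 0 < U) (hg : 0 ≤ g) (hT : 0 < T) {N K : ℕ} (hN : 1 ≤ N) (hK : 1 ≤ K)
    (hX : X = √a * √N) (hY : Y = K / a) :
    FB a U g N K / (π * rh a N K ^ 2) * min 1 ((T / rh a N K) ^ 2) ≤ g / π * (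
      8.8 * (U ^ (7/6 : ℝ) * a ^ (1/6 : ℝ)) * (T ^ (1/3 : ℝ) * mu (1/3) (5/3) (X / T) * mu (7/6) (5/3) (Y / X))
      + 43.5 * (U ^ (5/6 : ℝ) * a ^ (1/3 : ℝ)) * (T ^ (2/3 : ℝ) * mu (2/3) (4/3) (X / T) * mu (5/6) (1/3) (Y / X))
      + 1.57 * (U ^ (7/8 : ℝ) * a ^ (-1 : ℝ)) * (T ^ (5/8 : ℝ) * mu (5/8) (11/8) (X / T))
      + 11.4 * (U ^ (5/8 : ℝ) * a ^ (-1/2 : ℝ)) * (T ^ (7/8 : ℝ) * mu (7/8) (9/8) (X / T))) := by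
  have hZ := rh_pos_n ha hN K
  have hZ2 := rh_sq ha N K
  rw [FB]
  set Z := rh a N K
  have hNr : (0:ℝ) < N := by exact_mod_cast hN
  have hKr : (0:ℝ) < K := by exact_mod_cast hK
  have hX0 : 0 < X := by rw [hX]; positivity
  have hY0 : 0 < Y := by rw [hY]; positivity
  have hX2 : X ^ 2 = a * N := by rw [hX, mul_pow, Real.sq_sqrt ha.le, Real.sq_sqrt hNr.le]
  have hXZ : X ≤ Z := by
    apply (pow_le_pow_iff_left₀ hX0.le hZ.le two_ne_zero).1
    rw [hX2, hZ2]; have : 0 ≤ (K:ℝ) ^ 2 / a ^ 2 := by positivity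
    linarith
  have hYZ : Y ≤ Z := by
    apply (pow_le_pow_iff_left₀ hY0.le hZ.le two_ne_zero).1
    rw [hY, hZ2, div_pow]; have : 0 ≤ a * N := by positivity
    linarith
  have b1 := mono_box (p := 2) (q := 7/6) (e := 17/6) hX0 hY0 hT hXZ hYZ (by norm_num)
  have b2 := mono_box (p := 1) (q := 5/6) (e := 7/6) hX0 hY0 hT hXZ hYZ (by norm_num)
  have b3 := mono_box0 (p := 2) (e := 11/8) hX0 hT hXZ (by norm_num)
  have b4 := mono_box0 (p := 1) (e := 1/8) hX0 hT hXZ (by norm_num)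
  norm_num at b1 b2 b3 b4
  have hm : 0 ≤ min 1 ((T / Z) ^ 2) := by positivity
  set w := min 1 ((T / Z) ^ 2)
  have hKa : (K:ℝ) = a * Y := by rw [hY]; field_simp
  have hNa : (N:ℝ) = X ^ 2 / a := by rw [hX2]; field_simp
  have hsN : √(N:ℝ) = X * a ^ (-1/2 : ℝ) := by
    rw [hX, Real.sqrt_eq_rpow a, mul_right_comm, ← Real.rpow_add ha]; norm_num
  have hla := Real.exp_log ha
  have hlx := Real.exp_log hX0
  have hly := Real.exp_log hY0
  have hlz := Real.exp_log hZ
  have c1 : (N * (U ^ (7/6 : ℝ) * (K:ℝ) ^ (7/6 : ℝ) * Z ^ (-5/6 : ℝ))) / Z ^ 2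
      = (U ^ (7/6 : ℝ) * a ^ (1/6 : ℝ)) * (X ^ 2 * Y ^ (7/6 : ℝ) * Z ^ (-(17/6) : ℝ)) := by
    rw [hKa, hNa, ← hla, ← hlx, ← hly, ← hlz]
    simp only [exp_rp, ← exp_add, ← exp_nat_mul, ← exp_sub]
    rw [mul_div_right_comm, ← exp_sub]
    have : ∀ p q r s : ℝ, exp p * (U ^ (7/6 : ℝ) * exp q * exp r) = U ^ (7/6 : ℝ) * exp (p + q + r) := by
      intros; rw [exp_add, exp_add]; ring
    rw [this, mul_assoc, ← exp_add]
    congr 2; push_cast; ring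
    exact 0
  have c2 : (√N * (U ^ (5/6 : ℝ) * (K:ℝ) ^ (5/6 : ℝ) * Z ^ (5/6 : ℝ))) / Z ^ 2
      = (U ^ (5/6 : ℝ) * a ^ (1/3 : ℝ)) * (X * Y ^ (5/6 : ℝ) * Z ^ (-(7/6) : ℝ)) := by
    rw [hKa, hsN, ← hla, ← hlx, ← hly, ← hlz]
    simp only [exp_rp, ← exp_add, ← exp_nat_mul]
    rw [mul_div_right_comm, ← exp_sub]
    have : ∀ p q r : ℝ, exp p * (U ^ (5/6 : ℝ) * exp q * exp r) = U ^ (5/6 : ℝ) * exp (p + q + r) := by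
      intros; rw [exp_add, exp_add]; ring
    rw [this, mul_assoc, ← exp_add]
    congr 2; push_cast; ring
  have c3 : (N * (U ^ (7/8 : ℝ) * Z ^ (5/8 : ℝ))) / Z ^ 2
      = (U ^ (7/8 : ℝ) * a ^ (-1 : ℝ)) * (X ^ 2 * Z ^ (-(11/8) : ℝ)) := by
    rw [hNa, ← hla, ← hlx, ← hlz]
    simp only [exp_rp, ← exp_add, ← exp_nat_mul, ← exp_sub]
    rw [mul_div_right_comm, ← exp_sub]
    have : ∀ p q : ℝ, exp p * (U ^ (7/8 : ℝ) * exp q) = U ^ (7/8 : ℝ) * exp (p + q) := by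
      intros; rw [exp_add]; ring
    rw [this, mul_assoc, ← exp_add]
    congr 2; push_cast; ring
  have c4 : (√N * (U ^ (5/8 : ℝ) * Z ^ (15/8 : ℝ))) / Z ^ 2
      = (U ^ (5/8 : ℝ) * a ^ (-1/2 : ℝ)) * (X * Z ^ (-(1/8) : ℝ)) := by
    rw [hsN, ← hla, ← hlx, ← hlz]
    simp only [exp_rp, ← exp_add, ← exp_nat_mul]
    rw [mul_div_right_comm, ← exp_sub]
    have : ∀ p q : ℝ, exp p * (U ^ (5/8 : ℝ) * exp q) = U ^ (5/8 : ℝ) * exp (p + q) := by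
      intros; rw [exp_add]; ring
    rw [this, mul_assoc, ← exp_add]
    congr 2; push_cast; ring
  have hUs : ∀ s : ℝ, 0 ≤ U ^ s := fun s => (Real.rpow_pos_of_pos hU s).le
  have has : ∀ s : ℝ, 0 ≤ a ^ s := fun s => (Real.rpow_pos_of_pos ha s).le
  have split : g * (8.8 * (N * (U ^ (7/6 : ℝ) * (K:ℝ) ^ (7/6 : ℝ) * Z ^ (-5/6 : ℝ)))
        + 43.5 * (√N * (U ^ (5/6 : ℝ) * (K:ℝ) ^ (5/6 : ℝ) * Z ^ (5/6 : ℝ)))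
        + 1.57 * (N * (U ^ (7/8 : ℝ) * Z ^ (5/8 : ℝ)))
        + 11.4 * (√N * (U ^ (5/8 : ℝ) * Z ^ (15/8 : ℝ)))) / (π * Z ^ 2) * w
      = g / π * (8.8 * (U ^ (7/6 : ℝ) * a ^ (1/6 : ℝ)) * (X ^ 2 * Y ^ (7/6 : ℝ) * Z ^ (-(17/6) : ℝ) * w)
        + 43.5 * (U ^ (5/6 : ℝ) * a ^ (1/3 : ℝ)) * (X * Y ^ (5/6 : ℝ) * Z ^ (-(7/6) : ℝ) * w)
        + 1.57 * (U ^ (7/8 : ℝ) * a ^ (-1 : ℝ)) * (X ^ 2 * Z ^ (-(11/8) : ℝ) * w)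
        + 11.4 * (U ^ (5/8 : ℝ) * a ^ (-1/2 : ℝ)) * (X * Z ^ (-(1/8) : ℝ) * w)) := by
    calc _ = g / π * (8.8 * (N * (U ^ (7/6 : ℝ) * (K:ℝ) ^ (7/6 : ℝ) * Z ^ (-5/6 : ℝ)) / Z ^ 2)
        + 43.5 * (√N * (U ^ (5/6 : ℝ) * (K:ℝ) ^ (5/6 : ℝ) * Z ^ (5/6 : ℝ)) / Z ^ 2)
        + 1.57 * (N * (U ^ (7/8 : ℝ) * Z ^ (5/8 : ℝ)) / Z ^ 2)
        + 11.4 * (√N * (U ^ (5/8 : ℝ) * Z ^ (15/8 : ℝ)) / Z ^ 2)) * w := by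
          field_simp
      _ = _ := by rw [c1, c2, c3, c4]; ring
  rw [split]
  have hgp : 0 ≤ g / π := div_nonneg hg Real.pi_pos.le
  have := hUs (7/6); have := hUs (5/6); have := hUs (7/8); have := hUs (5/8)
  have := has (1/6); have := has (1/3); have := has (-1); have := has (-1/2)
  refine mul_le_mul_of_nonneg_left ?_ hgp
  gcongr

lemma pow_rt {q r : ℝ} (m : ℕ) {s : ℝ} (hr : 0 ≤ r) (hm : 0 < m) (n : ℕ) (hs : s * m = n) (h : q ^ m ≤ r ^ n) (hq : 0 ≤ q) : q ≤ r ^ s := by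
  apply (pow_le_pow_iff_left₀ hq (Real.rpow_nonneg hr _) hm.ne').1
  rw [← Real.rpow_natCast (r ^ s), ← Real.rpow_mul hr, hs, Real.rpow_natCast]
  exact h

lemma sum_inside {a U g T : ℝ} (ha : 0 < a) (hU : 0 < U) (hg : 0 ≤ g) (hT : 0 < T) (I J : ℕ) :
    ∑ i ∈ Finset.range I, ∑ j ∈ Finset.range J, FB a U g (2 ^ i) (2 ^ j) / (π * rh a (2 ^ i) (2 ^ j) ^ 2) * min 1 ((T / rh a (2 ^ i) (2 ^ j)) ^ 2)
    ≤ g / π * (8.8 * (U ^ (7/6 : ℝ) * a ^ (1/6 : ℝ)) * T ^ (1/3 : ℝ) * 37.5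
      + 43.5 * (U ^ (5/6 : ℝ) * a ^ (1/3 : ℝ)) * T ^ (2/3 : ℝ) * 54.2
      + 1.57 * (U ^ (7/8 : ℝ) * a ^ (-1 : ℝ)) * T ^ (5/8 : ℝ) * (7.8 * J)
      + 11.4 * (U ^ (5/8 : ℝ) * a ^ (-1/2 : ℝ)) * T ^ (7/8 : ℝ) * (6.95 * J)) := by
  have hs2 : (1.41421:ℝ) ≤ √2 := by apply Real.le_sqrt_of_sq_le; norm_num
  have hs1 : (1:ℝ) < √2 := by linarith
  set X : ℕ → ℝ := fun i => √a * √((2 ^ i : ℕ) : ℝ) with hXd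
  set Y : ℕ → ℝ := fun j => ((2 ^ j : ℕ) : ℝ) / a with hYd
  have hXp : ∀ i, 0 < X i := fun i => by simp only [hXd]; positivity
  have hXe : ∀ i, X i / T = √a / T * √2 ^ i := by
    intro i
    have e : √((2:ℝ) ^ i) = √2 ^ i := by
      rw [Real.sqrt_eq_iff_mul_self_eq (by positivity) (by positivity), ← mul_pow, Real.mul_self_sqrt (by norm_num)]
    simp only [hXd]; push_cast; rw [e]; ring
  have hYe : ∀ i j, Y j / X i = 1 / (a * X i) * 2 ^ j := by
    intro i j; simp only [hYd]; push_cast; field_simp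
  have hl : ∀ q : ℝ, ∀ m n : ℕ, 0 < m → q ^ m ≤ (1.41421:ℝ) ^ n → 0 ≤ q → ∀ s : ℝ, s * m = n → q ≤ √2 ^ s := by
    intro q m n hm h hq s hs
    exact pow_rt m (by positivity) hm n hs (h.trans (by gcongr)) hq
  have hl2 : ∀ q : ℝ, ∀ m n : ℕ, 0 < m → q ^ m ≤ (2:ℝ) ^ n → 0 ≤ q → ∀ s : ℝ, s * m = n → q ≤ 2 ^ s := by
    intro q m n hm h hq s hs
    exact pow_rt m (by positivity) hm n hs h hq
  have y1 : ∀ i, ∑ j ∈ Finset.range J, mu (7/6) (5/3) (Y j / X i) ≤ 3.27 := by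
    intro i
    simp only [hYe]
    have hx := hXp i
    refine (geo_sum' (p := 2.244) (q := 3.174) (A := 1.804) (B := 1.46) (by norm_num) (by norm_num) (hl2 _ 6 7 (by norm_num) (by norm_num) (by norm_num) _ (by norm_num))
      (hl2 _ 3 5 (by norm_num) (by norm_num) (by norm_num) _ (by norm_num)) (by norm_num) (by norm_num) (by norm_num) (by norm_num) J (by positivity)).trans (by norm_num)
  have y2 : ∀ i, ∑ j ∈ Finset.range J, mu (5/6) (1/3) (Y j / X i) ≤ 7.15 := by
    intro i
    simp only [hYe]
    have hx := hXp i
    refine (geo_sum' (p := 1.781) (q := 1.2598) (A := 2.281) (B := 4.85) (by norm_num) (by norm_num) (hl2 _ 6 5 (by norm_num) (by norm_num) (by norm_num) _ (by norm_num))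
      (hl2 _ 3 1 (by norm_num) (by norm_num) (by norm_num) _ (by norm_num)) (by norm_num) (by norm_num) (by norm_num) (by norm_num) J (by positivity)).trans (by norm_num)
  have hta : 0 < √a / T := by positivity
  have x1 : ∑ i ∈ Finset.range I, mu (1/3) (5/3) (X i / T) ≤ 11.46 := by
    simp only [hXe]
    refine (geo_sum' (p := 1.1224) (q := 1.781) (A := 9.175) (B := 2.281) hs1 (by norm_num) (hl _ 3 1 (by norm_num) (by norm_num) (by norm_num) _ (by norm_num))
      (hl _ 3 5 (by norm_num) (by norm_num) (by norm_num) _ (by norm_num)) (by norm_num) (by norm_num) (by norm_num) (by norm_num) I hta).trans (by norm_num)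
  have x2 : ∑ i ∈ Finset.range I, mu (2/3) (4/3) (X i / T) ≤ 7.57 := by
    simp only [hXe]
    refine (geo_sum' (p := 1.2597) (q := 1.587) (A := 4.86) (B := 2.705) hs1 (by norm_num) (hl _ 3 2 (by norm_num) (by norm_num) (by norm_num) _ (by norm_num))
      (hl _ 3 4 (by norm_num) (by norm_num) (by norm_num) _ (by norm_num)) (by norm_num) (by norm_num) (by norm_num) (by norm_num) I hta).trans (by norm_num)
  have x3 : ∑ i ∈ Finset.range I, mu (5/8) (11/8) (X i / T) ≤ 7.8 := by
    simp only [hXe]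
    refine (geo_sum' (p := 1.241) (q := 1.61) (A := 5.15) (B := 2.64) hs1 (by norm_num) (hl _ 8 5 (by norm_num) (by norm_num) (by norm_num) _ (by norm_num))
      (hl _ 8 11 (by norm_num) (by norm_num) (by norm_num) _ (by norm_num)) (by norm_num) (by norm_num) (by norm_num) (by norm_num) I hta).trans (by norm_num)
  have x4 : ∑ i ∈ Finset.range I, mu (7/8) (9/8) (X i / T) ≤ 6.95 := by
    simp only [hXe]
    refine (geo_sum' (p := 1.354) (q := 1.476) (A := 3.83) (B := 3.11) hs1 (by norm_num) (hl _ 8 7 (by norm_num) (by norm_num) (by norm_num) _ (by norm_num))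
      (hl _ 8 9 (by norm_num) (by norm_num) (by norm_num) _ (by norm_num)) (by norm_num) (by norm_num) (by norm_num) (by norm_num) I hta).trans (by norm_num)
  have hmu : ∀ α β i, 0 ≤ mu α β (X i / T) := fun α β i => mu_nonneg _ _ (by have := hXp i; positivity)
  have d1 : ∑ i ∈ Finset.range I, ∑ j ∈ Finset.range J, T ^ (1/3 : ℝ) * mu (1/3) (5/3) (X i / T) * mu (7/6) (5/3) (Y j / X i) ≤ T ^ (1/3 : ℝ) * 37.5 := by
    calc _ = ∑ i ∈ Finset.range I, T ^ (1/3 : ℝ) * mu (1/3) (5/3) (X i / T) * ∑ j ∈ Finset.range J, mu (7/6) (5/3) (Y j / X i) := by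
          simp only [Finset.mul_sum]
      _ ≤ ∑ i ∈ Finset.range I, T ^ (1/3 : ℝ) * mu (1/3) (5/3) (X i / T) * 3.27 := by
          refine Finset.sum_le_sum fun i _ => ?_
          have := hmu (1/3) (5/3) i
          have := y1 i
          gcongr
      _ = T ^ (1/3 : ℝ) * ((∑ i ∈ Finset.range I, mu (1/3) (5/3) (X i / T)) * 3.27) := by rw [Finset.sum_mul, Finset.mul_sum]; exact Finset.sum_congr rfl fun _ _ => by ring
      _ ≤ _ := by gcongr; linarith
  have d2 : ∑ i ∈ Finset.range I, ∑ j ∈ Finset.range J, T ^ (2/3 : ℝ) * mu (2/3) (4/3) (X i / T) * mu (5/6) (1/3) (Y j / X i) ≤ T ^ (2/3 : ℝ) * 54.2 := by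
    calc _ = ∑ i ∈ Finset.range I, T ^ (2/3 : ℝ) * mu (2/3) (4/3) (X i / T) * ∑ j ∈ Finset.range J, mu (5/6) (1/3) (Y j / X i) := by
          simp only [Finset.mul_sum]
      _ ≤ ∑ i ∈ Finset.range I, T ^ (2/3 : ℝ) * mu (2/3) (4/3) (X i / T) * 7.15 := by
          refine Finset.sum_le_sum fun i _ => ?_
          have := hmu (2/3) (4/3) i
          have := y2 i
          gcongr
      _ = T ^ (2/3 : ℝ) * ((∑ i ∈ Finset.range I, mu (2/3) (4/3) (X i / T)) * 7.15) := by rw [Finset.sum_mul, Finset.mul_sum]; exact Finset.sum_congr rfl fun _ _ => by ring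
      _ ≤ _ := by gcongr; linarith
  have d3 : ∑ i ∈ Finset.range I, ∑ _j ∈ Finset.range J, T ^ (5/8 : ℝ) * mu (5/8) (11/8) (X i / T) ≤ T ^ (5/8 : ℝ) * (7.8 * J) := by
    simp only [Finset.sum_const, Finset.card_range, nsmul_eq_mul]
    rw [← Finset.mul_sum, ← Finset.mul_sum, mul_left_comm, mul_comm (J:ℝ)]
    gcongr
  have d4 : ∑ i ∈ Finset.range I, ∑ _j ∈ Finset.range J, T ^ (7/8 : ℝ) * mu (7/8) (9/8) (X i / T) ≤ T ^ (7/8 : ℝ) * (6.95 * J) := by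
    simp only [Finset.sum_const, Finset.card_range, nsmul_eq_mul]
    rw [← Finset.mul_sum, ← Finset.mul_sum, mul_left_comm, mul_comm (J:ℝ)]
    gcongr
  have pull : ∀ (C : ℝ) (f : ℕ → ℕ → ℝ) (D : ℝ), 0 ≤ C → ∑ i ∈ Finset.range I, ∑ j ∈ Finset.range J, f i j ≤ D →
      ∑ i ∈ Finset.range I, ∑ j ∈ Finset.range J, C * f i j ≤ C * D := by
    intro C f D hC h
    simp only [← Finset.mul_sum]
    gcongr
  calc _ ≤ ∑ i ∈ Finset.range I, ∑ j ∈ Finset.range J, g / π * (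
      8.8 * (U ^ (7/6 : ℝ) * a ^ (1/6 : ℝ)) * (T ^ (1/3 : ℝ) * mu (1/3) (5/3) (X i / T) * mu (7/6) (5/3) (Y j / X i))
      + 43.5 * (U ^ (5/6 : ℝ) * a ^ (1/3 : ℝ)) * (T ^ (2/3 : ℝ) * mu (2/3) (4/3) (X i / T) * mu (5/6) (1/3) (Y j / X i))
      + 1.57 * (U ^ (7/8 : ℝ) * a ^ (-1 : ℝ)) * (T ^ (5/8 : ℝ) * mu (5/8) (11/8) (X i / T))
      + 11.4 * (U ^ (5/8 : ℝ) * a ^ (-1/2 : ℝ)) * (T ^ (7/8 : ℝ) * mu (7/8) (9/8) (X i / T))) := by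
        refine Finset.sum_le_sum fun i _ => Finset.sum_le_sum fun j _ => ?_
        exact FB_bound ha hU hg hT Nat.one_le_two_pow Nat.one_le_two_pow rfl rfl
    _ ≤ _ := by
        rw [show ∀ f : ℕ → ℕ → ℝ, (∑ i ∈ Finset.range I, ∑ j ∈ Finset.range J, g / π * f i j) = g / π * ∑ i ∈ Finset.range I, ∑ j ∈ Finset.range J, f i j from fun f => by simp only [Finset.mul_sum]]
        simp only [Finset.sum_add_distrib]
        simp only [mul_assoc _ (T ^ (1/3 : ℝ)) (37.5:ℝ), mul_assoc _ (T ^ (2/3 : ℝ)) (54.2:ℝ), mul_assoc _ (T ^ (5/8 : ℝ)) (7.8 * (J:ℝ)), mul_assoc _ (T ^ (7/8 : ℝ)) (6.95 * (J:ℝ))]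
        have := Real.pi_pos
        gcongr
        · exact pull _ (fun i j => T ^ (1/3 : ℝ) * mu (1/3) (5/3) (X i / T) * mu (7/6) (5/3) (Y j / X i)) _ (by positivity) d1
        · exact pull _ (fun i j => T ^ (2/3 : ℝ) * mu (2/3) (4/3) (X i / T) * mu (5/6) (1/3) (Y j / X i)) _ (by positivity) d2
        · exact pull _ (fun i j => T ^ (5/8 : ℝ) * mu (5/8) (11/8) (X i / T)) _ (by positivity) d3
        · exact pull _ (fun i j => T ^ (7/8 : ℝ) * mu (7/8) (9/8) (X i / T)) _ (by positivity) d4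

end EllAux
end M12sec

section M13sec
namespace EllAux

lemma dyadic_sum (f : ℕ → ℝ) (m : ℕ) : ∑ n ∈ Finset.Ico 1 (2 ^ m), f n = ∑ i ∈ Finset.range m, ∑ l ∈ Finset.range (2 ^ i), f (2 ^ i + l) := by
  induction m with
  | zero => simp
  | succ m ih =>
    rw [Finset.sum_range_succ, ← ih, ← Finset.sum_Ico_consecutive f Nat.one_le_two_pow (Nat.pow_le_pow_right (by norm_num) (Nat.le_succ m))]
    congr 1
    rw [Finset.sum_Ico_eq_sum_range, show 2 ^ (m + 1) - 2 ^ m = 2 ^ m by rw [pow_succ]; omega]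

noncomputable def Box (a c δ : ℝ) (N K : ℕ) : ℝ :=
  ∑ i ∈ Finset.range N, ∑ k ∈ Finset.range K, (r2 (N + i) : ℝ) * tau c δ (rh a (N + i) (K + k))

lemma r2_zero : r2 0 = 1 := by
  rw [r2]; rfl

lemma rh_zero_n (a : ℝ) (ha : 0 < a) (k : ℕ) : rh a 0 k = k / a := by
  rw [rh]; simp only [Nat.cast_zero, mul_zero, zero_add]
  rw [← div_pow]; exact Real.sqrt_sq (by positivity)

lemma bsum_dec (a c δ : ℝ) (m : ℕ) : bsum a c δ (2 ^ m) =
    2 * ∑ k ∈ Finset.Ico 1 (2 ^ m), tau c δ (rh a 0 k)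
    + ∑ i ∈ Finset.range m, ∑ l ∈ Finset.range (2 ^ i), (r2 (2 ^ i + l) : ℝ) * tau c δ (rh a (2 ^ i + l) 0)
    + 2 * ∑ i ∈ Finset.range m, ∑ j ∈ Finset.range m, Box a c δ (2 ^ i) (2 ^ j) := by
  have h0 : tau c δ (rh a 0 0) = 0 := by simp [rh, tau, ghat_zero]
  rw [bsum, Finset.range_eq_Ico, ← Finset.sum_Ico_consecutive _ (Nat.zero_le 1) Nat.one_le_two_pow]
  rw [show Finset.Ico 0 1 = {0} from rfl, Finset.sum_singleton, r2_zero, h0]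
  simp only [mul_add, Finset.sum_add_distrib]
  rw [← add_assoc]
  congr 1
  · congr 1
    · simp
    · exact dyadic_sum _ m
  · rw [dyadic_sum, Finset.mul_sum]
    apply Finset.sum_congr rfl
    intro i _
    rw [Finset.mul_sum]
    simp only [dyadic_sum, Box]
    simp only [Finset.mul_sum]
    rw [Finset.sum_comm]
    refine Finset.sum_congr rfl fun j _ => Finset.sum_congr rfl fun l _ => Finset.sum_congr rfl fun k _ => ?_
    ring

lemma line_n0 {a c δ U : ℝ} (ha : 0 < a) (hδ : 0 < δ) (hc : δ ≤ c) (hU : c + δ ≤ U) (M : ℕ) :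
    |2 * ∑ k ∈ Finset.Ico 1 M, tau c δ (rh a 0 k)| ≤ δ ^ 2 * (1.34 * U * a ^ 2 + 0.23 * a ^ 3) := by
  have hπ := Real.pi_gt_three
  have h1 : ∀ k ∈ Finset.Ico 1 M, |tau c δ (rh a 0 k)| ≤ δ ^ 2 * (U * a ^ 2 / 3 + a ^ 3 / 18) * ((k:ℝ) ^ 2)⁻¹ := by
    intro k hk
    have hk1 : (1:ℝ) ≤ k := by exact_mod_cast (Finset.mem_Ico.1 hk).1
    rw [rh_zero_n a ha]
    have hU0 : 0 ≤ U := by linarith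
    refine (tau_ptA hδ hc (by positivity)).trans ?_
    rw [mul_assoc (δ ^ 2)]
    refine mul_le_mul_of_nonneg_left ?_ (sq_nonneg δ)
    have e1 : (c + δ) / (π * ((k:ℝ) / a) ^ 2) ≤ U * a ^ 2 / 3 * ((k:ℝ) ^ 2)⁻¹ := by
      calc (c + δ) / (π * ((k:ℝ) / a) ^ 2) ≤ U / (3 * ((k:ℝ) / a) ^ 2) := by gcongr
        _ = _ := by field_simp
    have e2 : 1 / (2 * π ^ 2 * ((k:ℝ) / a) ^ 3) ≤ a ^ 3 / 18 * ((k:ℝ) ^ 2)⁻¹ := by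
      calc 1 / (2 * π ^ 2 * ((k:ℝ) / a) ^ 3) ≤ 1 / (2 * 3 ^ 2 * ((k:ℝ) / a) ^ 3) := by gcongr
        _ = a ^ 3 / 18 * ((k:ℝ) ^ 2)⁻¹ * (1 / k) := by field_simp; norm_num
        _ ≤ a ^ 3 / 18 * ((k:ℝ) ^ 2)⁻¹ * 1 := by gcongr; rw [div_le_one (by linarith)]; exact hk1
        _ = _ := by ring
    linarith
  have h2 : ∑ k ∈ Finset.Ico 1 M, ((k:ℝ) ^ 2)⁻¹ ≤ 2 := by
    have := sum_Ioo_inv_sq_le (α := ℝ) 0 M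
    have e : Finset.Ioo 0 M = Finset.Ico 1 M := by ext; simp [Finset.mem_Ioo, Finset.mem_Ico]; omega
    rw [e] at this
    norm_num at this; exact this
  rw [abs_mul, abs_of_pos (by norm_num : (0:ℝ) < 2)]
  have hU0 : 0 ≤ U := by linarith
  calc _ ≤ 2 * ∑ k ∈ Finset.Ico 1 M, δ ^ 2 * (U * a ^ 2 / 3 + a ^ 3 / 18) * ((k:ℝ) ^ 2)⁻¹ := by
        gcongr
        exact (Finset.abs_sum_le_sum_abs _ _).trans (Finset.sum_le_sum h1)
    _ = 2 * (δ ^ 2 * (U * a ^ 2 / 3 + a ^ 3 / 18) * ∑ k ∈ Finset.Ico 1 M, ((k:ℝ) ^ 2)⁻¹) := by rw [← Finset.mul_sum]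
    _ ≤ 2 * (δ ^ 2 * (U * a ^ 2 / 3 + a ^ 3 / 18) * 2) := by gcongr
    _ = δ ^ 2 * (4 / 3 * (U * a ^ 2) + 4 / 18 * a ^ 3) := by ring
    _ ≤ _ := by
        have : 0 ≤ U * a ^ 2 := by positivity
        have : 0 ≤ a ^ 3 := by positivity
        gcongr δ ^ 2 * ?_
        linarith

lemma sum_r2' (N : ℕ) (hN : 1 ≤ N) : ∑ i ∈ Finset.range N, (r2 (N + i) : ℝ) ≤ 12 * N := by
  have := r2box N 1 hN
  simpa using this

lemma Xi_eq {a : ℝ} (i : ℕ) : √a * √((2 ^ i : ℕ) : ℝ) = √a * √2 ^ i := by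
  have e : √((2:ℝ) ^ i) = √2 ^ i := by
    rw [Real.sqrt_eq_iff_mul_self_eq (by positivity) (by positivity), ← mul_pow, Real.mul_self_sqrt (by norm_num)]
  push_cast; rw [e]

lemma line_k0 {a c δ U T : ℝ} (ha : 0 < a) (hδ : 0 < δ) (hc : δ ≤ c) (hU : c + δ ≤ U) (hT : 1 ≤ T) {I : ℕ}
    (hI : ∀ i ≥ I, T ≤ √a * √((2 ^ i : ℕ) : ℝ)) (m : ℕ) :
    |∑ i ∈ Finset.range m, ∑ l ∈ Finset.range (2 ^ i), (r2 (2 ^ i + l) : ℝ) * tau c δ (rh a (2 ^ i + l) 0)|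
      ≤ δ ^ 2 * (4 * U / a * I + 2.4 * (√a)⁻¹ ^ 3) + 1.8 * (c + 0.5) / (a * T ^ 2) := by
  have hπ := Real.pi_gt_three
  have hc0 : 0 < c := by linarith
  have hU0 : 0 < U := by linarith
  have hs2 : (1.41421:ℝ) ≤ √2 := by apply Real.le_sqrt_of_sq_le; norm_num
  have h22 : √2 ^ 2 = (2:ℝ) := Real.sq_sqrt (by norm_num)
  set X : ℕ → ℝ := fun i => √a * √((2 ^ i : ℕ) : ℝ) with hXd
  have hXp : ∀ i, 0 < X i := fun i => by simp only [hXd]; positivity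
  have hX2 : ∀ i, X i ^ 2 = a * ((2 ^ i : ℕ) : ℝ) := fun i => by
    simp only [hXd]; rw [mul_pow, Real.sq_sqrt ha.le, Real.sq_sqrt (by positivity)]
  have hrX : ∀ i l, X i ≤ rh a (2 ^ i + l) 0 := by
    intro i l
    refine le_trans (le_of_eq ?_) (rh_mono ha (Nat.le_add_right (2 ^ i) l) (le_refl 0))
    simp only [hXd, rh]; rw [← Real.sqrt_mul ha.le]; simp
  have blk : ∀ (i : ℕ) (B : ℝ), 0 ≤ B → (∀ l, |tau c δ (rh a (2 ^ i + l) 0)| ≤ B) →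
      |∑ l ∈ Finset.range (2 ^ i), (r2 (2 ^ i + l) : ℝ) * tau c δ (rh a (2 ^ i + l) 0)| ≤ 12 * (X i ^ 2 / a) * B := by
    intro i B hB h
    calc _ ≤ ∑ l ∈ Finset.range (2 ^ i), (r2 (2 ^ i + l) : ℝ) * B := by
          refine (Finset.abs_sum_le_sum_abs _ _).trans (Finset.sum_le_sum fun l _ => ?_)
          rw [abs_mul, abs_of_nonneg (by positivity : (0:ℝ) ≤ (r2 (2 ^ i + l) : ℝ))]
          gcongr; exact h l
      _ = (∑ l ∈ Finset.range (2 ^ i), (r2 (2 ^ i + l) : ℝ)) * B := by rw [Finset.sum_mul]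
      _ ≤ 12 * ((2 ^ i : ℕ) : ℝ) * B := by gcongr; exact sum_r2' _ Nat.one_le_two_pow
      _ = _ := by rw [hX2]; field_simp
  have hin : ∀ i, |∑ l ∈ Finset.range (2 ^ i), (r2 (2 ^ i + l) : ℝ) * tau c δ (rh a (2 ^ i + l) 0)|
      ≤ δ ^ 2 * (4 * U / a) + δ ^ 2 * (2 / 3 * (√a)⁻¹ ^ 3 * (1 / √2) ^ i) := by
    intro i
    have hx := hXp i
    refine (blk i (δ ^ 2 * (U / (3 * X i ^ 2) + 1 / (2 * 3 ^ 2 * X i ^ 3))) (by positivity) fun l => ?_).trans (le_of_eq ?_)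
    · have h1 := hrX i l
      refine (tau_ptA hδ hc (hx.trans_le h1)).trans ?_
      gcongr
    · have e : (√a)⁻¹ ^ 3 * (1 / √2) ^ i = 1 / (a * X i) := by
        have : X i = √a * √2 ^ i := Xi_eq i
        rw [this]
        have hsa : 0 < √a := by positivity
        have : a = √a ^ 2 := (Real.sq_sqrt ha.le).symm
        rw [this, Real.sqrt_sq hsa.le]
        field_simp
        rw [← mul_pow, one_div, inv_mul_cancel₀ (by positivity), one_pow]
      rw [mul_assoc (2/3:ℝ), e]
      field_simp
      ring
  have hout : ∀ i ≥ I, |∑ l ∈ Finset.range (2 ^ i), (r2 (2 ^ i + l) : ℝ) * tau c δ (rh a (2 ^ i + l) 0)|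
      ≤ 0.45 * (c + 0.5) / (a * T ^ 2) * mu 2 2 (√a / T * √2 ^ i) := by
    intro i hi
    have hx := hXp i
    have hxT := hI i hi
    have e : √a / T * √2 ^ i = X i / T := by simp only [hXd]; rw [Xi_eq]; ring
    have hge : 1 ≤ X i / T := by rw [le_div_iff₀ (by linarith), one_mul]; exact hxT
    have hmu : mu 2 2 (X i / T) = T ^ 2 / X i ^ 2 := by
      rw [mu, min_eq_right (Real.rpow_le_rpow_of_exponent_le hge (by norm_num)), Real.rpow_neg (by positivity)]
      norm_num [div_pow]
    rw [e, hmu]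
    have hπ3 : (27:ℝ) ≤ π ^ 3 := by
      calc (27:ℝ) = 3 ^ 3 := by norm_num
        _ ≤ π ^ 3 := by gcongr
    have hπ4 : (81:ℝ) ≤ π ^ 4 := by
      calc (81:ℝ) = 3 ^ 4 := by norm_num
        _ ≤ π ^ 4 := by gcongr
    refine (blk i ((c + 0.5) / (27 * X i ^ 4)) (by positivity) fun l => ?_).trans ?_
    · have h1 := hrX i l
      refine (tau_ptB hδ hc (hx.trans_le h1)).trans ?_
      have hX1 : 1 ≤ X i := hT.trans hxT
      calc c / (π ^ 3 * rh a (2 ^ i + l) 0 ^ 4) + 3 / (2 * π ^ 4 * rh a (2 ^ i + l) 0 ^ 5)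
          ≤ c / (27 * X i ^ 4) + 3 / (2 * 81 * X i ^ 4) := by
            have : X i ^ 4 ≤ rh a (2 ^ i + l) 0 ^ 5 := by
              calc X i ^ 4 ≤ X i ^ 5 := pow_le_pow_right₀ hX1 (by norm_num)
                _ ≤ _ := by gcongr
            gcongr
        _ ≤ _ := by
          rw [add_div]
          refine add_le_add (le_refl _) ?_
          rw [div_le_div_iff₀ (by positivity) (by positivity)]
          have : 0 < X i ^ 4 := by positivity
          linarith
    · have : 12 * (X i ^ 2 / a) * ((c + 0.5) / (27 * X i ^ 4)) = 12 / 27 * ((c + 0.5) / (a * X i ^ 2)) := by field_simp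
      rw [this]
      have : 0.45 * (c + 0.5) / (a * T ^ 2) * (T ^ 2 / X i ^ 2) = 0.45 * ((c + 0.5) / (a * X i ^ 2)) := by field_simp
      rw [this]
      gcongr
      norm_num
  have hmun : ∀ i : ℕ, 0 ≤ mu 2 2 (√a / T * √2 ^ i) := fun i => mu_nonneg _ _ (by positivity)
  have each : ∀ i, |∑ l ∈ Finset.range (2 ^ i), (r2 (2 ^ i + l) : ℝ) * tau c δ (rh a (2 ^ i + l) 0)|
      ≤ (if i < I then δ ^ 2 * (4 * U / a) else 0) + δ ^ 2 * (2 / 3 * (√a)⁻¹ ^ 3 * (1 / √2) ^ i) + 0.45 * (c + 0.5) / (a * T ^ 2) * mu 2 2 (√a / T * √2 ^ i) := by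
    intro i
    have := hmun i
    by_cases h : i < I
    · rw [if_pos h]
      have h1 := hin i
      have : 0 ≤ 0.45 * (c + 0.5) / (a * T ^ 2) * mu 2 2 (√a / T * √2 ^ i) := by positivity
      linarith
    · rw [if_neg h]
      have h1 := hout i (by omega)
      have : 0 ≤ δ ^ 2 * (2 / 3 * (√a)⁻¹ ^ 3 * (1 / √2) ^ i) := by positivity
      linarith
  refine (Finset.abs_sum_le_sum_abs _ _).trans ((Finset.sum_le_sum fun i _ => each i).trans ?_)
  rw [Finset.sum_add_distrib, Finset.sum_add_distrib]
  have s1 : ∑ i ∈ Finset.range m, (if i < I then δ ^ 2 * (4 * U / a) else 0) ≤ δ ^ 2 * (4 * U / a) * I := by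
    rw [← Finset.sum_filter, Finset.sum_const, nsmul_eq_mul, mul_comm]
    have hc : ((Finset.range m).filter (fun i => i < I)).card ≤ I := by
      calc _ ≤ (Finset.range I).card := Finset.card_le_card (fun i hi => by simp at hi ⊢; exact hi.2)
        _ = I := Finset.card_range I
    gcongr
  have s2 : ∑ i ∈ Finset.range m, δ ^ 2 * (2 / 3 * (√a)⁻¹ ^ 3 * (1 / √2) ^ i) ≤ δ ^ 2 * (2.4 * (√a)⁻¹ ^ 3) := by
    have hg : ∑ i ∈ Finset.range m, (1 / √2) ^ i ≤ 3.5 := by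
      have hlt : 1 / √2 < 1 := by rw [div_lt_one (by positivity)]; linarith
      have h1 : 1 / √2 ≤ 0.7072 := by rw [div_le_iff₀ (by positivity)]; linarith
      have := geom_sum_mul (1 / √2) m
      have h3 : 0 ≤ (1 / √2) ^ m := by positivity
      nlinarith [Finset.sum_nonneg (fun i (_ : i ∈ Finset.range m) => (by positivity : 0 ≤ (1 / √2) ^ i))]
    rw [← Finset.mul_sum, ← Finset.mul_sum]
    gcongr δ ^ 2 * ?_
    have : 0 ≤ (√a)⁻¹ ^ 3 := by positivity
    nlinarith
  have s3 : ∑ i ∈ Finset.range m, 0.45 * (c + 0.5) / (a * T ^ 2) * mu 2 2 (√a / T * √2 ^ i) ≤ 1.8 * (c + 0.5) / (a * T ^ 2) := by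
    rw [← Finset.mul_sum]
    have hq : (2:ℝ) ≤ √2 ^ (2:ℝ) := by rw [Real.rpow_two, h22]
    have := geo_sum' (α := 2) (β := 2) (r := √2) (p := 2) (q := 2) (A := 2) (B := 2) (by linarith) (by norm_num) hq hq (by norm_num) (by norm_num) (by norm_num) (by norm_num) m (t := √a / T) (by positivity)
    calc _ ≤ 0.45 * (c + 0.5) / (a * T ^ 2) * (2 + 2) := by gcongr
      _ = _ := by ring
  have : δ ^ 2 * (4 * U / a * I + 2.4 * (√a)⁻¹ ^ 3) = δ ^ 2 * (4 * U / a) * I + δ ^ 2 * (2.4 * (√a)⁻¹ ^ 3) := by ring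
  linarith

end EllAux
end M13sec

section M14sec
namespace EllAux

lemma Box_in {a c δ U g : ℝ} (ha : 0 < a) (hδ : 0 < δ) (hc : δ < c) (hU : c + δ ≤ U) (hg0 : 0 ≤ g) {N K : ℕ} (hN : 1 ≤ N) (hK : 1 ≤ K)
    (hg : 64 * log N + 310 ≤ g ^ 2) :
    |Box a c δ N K| ≤ δ ^ 2 * (FB a U g N K / (π * rh a N K ^ 2) * min 1 ((1 / (π * δ) / rh a N K) ^ 2) + 0.71) := by
  refine box_tau ha hδ hc hN hK fun u hu N' hN' K' hK' => ?_
  rw [Set.mem_Icc] at hu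
  refine box_F ha (by linarith) (by linarith) hg0 hN hK ?_ hN' hK'
  refine (sum_r2_sq N hN).trans ?_
  have : (0:ℝ) ≤ N := Nat.cast_nonneg N
  nlinarith

lemma Box_out {a c δ T : ℝ} (ha : 0 < a) (hδ : 0 < δ) (hc : δ ≤ c) (hT : 1 ≤ T) {N K : ℕ} (hN : 1 ≤ N) (hK : 1 ≤ K)
    (hZT : T ≤ rh a N K) :
    |Box a c δ N K| ≤ 12 / 27 * (c + 0.5) / T * (mu 1 1 (√a * √N / T) * mu 1 1 (K / a / (√a * √N))) := by
  have hZ := rh_pos_n ha hN K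
  have hZ2 := rh_sq ha N K
  have hπ := Real.pi_gt_three
  have hc0 : 0 < c := by linarith
  have hT0 : 0 < T := by linarith
  have hNr : (0:ℝ) < N := by exact_mod_cast hN
  have hKr : (0:ℝ) < K := by exact_mod_cast hK
  have hrZ : ∀ i k, rh a N K ≤ rh a (N + i) (K + k) := fun i k => rh_mono ha (by omega) (by omega)
  set Z := rh a N K with hZd
  set X := √a * √N with hX
  set Y := (K:ℝ) / a with hY
  have hX0 : 0 < X := by rw [hX]; positivity
  have hY0 : 0 < Y := by rw [hY]; positivity
  have hX2 : X ^ 2 = a * N := by rw [hX, mul_pow, Real.sq_sqrt ha.le, Real.sq_sqrt hNr.le]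
  have hXZ : X ≤ Z := by
    apply (pow_le_pow_iff_left₀ hX0.le hZ.le two_ne_zero).1
    rw [hX2, hZ2]; have : 0 ≤ (K:ℝ) ^ 2 / a ^ 2 := by positivity
    linarith
  have hYZ : Y ≤ Z := by
    apply (pow_le_pow_iff_left₀ hY0.le hZ.le two_ne_zero).1
    rw [hY, hZ2, div_pow]; have : 0 ≤ a * N := by positivity
    linarith
  have b1 := mono_box (p := 2) (q := 1) (e := 2) hX0 hY0 hT0 hXZ hYZ (by norm_num)
  rw [min_eq_right (by apply pow_le_one₀ (by positivity); rw [div_le_one hZ]; exact hZT), Real.rpow_neg hZ.le] at b1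
  norm_num at b1
  have hπ3 : (27:ℝ) ≤ π ^ 3 := by
    calc (27:ℝ) = 3 ^ 3 := by norm_num
      _ ≤ π ^ 3 := by gcongr
  have hπ4 : (81:ℝ) ≤ π ^ 4 := by
    calc (81:ℝ) = 3 ^ 4 := by norm_num
      _ ≤ π ^ 4 := by gcongr
  have pt : ∀ i k, |tau c δ (rh a (N + i) (K + k))| ≤ (c + 0.5) / (27 * Z ^ 4) := by
    intro i k
    have h1 := hrZ i k
    refine (tau_ptB hδ hc (hZ.trans_le h1)).trans ?_
    have hX1 : 1 ≤ Z := hT.trans hZT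
    calc c / (π ^ 3 * rh a (N + i) (K + k) ^ 4) + 3 / (2 * π ^ 4 * rh a (N + i) (K + k) ^ 5)
        ≤ c / (27 * Z ^ 4) + 3 / (2 * 81 * Z ^ 4) := by
          have : Z ^ 4 ≤ rh a (N + i) (K + k) ^ 5 := by
            calc Z ^ 4 ≤ Z ^ 5 := pow_le_pow_right₀ hX1 (by norm_num)
              _ ≤ _ := by gcongr
          gcongr
      _ ≤ _ := by
        rw [add_div]
        refine add_le_add (le_refl _) ?_
        rw [div_le_div_iff₀ (by positivity) (by positivity)]
        have : 0 < Z ^ 4 := by positivity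
        linarith
  have hB : |Box a c δ N K| ≤ 12 * N * K * ((c + 0.5) / (27 * Z ^ 4)) := by
    rw [Box]
    calc _ ≤ ∑ i ∈ Finset.range N, ∑ k ∈ Finset.range K, (r2 (N + i) : ℝ) * ((c + 0.5) / (27 * Z ^ 4)) := by
          refine (Finset.abs_sum_le_sum_abs _ _).trans (Finset.sum_le_sum fun i _ => ?_)
          refine (Finset.abs_sum_le_sum_abs _ _).trans (Finset.sum_le_sum fun k _ => ?_)
          rw [abs_mul, abs_of_nonneg (by positivity : (0:ℝ) ≤ (r2 (N + i) : ℝ))]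
          gcongr; exact pt i k
      _ = (∑ i ∈ Finset.range N, ∑ k ∈ Finset.range K, (r2 (N + i) : ℝ)) * ((c + 0.5) / (27 * Z ^ 4)) := by
          simp only [Finset.sum_mul]
      _ ≤ _ := by gcongr; exact r2box N K hN
  have hNK : (N:ℝ) * K = X ^ 2 * Y := by rw [hX2, hY]; field_simp
  refine hB.trans ?_
  calc 12 * (N:ℝ) * K * ((c + 0.5) / (27 * Z ^ 4)) = 12 / 27 * (c + 0.5) / T ^ 2 * (X ^ 2 * Y * (Z ^ 2)⁻¹ * (T / Z) ^ 2) := by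
        rw [mul_assoc (12:ℝ), hNK]; field_simp
    _ ≤ 12 / 27 * (c + 0.5) / T ^ 2 * (T * mu 1 1 (X / T) * mu 1 1 (Y / X)) := by gcongr
    _ = _ := by field_simp

lemma boxes {a c δ U g T : ℝ} (ha : 0 < a) (hδ : 0 < δ) (hc : δ < c) (hU : c + δ ≤ U) (hg0 : 0 ≤ g) (hT : 1 ≤ T) {I J : ℕ}
    (hg : ∀ i < I, 64 * log ((2 ^ i : ℕ) : ℝ) + 310 ≤ g ^ 2)
    (hout : ∀ i j, ¬ (i < I ∧ j < J) → T ≤ rh a (2 ^ i) (2 ^ j)) (m : ℕ) :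
    |∑ i ∈ Finset.range m, ∑ j ∈ Finset.range m, Box a c δ (2 ^ i) (2 ^ j)| ≤
    δ ^ 2 * (g / π * (8.8 * (U ^ (7/6 : ℝ) * a ^ (1/6 : ℝ)) * (1 / (π * δ)) ^ (1/3 : ℝ) * 37.5
      + 43.5 * (U ^ (5/6 : ℝ) * a ^ (1/3 : ℝ)) * (1 / (π * δ)) ^ (2/3 : ℝ) * 54.2
      + 1.57 * (U ^ (7/8 : ℝ) * a ^ (-1 : ℝ)) * (1 / (π * δ)) ^ (5/8 : ℝ) * (7.8 * J)
      + 11.4 * (U ^ (5/8 : ℝ) * a ^ (-1/2 : ℝ)) * (1 / (π * δ)) ^ (7/8 : ℝ) * (6.95 * J)) + 0.71 * (I * J))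
     + 12.5 * (c + 0.5) / T := by
  have hπ := Real.pi_gt_three
  have hc0 : 0 < c := by linarith
  have hU0 : 0 < U := by linarith
  have hT0 : 0 < T := by linarith
  have hs2 : (1.41421:ℝ) ≤ √2 := by apply Real.le_sqrt_of_sq_le; norm_num
  set In : ℕ → ℕ → ℝ := fun i j => FB a U g (2 ^ i) (2 ^ j) / (π * rh a (2 ^ i) (2 ^ j) ^ 2) * min 1 ((1 / (π * δ) / rh a (2 ^ i) (2 ^ j)) ^ 2) with hIn
  set Ou : ℕ → ℕ → ℝ := fun i j => mu 1 1 (√a * √((2 ^ i : ℕ) : ℝ) / T) * mu 1 1 (((2 ^ j : ℕ) : ℝ) / a / (√a * √((2 ^ i : ℕ) : ℝ))) with hOu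
  have hIn0 : ∀ i j, 0 ≤ In i j := by
    intro i j
    have h := rh_nonneg a (2 ^ i) (2 ^ j)
    simp only [hIn, FB]
    have : ∀ s : ℝ, 0 ≤ rh a (2 ^ i) (2 ^ j) ^ s := fun s => Real.rpow_nonneg h s
    have := this (-5/6); 
    positivity
  have hOu0 : ∀ i j, 0 ≤ Ou i j := by
    intro i j
    exact mul_nonneg (mu_nonneg _ _ (by positivity)) (mu_nonneg _ _ (by positivity))
  have each : ∀ i j, |Box a c δ (2 ^ i) (2 ^ j)| ≤ (if i < I ∧ j < J then δ ^ 2 * (In i j + 0.71) else 0) + 12 / 27 * (c + 0.5) / T * Ou i j := by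
    intro i j
    have h2 := hOu0 i j
    have h3 : 0 ≤ 12 / 27 * (c + 0.5) / T * Ou i j := by positivity
    by_cases h : i < I ∧ j < J
    · rw [if_pos h]
      have := Box_in ha hδ hc hU hg0 (N := 2 ^ i) (K := 2 ^ j) Nat.one_le_two_pow Nat.one_le_two_pow (hg i h.1)
      linarith
    · rw [if_neg h, zero_add]
      exact Box_out ha hδ hc.le hT Nat.one_le_two_pow Nat.one_le_two_pow (hout i j h)
  have s1 : ∑ i ∈ Finset.range m, ∑ j ∈ Finset.range m, (if i < I ∧ j < J then δ ^ 2 * (In i j + 0.71) else 0)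
      ≤ ∑ i ∈ Finset.range I, ∑ j ∈ Finset.range J, δ ^ 2 * (In i j + 0.71) := by
    rw [← Finset.sum_product', ← Finset.sum_product', ← Finset.sum_filter]
    apply Finset.sum_le_sum_of_subset_of_nonneg
    · intro p hp; simp at hp ⊢; exact hp.2
    · intro p _ _
      have := hIn0 p.1 p.2
      positivity
  have s2 : ∑ i ∈ Finset.range I, ∑ j ∈ Finset.range J, δ ^ 2 * (In i j + 0.71) = δ ^ 2 * ((∑ i ∈ Finset.range I, ∑ j ∈ Finset.range J, In i j) + 0.71 * (I * J)) := by
    simp only [← Finset.mul_sum, Finset.sum_add_distrib, Finset.sum_const, Finset.card_range, nsmul_eq_mul]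
    ring
  have s3 := sum_inside (U := U) (g := g) (T := 1 / (π * δ)) ha hU0 hg0 (by positivity) I J
  have s4 : ∑ i ∈ Finset.range m, ∑ j ∈ Finset.range m, Ou i j ≤ 28 := by
    have hY : ∀ i, ∑ j ∈ Finset.range m, mu 1 1 (((2 ^ j : ℕ) : ℝ) / a / (√a * √((2 ^ i : ℕ) : ℝ))) ≤ 4 := by
      intro i
      have e : ∀ j : ℕ, ((2 ^ j : ℕ) : ℝ) / a / (√a * √((2 ^ i : ℕ) : ℝ)) = 1 / (a * (√a * √((2 ^ i : ℕ) : ℝ))) * 2 ^ j := by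
        intro j; push_cast; field_simp
      simp only [e]
      refine (geo_sum' (p := 2) (q := 2) (A := 2) (B := 2) (by norm_num) (by norm_num) (by norm_num) (by norm_num) (by norm_num) (by norm_num) (by norm_num) (by norm_num) m (by positivity)).trans (by norm_num)
    have hX : ∑ i ∈ Finset.range m, mu 1 1 (√a * √((2 ^ i : ℕ) : ℝ) / T) ≤ 7 := by
      have e : ∀ i : ℕ, √a * √((2 ^ i : ℕ) : ℝ) / T = √a / T * √2 ^ i := by
        intro i; rw [Xi_eq]; ring
      simp only [e]
      have hq : (1.41421:ℝ) ≤ √2 ^ (1:ℝ) := by rw [Real.rpow_one]; exact hs2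
      refine (geo_sum' (p := 1.41421) (q := 1.41421) (A := 3.5) (B := 3.5) (by linarith) (by norm_num) hq hq (by norm_num) (by norm_num) (by norm_num) (by norm_num) m (by positivity)).trans (by norm_num)
    calc _ = ∑ i ∈ Finset.range m, mu 1 1 (√a * √((2 ^ i : ℕ) : ℝ) / T) * ∑ j ∈ Finset.range m, mu 1 1 (((2 ^ j : ℕ) : ℝ) / a / (√a * √((2 ^ i : ℕ) : ℝ))) := by
          simp only [hOu, Finset.mul_sum]
      _ ≤ ∑ i ∈ Finset.range m, mu 1 1 (√a * √((2 ^ i : ℕ) : ℝ) / T) * 4 := by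
          refine Finset.sum_le_sum fun i _ => ?_
          exact mul_le_mul_of_nonneg_left (hY i) (mu_nonneg _ _ (by positivity))
      _ = (∑ i ∈ Finset.range m, mu 1 1 (√a * √((2 ^ i : ℕ) : ℝ) / T)) * 4 := by rw [Finset.sum_mul]
      _ ≤ _ := by linarith
  have s5 : ∑ i ∈ Finset.range m, ∑ j ∈ Finset.range m, 12 / 27 * (c + 0.5) / T * Ou i j ≤ 12.5 * (c + 0.5) / T := by
    simp only [← Finset.mul_sum]
    calc _ ≤ 12 / 27 * (c + 0.5) / T * 28 := by gcongr
      _ = (12 * 28 / 27) * ((c + 0.5) / T) := by ring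
      _ ≤ 12.5 * ((c + 0.5) / T) := by gcongr; norm_num
      _ = _ := by ring
  calc _ ≤ ∑ i ∈ Finset.range m, ∑ j ∈ Finset.range m, ((if i < I ∧ j < J then δ ^ 2 * (In i j + 0.71) else 0) + 12 / 27 * (c + 0.5) / T * Ou i j) := by
        refine (Finset.abs_sum_le_sum_abs _ _).trans (Finset.sum_le_sum fun i _ => ?_)
        exact (Finset.abs_sum_le_sum_abs _ _).trans (Finset.sum_le_sum fun j _ => each i j)
    _ ≤ δ ^ 2 * ((∑ i ∈ Finset.range I, ∑ j ∈ Finset.range J, In i j) + 0.71 * (I * J)) + 12.5 * (c + 0.5) / T := by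
        simp only [Finset.sum_add_distrib]
        linarith
    _ ≤ _ := by gcongr

end EllAux
end M14sec

section M15sec
namespace EllAux

lemma cutoff (B : ℝ) : ∃ I : ℕ, (∀ i < I, ((2 ^ i : ℕ) : ℝ) < B) ∧ (∀ i ≥ I, B ≤ ((2 ^ i : ℕ) : ℝ)) := by
  have hex : ∃ n : ℕ, B ≤ ((2 ^ n : ℕ) : ℝ) := by
    obtain ⟨n, hn⟩ := pow_unbounded_of_one_lt B (by norm_num : (1:ℝ) < 2)
    exact ⟨n, by push_cast; exact hn.le⟩
  classical
  refine ⟨Nat.find hex, fun i hi => not_le.1 (Nat.find_min hex hi), fun i hi => (Nat.find_spec hex).trans ?_⟩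
  exact_mod_cast Nat.pow_le_pow_right (by norm_num) hi

lemma cutoff_card {B Λ : ℝ} {I : ℕ} (hI : ∀ i < I, ((2 ^ i : ℕ) : ℝ) < B) (hΛ : log B ≤ Λ)
    {M : ℝ} (hM : 1 + Λ * 1.4428 ≤ M) (hM0 : 0 ≤ M) : (I : ℝ) ≤ M := by
  rcases Nat.eq_zero_or_pos I with h | h
  · rw [h]; simpa using hM0
  · have h1 := hI (I - 1) (by omega)
    have h2 : log ((2 ^ (I - 1) : ℕ) : ℝ) < log B := Real.log_lt_log (by positivity) h1
    push_cast at h2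
    rw [Real.log_pow] at h2
    have h3 : ((I - 1 : ℕ) : ℝ) = I - 1 := by push_cast [Nat.cast_sub h]; ring
    rw [h3] at h2
    have h4 := Real.log_two_gt_d9
    have h5 : (1:ℝ) ≤ I := by exact_mod_cast h
    nlinarith

lemma log_hundred : (4.6:ℝ) ≤ log 100 := by
  have h : (100:ℝ) = 2 ^ 6 * (25 / 16) := by norm_num
  have h1 := Real.log_two_gt_d9
  have h2 : (0.442:ℝ) ≤ log (25/16) := by
    rw [Real.le_log_iff_exp_le (by norm_num)]
    have : (0.442:ℝ) = 0.221 + 0.221 := by norm_num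
    rw [this, exp_add]
    have h3 : exp (0.221:ℝ) ≤ 1.2495 := by
      have := Real.exp_bound' (x := 0.221) (by norm_num) (by norm_num) (n := 4) (by norm_num)
      refine this.trans ?_
      norm_num [Finset.sum_range_succ, Nat.factorial]
    have h4 := exp_pos (0.221:ℝ)
    nlinarith
  rw [h, Real.log_mul (by norm_num) (by norm_num), Real.log_pow]
  push_cast
  linarith

lemma main_E {a x c δ U L : ℝ} (ha : 0 < a) (hx : 3 ≤ x) (hL : L = log (100 * x) + |log a|) (hδ : 0 < δ)
    (hδ2 : 1 ≤ δ ^ 2 * (16 * x)) (hc : δ < c) (hU : c + δ ≤ U) (m : ℕ) :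
    |bsum a c δ (2 ^ m)| ≤ δ ^ 2 * (1.34 * U * a ^ 2 + 0.23 * a ^ 3 + 4 * U / a * (2.9 * L) + 2.4 * (√a)⁻¹ ^ 3
      + 28.8 * (c + 0.5) / (a * x)
      + 2 * (√(128 * L) / π * (8.8 * (U ^ (7/6 : ℝ) * a ^ (1/6 : ℝ)) * (1 / (π * δ)) ^ (1/3 : ℝ) * 37.5
      + 43.5 * (U ^ (5/6 : ℝ) * a ^ (1/3 : ℝ)) * (1 / (π * δ)) ^ (2/3 : ℝ) * 54.2
      + 1.57 * (U ^ (7/8 : ℝ) * a ^ (-1 : ℝ)) * (1 / (π * δ)) ^ (5/8 : ℝ) * (7.8 * (1.45 * L))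
      + 11.4 * (U ^ (5/8 : ℝ) * a ^ (-1/2 : ℝ)) * (1 / (π * δ)) ^ (7/8 : ℝ) * (6.95 * (1.45 * L))) + 0.71 * (2.9 * L * (1.45 * L)))
      + 400 * (c + 0.5)) := by
  have hx0 : 0 < x := by linarith
  have hπ := Real.pi_pos
  have hc0 : 0 < c := by linarith
  have hU0 : 0 < U := by linarith
  have hl := log_hundred
  rw [Real.log_mul (by norm_num) hx0.ne'] at hL
  have hlx : 0 ≤ log x := Real.log_nonneg (by linarith)
  have hab := abs_nonneg (log a)
  have hL0 : 4.6 ≤ L := by linarith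
  obtain ⟨I, hI1, hI2⟩ := cutoff (x ^ 2 / a)
  obtain ⟨J, hJ1, hJ2⟩ := cutoff (a * x)
  have hlB : log (x ^ 2 / a) ≤ 2 * L - 9.2 := by
    rw [Real.log_div (by positivity) ha.ne', Real.log_pow]
    push_cast
    have := neg_abs_le (log a)
    linarith
  have hlB' : log (a * x) ≤ L - 4.6 := by
    rw [Real.log_mul ha.ne' hx0.ne']
    have := le_abs_self (log a)
    linarith
  have hIc : (I:ℝ) ≤ 2.9 * L := cutoff_card hI1 hlB (by linarith) (by linarith)
  have hJc : (J:ℝ) ≤ 1.45 * L := cutoff_card hJ1 hlB' (by linarith) (by linarith)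
  have hsI : ∀ i ≥ I, x ≤ √a * √((2 ^ i : ℕ) : ℝ) := by
    intro i hi
    rw [← Real.sqrt_mul ha.le]
    apply Real.le_sqrt_of_sq_le
    have := hI2 i hi
    rwa [div_le_iff₀ ha, mul_comm] at this
  have hout : ∀ i j, ¬ (i < I ∧ j < J) → x ≤ rh a (2 ^ i) (2 ^ j) := by
    intro i j hij
    have hsq := rh_sq ha (2 ^ i) (2 ^ j)
    refine (sq_le_sq₀ hx0.le (rh_nonneg _ _ _)).1 ?_
    rw [hsq]
    by_cases h : i < I
    · have hj : J ≤ j := by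
        by_contra hh
        exact hij ⟨h, by omega⟩
      have h1 := hJ2 j hj
      have h2 : x ≤ ((2 ^ j : ℕ) : ℝ) / a := by
        rw [le_div_iff₀ ha]; linarith
      have h3 : x ^ 2 ≤ (((2 ^ j : ℕ) : ℝ) / a) ^ 2 := by gcongr
      rw [div_pow] at h3
      have : 0 ≤ a * ((2 ^ i : ℕ) : ℝ) := by positivity
      linarith
    · have h1 := hI2 i (by omega)
      rw [div_le_iff₀ ha] at h1
      have : 0 ≤ ((2 ^ j : ℕ) : ℝ) ^ 2 / a ^ 2 := by positivity
      linarith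
  have hg : ∀ i < I, 64 * log ((2 ^ i : ℕ) : ℝ) + 310 ≤ √(128 * L) ^ 2 := by
    intro i hi
    rw [Real.sq_sqrt (by linarith)]
    have : log ((2 ^ i : ℕ) : ℝ) < log (x ^ 2 / a) := Real.log_lt_log (by positivity) (hI1 i hi)
    linarith
  have B1 := line_n0 ha hδ hc.le hU (2 ^ m)
  have B2 := line_k0 ha hδ hc.le hU (T := x) (by linarith) hsI m
  have B3 := boxes ha hδ hc hU (Real.sqrt_nonneg (128 * L)) (T := x) (by linarith) hg hout m
  rw [bsum_dec]
  have e1 : 1.8 * (c + 0.5) / (a * x ^ 2) ≤ δ ^ 2 * (28.8 * (c + 0.5) / (a * x)) := by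
    calc 1.8 * (c + 0.5) / (a * x ^ 2) = 1 * (1.8 * (c + 0.5) / (a * x ^ 2)) := by ring
      _ ≤ (δ ^ 2 * (16 * x)) * (1.8 * (c + 0.5) / (a * x ^ 2)) := by gcongr
      _ = _ := by field_simp; ring
  have e2 : 12.5 * (c + 0.5) / x ≤ δ ^ 2 * (200 * (c + 0.5)) := by
    calc 12.5 * (c + 0.5) / x = 1 * (12.5 * (c + 0.5) / x) := by ring
      _ ≤ (δ ^ 2 * (16 * x)) * (12.5 * (c + 0.5) / x) := by gcongr
      _ = _ := by field_simp; ring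
  have e3 : δ ^ 2 * (4 * U / a * I + 2.4 * (√a)⁻¹ ^ 3) ≤ δ ^ 2 * (4 * U / a * (2.9 * L) + 2.4 * (√a)⁻¹ ^ 3) := by gcongr
  have B3' := B3.trans (add_le_add (show _ ≤ δ ^ 2 * (√(128 * L) / π * (8.8 * (U ^ (7/6 : ℝ) * a ^ (1/6 : ℝ)) * (1 / (π * δ)) ^ (1/3 : ℝ) * 37.5
      + 43.5 * (U ^ (5/6 : ℝ) * a ^ (1/3 : ℝ)) * (1 / (π * δ)) ^ (2/3 : ℝ) * 54.2
      + 1.57 * (U ^ (7/8 : ℝ) * a ^ (-1 : ℝ)) * (1 / (π * δ)) ^ (5/8 : ℝ) * (7.8 * (1.45 * L))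
      + 11.4 * (U ^ (5/8 : ℝ) * a ^ (-1/2 : ℝ)) * (1 / (π * δ)) ^ (7/8 : ℝ) * (6.95 * (1.45 * L))) + 0.71 * (2.9 * L * (1.45 * L))) by
        gcongr) e2)
  refine (abs_add_three _ _ _).trans ?_
  rw [abs_mul 2 (∑ i ∈ Finset.range m, ∑ j ∈ Finset.range m, Box a c δ (2 ^ i) (2 ^ j)), abs_of_pos (by norm_num : (0:ℝ) < 2)]
  linarith

end EllAux
end M15sec

section M16sec
namespace EllAux

lemma rt_le {q r : ℝ} (m : ℕ) {s : ℝ} (hr : 0 ≤ r) (hm : 0 < m) (n : ℕ) (hs : s * m = n) (h : r ^ n ≤ q ^ m) (hq : 0 ≤ q) : r ^ s ≤ q := by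
  apply (pow_le_pow_iff_left₀ (Real.rpow_nonneg hr _) hq hm.ne').1
  rw [← Real.rpow_natCast (r ^ s), ← Real.rpow_mul hr, hs, Real.rpow_natCast]
  exact h

/-- generic bound for one of the main terms -/
lemma mono_term {a R L δ g κu κd : ℝ} (ha : 0 < a) (hR : 0 < R) (hL : 0 < L) (hδ : δ = 18.4 * a ^ (1/8:ℝ) * R ^ (-5/8:ℝ) * L ^ (3/8:ℝ))
    (hg : g = √(128 * L)) {u p s : ℝ} (hs0 : 0 ≤ s) (hu : (7/6:ℝ) ^ u ≤ κu) (hd : (1/57.8:ℝ) ^ s ≤ κd) :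
    2 * (g / π) * ((7/6 * R) ^ u * a ^ p * (1 / (π * δ)) ^ s) ≤
      7.203 * κu * κd * (a ^ (p - s / 8) * R ^ (u + 5 / 8 * s) * L ^ (1/2 - 3 / 8 * s)) := by
  have hπ : (3.1415:ℝ) < π := Real.pi_gt_d4
  have hku : 0 ≤ κu := (Real.rpow_nonneg (by norm_num) _).trans hu
  have hkd : 0 ≤ κd := (Real.rpow_nonneg (by norm_num) _).trans hd
  have hg1 : 2 * (g / π) ≤ 7.203 * L ^ (1/2:ℝ) := by
    have h1 : √(128 * L) ≤ 11.3138 * L ^ (1/2:ℝ) := by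
      rw [Real.sqrt_mul (by norm_num), ← Real.sqrt_eq_rpow]
      gcongr
      rw [Real.sqrt_le_left (by norm_num)]; norm_num
    have hLp : 0 ≤ L ^ (1/2:ℝ) := by positivity
    rw [hg, ← mul_div_assoc, div_le_iff₀ (by linarith)]
    nlinarith
  set M := a ^ (-1/8:ℝ) * R ^ (5/8:ℝ) * L ^ (-3/8:ℝ) with hM
  have hM0 : 0 < M := by positivity
  have hδM : δ = 18.4 / M := by
    rw [hδ, hM]
    rw [eq_div_iff (by positivity)]
    have e : ∀ z : ℝ, 0 < z → ∀ q : ℝ, ∀ q' : ℝ, q + q' = 0 → z ^ q * z ^ q' = 1 := by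
      intro z hz q q' h; rw [← Real.rpow_add hz, h, Real.rpow_zero]
    calc _ = 18.4 * (a ^ (1/8:ℝ) * a ^ (-1/8:ℝ)) * (R ^ (-5/8:ℝ) * R ^ (5/8:ℝ)) * (L ^ (3/8:ℝ) * L ^ (-3/8:ℝ)) := by ring
      _ = _ := by rw [e a ha _ _ (by norm_num), e R hR _ _ (by norm_num), e L hL _ _ (by norm_num)]; ring
  have h2 : 1 / (π * δ) ≤ 1 / 57.8 * M := by
    rw [hδM, ← mul_div_assoc, one_div_div, div_le_iff₀ (by positivity)]
    nlinarith
  have hδ0 : 0 < δ := by rw [hδM]; positivity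
  have h3 : (1 / (π * δ)) ^ s ≤ κd * M ^ s := by
    calc _ ≤ (1 / 57.8 * M) ^ s := Real.rpow_le_rpow (by positivity) h2 hs0
      _ = (1/57.8) ^ s * M ^ s := Real.mul_rpow (by norm_num) hM0.le
      _ ≤ _ := by gcongr
  have h4 : (7/6 * R) ^ u ≤ κu * R ^ u := by
    rw [Real.mul_rpow (by norm_num) hR.le]; gcongr
  calc 2 * (g / π) * ((7/6 * R) ^ u * a ^ p * (1 / (π * δ)) ^ s)
      ≤ (7.203 * L ^ (1/2:ℝ)) * ((κu * R ^ u) * a ^ p * (κd * M ^ s)) := by gcongr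
    _ = 7.203 * κu * κd * (L ^ (1/2:ℝ) * R ^ u * a ^ p * M ^ s) := by ring
    _ = _ := by
      congr 1
      have hla := Real.exp_log ha
      have hlR := Real.exp_log hR
      have hlL := Real.exp_log hL
      rw [hM, ← hla, ← hlR, ← hlL]
      simp only [exp_rp, ← exp_add]
      congr 1
      ring

lemma count_eq {a x : ℝ} (hx : 0 ≤ x) : (Set.ncard {m : ℤ × ℤ × ℤ |
          (((m.1 : ℝ) ^ 2 + (m.2.1 : ℝ) ^ 2) / a + a ^ 2 * (m.2.2 : ℝ) ^ 2) ≤ x} : ℝ) = Nc a (√x) := by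
  unfold Nc
  congr 1
  rw [← Set.ncard_image_of_injective _ ((Equiv.prodAssoc ℤ ℤ ℤ).symm.trans e3).injective]
  congr 1
  ext m
  simp only [Set.mem_image, Set.mem_setOf_eq, Qn]
  rw [Real.sqrt_le_sqrt_iff hx]
  constructor
  · rintro ⟨p, hp, rfl⟩
    simpa [e3] using hp
  · intro h
    refine ⟨(m 0, m 1, m 2), h, ?_⟩
    ext i; fin_cases i <;> rfl

end EllAux
end M16sec

section M17sec
namespace EllAux

lemma mono_conv {a x L : ℝ} (ha : 0 < a) (hx : 0 < x) (hL : 0 < L) {p q r p' q' r' : ℝ} (h1 : p = p') (h2 : q = 2 * q') (h3 : r = r') :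
    a ^ p * (√x) ^ q * L ^ r = a ^ p' * x ^ q' * L ^ r' := by
  rw [h1, h2, h3, Real.sqrt_eq_rpow, ← Real.rpow_mul hx.le]
  congr 3
  ring

lemma comb {A5 a b R G B1 B2 B3 B4 S c X1 X3 X4 p q r w L α A1 A3 : ℝ} (T1 : 2 * G * B1 ≤ X1) (T2 : 2 * G * B2 ≤ p * (16 * q + 543 * r) * w)
    (T3 : 2 * G * B3 ≤ X3) (T4 : 2 * G * B4 ≤ X4) (T5 : 2 * S ≤ (p * (118 * q) + 20 * q / p) * w)
    (_f1 : a ^ 2 ≤ α ^ 3) (f2 : a ^ 3 ≤ α ^ 3) (f3 : b ^ 3 ≤ α ^ 3) (f4 : A5 ≤ 14 * L / a * R) (f5 : A3 ≤ 14 * L / a * R)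
    (f6 : A1 ≤ 159 * α ^ 3 * R) (hc5 : c + 0.5 ≤ 1.38 * R) (hL : 0 ≤ L) (ha : 0 < a) (hR : 0 < R) (hα : 0 < α) :
    A1 + 0.23 * a ^ 3 + A3 + 2.4 * b ^ 3 + A5 + 2 * (G * (B1 + B2 + B3 + B4) + S) + 400 * (c + 0.5) ≤
      X1 + X3 + (p * (134 * q + 543 * r) + 20 * q / p) * w + X4 + (268 * L / a + 159 * α ^ 3 + 2000) * R + α ^ 3 * (4.4 * L + 104.5) := by
  have f7 : 28 * L / a * R ≤ 268 * L / a * R := by gcongr; norm_num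
  have f8 : 0 ≤ α ^ 3 * L := by positivity
  have f9 : 0 ≤ α ^ 3 := by positivity
  have key : 28 * L / a * R = 14 * L / a * R + 14 * L / a * R := by ring
  have k2 : (p * (134 * q + 543 * r) + 20 * q / p) * w = p * (16 * q + 543 * r) * w + (p * (118 * q) + 20 * q / p) * w := by ring
  rw [k2]
  have k3 : 2 * (G * (B1 + B2 + B3 + B4) + S) = 2 * G * B1 + 2 * G * B2 + 2 * G * B3 + 2 * G * B4 + 2 * S := by ring
  have k4 : (268 * L / a + 159 * α ^ 3 + 2000) * R = 268 * L / a * R + 159 * α ^ 3 * R + 2000 * R := by ring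
  rw [k3, k4]
  linarith

set_option maxHeartbeats 1000000 in
lemma E_bound {a x c δ L α : ℝ} (ha : 0 < a) (hx : 3 ≤ x) (hL : 5.69 ≤ L)
    (hδ : δ = 18.4 * a ^ (1/8:ℝ) * (√x) ^ (-5/8:ℝ) * L ^ (3/8:ℝ)) (hc0 : 0 < c) (hc : c ≤ 13 / 12 * √x) (hα : α = max a (1 / √a)) :
    1.34 * (7/6 * √x) * a ^ 2 + 0.23 * a ^ 3 + 4 * (7/6 * √x) / a * (2.9 * L) + 2.4 * (√a)⁻¹ ^ 3
      + 28.8 * (c + 0.5) / (a * x)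
      + 2 * (√(128 * L) / π * (8.8 * ((7/6 * √x) ^ (7/6 : ℝ) * a ^ (1/6 : ℝ)) * (1 / (π * δ)) ^ (1/3 : ℝ) * 37.5
      + 43.5 * ((7/6 * √x) ^ (5/6 : ℝ) * a ^ (1/3 : ℝ)) * (1 / (π * δ)) ^ (2/3 : ℝ) * 54.2
      + 1.57 * ((7/6 * √x) ^ (7/8 : ℝ) * a ^ (-1 : ℝ)) * (1 / (π * δ)) ^ (5/8 : ℝ) * (7.8 * (1.45 * L))
      + 11.4 * ((7/6 * √x) ^ (5/8 : ℝ) * a ^ (-1/2 : ℝ)) * (1 / (π * δ)) ^ (7/8 : ℝ) * (6.95 * (1.45 * L))) + 0.71 * (2.9 * L * (1.45 * L)))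
      + 400 * (c + 0.5) ≤ 750 * (a ^ ((1 : ℝ) / 8) * x ^ ((11 : ℝ) / 16) * L ^ ((3 : ℝ) / 8))
        + 12 * a ^ (-(69 : ℝ) / 64) * x ^ ((81 : ℝ) / 128) * L ^ ((145 : ℝ) / 64)
        + (a ^ ((1 : ℝ) / 4) * (134 * L ^ ((5 : ℝ) / 2) + 543 * L ^ ((1 : ℝ) / 4))
            + 20 * L ^ ((5 : ℝ) / 2) / a ^ ((1 : ℝ) / 4)) * x ^ ((5 : ℝ) / 8)
        + 12 * a ^ (-(39 : ℝ) / 64) * x ^ ((75 : ℝ) / 128) * L ^ ((139 : ℝ) / 64)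
        + (268 * L / a + 159 * α ^ 3 + 2000) * x ^ ((1 : ℝ) / 2)
        + α ^ 3 * (4.4 * L + 104.5) := by
  have hx0 : 0 < x := by linarith
  have hL0 : 0 < L := by linarith
  have hR0 : 0 < √x := Real.sqrt_pos.2 hx0
  have hR1 : 1.73 ≤ √x := by apply Real.le_sqrt_of_sq_le; linarith
  have hRx : √x * √x = x := Real.mul_self_sqrt hx0.le
  have t1 := mono_term (κu := 1.1971) (κd := 0.25875) ha hR0 hL0 hδ rfl (u := 7/6) (p := 1/6) (s := 1/3) (by norm_num)
    (rt_le 6 (by norm_num) (by norm_num) 7 (by norm_num) (by norm_num) (by norm_num))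
    (rt_le 3 (by norm_num) (by norm_num) 1 (by norm_num) (by norm_num) (by norm_num))
  have t2 := mono_term (κu := 1.1372) (κd := 0.067) ha hR0 hL0 hδ rfl (u := 5/6) (p := 1/3) (s := 2/3) (by norm_num)
    (rt_le 6 (by norm_num) (by norm_num) 5 (by norm_num) (by norm_num) (by norm_num))
    (rt_le 3 (by norm_num) (by norm_num) 2 (by norm_num) (by norm_num) (by norm_num))
  have t3 := mono_term (κu := 1.145) (κd := 0.0793) ha hR0 hL0 hδ rfl (u := 7/8) (p := -1) (s := 5/8) (by norm_num)
    (rt_le 8 (by norm_num) (by norm_num) 7 (by norm_num) (by norm_num) (by norm_num))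
    (rt_le 8 (by norm_num) (by norm_num) 5 (by norm_num) (by norm_num) (by norm_num))
  have t4 := mono_term (κu := 1.102) (κd := 0.0288) ha hR0 hL0 hδ rfl (u := 5/8) (p := -1/2) (s := 7/8) (by norm_num)
    (rt_le 8 (by norm_num) (by norm_num) 5 (by norm_num) (by norm_num) (by norm_num))
    (rt_le 8 (by norm_num) (by norm_num) 7 (by norm_num) (by norm_num) (by norm_num))
  rw [mono_conv ha hx0 hL0 (p' := 1/8) (q' := 11/16) (r' := 3/8) (by norm_num) (by norm_num) (by norm_num)] at t1
  rw [mono_conv ha hx0 hL0 (p' := 1/4) (q' := 5/8) (r' := 1/4) (by norm_num) (by norm_num) (by norm_num)] at t2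
  rw [mono_conv ha hx0 hL0 (p' := -69/64) (q' := 81/128) (r' := 17/64) (by norm_num) (by norm_num) (by norm_num)] at t3
  rw [mono_conv ha hx0 hL0 (p' := -39/64) (q' := 75/128) (r' := 11/64) (by norm_num) (by norm_num) (by norm_num)] at t4
  have l3 : L ^ (145/64:ℝ) = L ^ (17/64:ℝ) * (L * L) := by
    rw [show (145/64:ℝ) = 17/64 + 2 by norm_num, Real.rpow_add hL0, Real.rpow_two, sq]
  have l4 : L ^ (139/64:ℝ) = L ^ (11/64:ℝ) * (L * L) := by
    rw [show (139/64:ℝ) = 11/64 + 2 by norm_num, Real.rpow_add hL0, Real.rpow_two, sq]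
  have l5 : L ^ (5/2:ℝ) = L ^ (1/4:ℝ) * L ^ (9/4:ℝ) := by
    rw [← Real.rpow_add hL0]; norm_num
  have l5' : L ^ (5/2:ℝ) = L ^ (1/2:ℝ) * (L * L) := by
    rw [show (5/2:ℝ) = 1/2 + 2 by norm_num, Real.rpow_add hL0, Real.rpow_two, sq]
  have l6 : (49.5:ℝ) ≤ L ^ (9/4:ℝ) :=
    pow_rt 4 (by linarith) (by norm_num) 9 (by norm_num) (le_trans (by norm_num) (pow_le_pow_left₀ (by norm_num) hL 9)) (by norm_num)
  have l7 : (1:ℝ) ≤ L ^ (1/2:ℝ) := Real.one_le_rpow (by linarith) (by norm_num)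
  have x1 : (1:ℝ) ≤ x ^ (5/8:ℝ) := Real.one_le_rpow (by linarith) (by norm_num)
  have hx12 : x ^ (1/2:ℝ) = √x := (Real.sqrt_eq_rpow x).symm
  -- the four main terms
  have T3 : 2 * (√(128 * L) / π) * (1.57 * ((7/6 * √x) ^ (7/8 : ℝ) * a ^ (-1 : ℝ)) * (1 / (π * δ)) ^ (5/8 : ℝ) * (7.8 * (1.45 * L)))
      ≤ 12 * a ^ (-(69 : ℝ) / 64) * x ^ ((81 : ℝ) / 128) * L ^ ((145 : ℝ) / 64) := by
    set Z := a ^ (-69/64 : ℝ) * x ^ ((81 : ℝ) / 128) * L ^ ((17 : ℝ) / 64) with hZ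
    have hZ0 : 0 < Z := by positivity
    have hZL : 0 < Z * L := by positivity
    calc _ = (2 * (√(128 * L) / π) * ((7/6 * √x) ^ (7/8 : ℝ) * a ^ (-1 : ℝ) * (1 / (π * δ)) ^ (5/8 : ℝ))) * (1.57 * (7.8 * (1.45 * L))) := by ring
      _ ≤ (7.203 * 1.145 * 0.0793 * Z) * (1.57 * (7.8 * (1.45 * L))) := by gcongr
      _ ≤ 12 * (Z * L) * L := by
        have := mul_le_mul_of_nonneg_left hL hZL.le
        linarith
      _ = _ := by rw [l3, hZ]; ring
  have T4 : 2 * (√(128 * L) / π) * (11.4 * ((7/6 * √x) ^ (5/8 : ℝ) * a ^ (-1/2 : ℝ)) * (1 / (π * δ)) ^ (7/8 : ℝ) * (6.95 * (1.45 * L)))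
      ≤ 12 * a ^ (-(39 : ℝ) / 64) * x ^ ((75 : ℝ) / 128) * L ^ ((139 : ℝ) / 64) := by
    set Z := a ^ (-39/64 : ℝ) * x ^ ((75 : ℝ) / 128) * L ^ ((11 : ℝ) / 64) with hZ
    have hZ0 : 0 < Z := by positivity
    have hZL : 0 < Z * L := by positivity
    calc _ = (2 * (√(128 * L) / π) * ((7/6 * √x) ^ (5/8 : ℝ) * a ^ (-1/2 : ℝ) * (1 / (π * δ)) ^ (7/8 : ℝ))) * (11.4 * (6.95 * (1.45 * L))) := by ring
      _ ≤ (7.203 * 1.102 * 0.0288 * Z) * (11.4 * (6.95 * (1.45 * L))) := by gcongr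
      _ ≤ 12 * (Z * L) * L := by
        have := mul_le_mul_of_nonneg_left hL hZL.le
        linarith
      _ = _ := by rw [l4, hZ]; ring
  have T2 : 2 * (√(128 * L) / π) * (43.5 * ((7/6 * √x) ^ (5/6 : ℝ) * a ^ (1/3 : ℝ)) * (1 / (π * δ)) ^ (2/3 : ℝ) * 54.2)
      ≤ a ^ (1/4:ℝ) * (16 * L ^ (5/2:ℝ) + 543 * L ^ (1/4:ℝ)) * x ^ (5/8:ℝ) := by
    set Z := a ^ (1/4 : ℝ) * x ^ (5/8:ℝ) * L ^ (1/4:ℝ) with hZ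
    have hZ0 : 0 < Z := by positivity
    calc _ = (2 * (√(128 * L) / π) * ((7/6 * √x) ^ (5/6 : ℝ) * a ^ (1/3 : ℝ) * (1 / (π * δ)) ^ (2/3 : ℝ))) * (43.5 * 54.2) := by ring
      _ ≤ (7.203 * 1.1372 * 0.067 * Z) * (43.5 * 54.2) := by gcongr
      _ ≤ 16 * (Z * L ^ (9/4:ℝ)) + 543 * Z := by
        have := mul_le_mul_of_nonneg_left l6 hZ0.le
        linarith
      _ = _ := by rw [l5, hZ]; ring
  have T1 : 2 * (√(128 * L) / π) * (8.8 * ((7/6 * √x) ^ (7/6 : ℝ) * a ^ (1/6 : ℝ)) * (1 / (π * δ)) ^ (1/3 : ℝ) * 37.5)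
      ≤ 750 * (a ^ ((1 : ℝ) / 8) * x ^ ((11 : ℝ) / 16) * L ^ ((3 : ℝ) / 8)) := by
    set Z := a ^ (1/8 : ℝ) * x ^ (11/16:ℝ) * L ^ (3/8:ℝ) with hZ
    have hZ0 : 0 < Z := by positivity
    calc _ = (2 * (√(128 * L) / π) * ((7/6 * √x) ^ (7/6 : ℝ) * a ^ (1/6 : ℝ) * (1 / (π * δ)) ^ (1/3 : ℝ))) * (8.8 * 37.5) := by ring
      _ ≤ (7.203 * 1.1971 * 0.25875 * Z) * (8.8 * 37.5) := by gcongr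
      _ ≤ 750 * Z := by linarith
  have T5 : 2 * (0.71 * (2.9 * L * (1.45 * L))) ≤ (a ^ (1/4:ℝ) * (118 * L ^ (5/2:ℝ)) + 20 * L ^ (5/2:ℝ) / a ^ (1/4:ℝ)) * x ^ (5/8:ℝ) := by
    set b := a ^ (1/4:ℝ) with hb
    have hb0 : 0 < b := by positivity
    have h1 : 6 ≤ b * 118 + 20 / b := by
      rw [← sub_nonneg]
      have : b * 118 + 20 / b - 6 = (118 * b ^ 2 + 20 - 6 * b) / b := by field_simp
      rw [this]
      apply div_nonneg _ hb0.le
      linarith [sq_nonneg (b - 1), sq_nonneg b]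
    have h2 : L * L ≤ L ^ (5/2:ℝ) := by rw [l5']; exact le_mul_of_one_le_left (mul_pos hL0 hL0).le l7
    calc _ ≤ 6 * (L * L) * 1 := by linarith [mul_pos hL0 hL0]
      _ ≤ (b * 118 + 20 / b) * L ^ (5/2:ℝ) * x ^ (5/8:ℝ) := by gcongr
      _ = _ := by ring
  -- the lower-order terms
  have hsa : 0 < √a := Real.sqrt_pos.2 ha
  have hα1 : a ≤ α := hα ▸ le_max_left _ _
  have hα2 : (√a)⁻¹ ≤ α := by rw [hα, ← one_div]; exact le_max_right _ _
  have hα0 : 0 < α := lt_of_lt_of_le ha hα1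
  have hα3 : 1 ≤ α := by
    by_contra h
    push Not at h
    have h1 : a < 1 := by linarith
    have h2 : √a ≤ 1 := by rw [Real.sqrt_le_left (by norm_num)]; linarith
    have h3 : 1 ≤ (√a)⁻¹ := (one_le_inv₀ hsa).2 h2
    linarith
  have f1 : a ^ 2 ≤ α ^ 3 := by
    calc a ^ 2 ≤ α ^ 2 := by gcongr
      _ ≤ α ^ 3 := pow_le_pow_right₀ hα3 (by norm_num)
  have f2 : a ^ 3 ≤ α ^ 3 := by gcongr
  have f3 : (√a)⁻¹ ^ 3 ≤ α ^ 3 := by gcongr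
  have hc5 : c + 0.5 ≤ 1.38 * √x := by linarith
  have f4 : 28.8 * (c + 0.5) / (a * x) ≤ 14 * L / a * √x := by
    rw [div_le_iff₀ (by positivity)]
    have : 14 * L / a * √x * (a * x) = 14 * L * √x * x := by field_simp
    rw [this]
    have h1 : √x * 3 ≤ √x * x := by gcongr
    have h2 : (√x * x) * 5.69 ≤ (√x * x) * L := by gcongr
    linarith
  have f5 : 4 * (7/6 * √x) / a * (2.9 * L) ≤ 14 * L / a * √x := by
    have h0 : 0 < L / a * √x := by positivity
    have : 4 * (7/6 * √x) / a * (2.9 * L) = 4 * (7/6) * 2.9 * (L / a * √x) := by ring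
    have h' : 14 * L / a * √x = 14 * (L / a * √x) := by ring
    rw [this, h']; linarith
  have f6 : 1.34 * (7/6 * √x) * a ^ 2 ≤ 159 * α ^ 3 * √x := by
    have : a ^ 2 * √x ≤ α ^ 3 * √x := by gcongr
    have h0 : 0 ≤ α ^ 3 * √x := by positivity
    linarith
  rw [hx12]
  exact comb T1 T2 T3 T4 T5 f1 f2 f3 f4 f5 f6 hc5 hL0.le ha hR0 hα0

end EllAux
end M17sec

section M18sec
namespace EllAux

lemma log_three_ge : (1.09:ℝ) ≤ log 3 := by
  rw [Real.le_log_iff_exp_le (by norm_num), show (1.09:ℝ) = 1 + 0.09 by norm_num, exp_add]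
  have h1 := Real.exp_one_lt_d9
  have h3 : exp (0.09:ℝ) ≤ 1.0945 := by
    have := Real.exp_bound' (x := 0.09) (by norm_num) (by norm_num) (n := 4) (by norm_num)
    refine this.trans ?_
    norm_num [Finset.sum_range_succ, Nat.factorial]
  have h4 := exp_pos (0.09:ℝ)
  have h5 := exp_pos (1:ℝ)
  nlinarith

lemma zt_eq (c δ : ℝ) : zt c δ = δ ^ 2 * (4 * π / 3 * (c ^ 3 + c * δ ^ 2 / 2)) := by
  unfold zt; ring

lemma zt_up {R δ : ℝ} (hδ : 0 < δ) (h : δ ≤ R / 12) :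
    4 * π / 3 * ((R + δ) ^ 3 + (R + δ) * δ ^ 2 / 2) ≤ 4 * π / 3 * R ^ 3 + 14 * (R ^ 2 * δ) := by
  have hπ := Real.pi_lt_d2
  have hπ0 := Real.pi_pos
  have hR : 0 < R := by linarith
  have h1 : R * δ ^ 2 ≤ R ^ 2 * δ / 12 := by nlinarith [mul_pos hR hδ]
  have h2 : δ ^ 3 ≤ R ^ 2 * δ / 144 := by
    have : δ ^ 2 ≤ (R / 12) ^ 2 := by gcongr
    nlinarith
  have h3 : (R + δ) ^ 3 + (R + δ) * δ ^ 2 / 2 ≤ R ^ 3 + 3.31 * (R ^ 2 * δ) := by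
    nlinarith [mul_pos (mul_pos hR hR) hδ]
  have h4 : 4 * π / 3 * ((R + δ) ^ 3 + (R + δ) * δ ^ 2 / 2) ≤ 4 * π / 3 * (R ^ 3 + 3.31 * (R ^ 2 * δ)) := by gcongr
  have h5 : 0 < R ^ 2 * δ := by positivity
  nlinarith

lemma zt_lo {R δ : ℝ} (hδ : 0 < δ) (h : δ ≤ R / 12) :
    4 * π / 3 * R ^ 3 - 14 * (R ^ 2 * δ) ≤ 4 * π / 3 * ((R - δ) ^ 3 + (R - δ) * δ ^ 2 / 2) := by
  have hπ := Real.pi_lt_d2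
  have hπ0 := Real.pi_pos
  have hR : 0 < R := by linarith
  have h2 : δ ^ 3 ≤ R * δ ^ 2 / 12 := by nlinarith [mul_pos hδ hδ]
  have h3 : R ^ 3 - 3 * (R ^ 2 * δ) ≤ (R - δ) ^ 3 + (R - δ) * δ ^ 2 / 2 := by
    nlinarith [mul_pos hR (mul_pos hδ hδ)]
  have h4 : 4 * π / 3 * (R ^ 3 - 3 * (R ^ 2 * δ)) ≤ 4 * π / 3 * ((R - δ) ^ 3 + (R - δ) * δ ^ 2 / 2) := by gcongr
  have h5 : 0 < R ^ 2 * δ := by positivity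
  nlinarith

lemma fin_lo {d E N n z V w p q r Y2 Y3 Y4 Y5 Y6 : ℝ} (hd : 0 < d) (A : |N - d * z| ≤ d * E) (B : E ≤ 750 * (p * q * r) + Y2 + Y3 + Y4 + Y5 + Y6)
    (D : N ≤ n * d) (Z : V - w ≤ z) (hz : w ≤ 487 * (p * q * r)) : -(1237 * p * q * r + Y2 + Y3 + Y4 + Y5 + Y6) ≤ n - V := by
  have h1 := (abs_le.1 A).1
  have h2 : d * (z - E) ≤ d * n := by linarith
  have h3 := le_of_mul_le_mul_left h2 hd
  linarith

lemma fin_up {d E N n z V w p q r Y2 Y3 Y4 Y5 Y6 : ℝ} (hd : 0 < d) (A : |N - d * z| ≤ d * E) (B : E ≤ 750 * (p * q * r) + Y2 + Y3 + Y4 + Y5 + Y6)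
    (D : n * d ≤ N) (Z : z ≤ V + w) (hz : w ≤ 487 * (p * q * r)) : n - V ≤ 1237 * p * q * r + Y2 + Y3 + Y4 + Y5 + Y6 := by
  have h1 := (abs_le.1 A).2
  have h2 : d * n ≤ d * (z + E) := by linarith
  have h3 := le_of_mul_le_mul_left h2 hd
  linarith

theorem main (a x : ℝ) (ha : 0 < a) (hx : 0 < x)
    (L : ℝ) (hL : L = Real.log (100 * x) + |Real.log a|)
    (y : ℝ) (hy : y = 73.6 * a ^ ((1 : ℝ) / 8) * x ^ ((3 : ℝ) / 16) * L ^ ((3 : ℝ) / 8))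
    (hy₁ : 1 ≤ y) (hy₂ : y ≤ x / 3)
    (α₀ : ℝ) (hα₀ : α₀ = max a (1 / Real.sqrt a)) :
    |Nc a (√x) - (4 * π / 3) * x ^ ((3 : ℝ) / 2)| ≤ 1237 * a ^ ((1 : ℝ) / 8) * x ^ ((11 : ℝ) / 16) * L ^ ((3 : ℝ) / 8)
        + 12 * a ^ (-(69 : ℝ) / 64) * x ^ ((81 : ℝ) / 128) * L ^ ((145 : ℝ) / 64)
        + (a ^ ((1 : ℝ) / 4) * (134 * L ^ ((5 : ℝ) / 2) + 543 * L ^ ((1 : ℝ) / 4))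
            + 20 * L ^ ((5 : ℝ) / 2) / a ^ ((1 : ℝ) / 4)) * x ^ ((5 : ℝ) / 8)
        + 12 * a ^ (-(39 : ℝ) / 64) * x ^ ((75 : ℝ) / 128) * L ^ ((139 : ℝ) / 64)
        + (268 * L / a + 159 * α₀ ^ 3 + 2000) * x ^ ((1 : ℝ) / 2)
        + α₀ ^ 3 * (4.4 * L + 104.5) := by
  have hx3 : 3 ≤ x := by linarith
  have hL5 : 5.69 ≤ L := by
    rw [hL, Real.log_mul (by norm_num) hx.ne']
    have h1 := log_hundred
    have h2 := log_three_ge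
    have h3 := Real.log_le_log (by norm_num) hx3
    have := abs_nonneg (log a)
    linarith
  have hL0 : 0 < L := by linarith
  set R := √x with hR
  have hR0 : 0 < R := Real.sqrt_pos.2 hx
  have hRx : R * R = x := Real.mul_self_sqrt hx.le
  set δ := y / (4 * R) with hδ
  have hδ0 : 0 < δ := by positivity
  have hyδ : y = 4 * (R * δ) := by rw [hδ]; field_simp
  have hδe : δ = 18.4 * a ^ (1/8:ℝ) * R ^ (-5/8:ℝ) * L ^ (3/8:ℝ) := by
    rw [hδ, hy, div_eq_iff (by positivity)]
    have : x ^ (3/16:ℝ) = R ^ (-5/8:ℝ) * R := by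
      rw [hR, Real.sqrt_eq_rpow, ← Real.rpow_mul hx.le, ← Real.rpow_add hx]; norm_num
    rw [this]; ring
  have hδR : δ ≤ R / 12 := by
    rw [hyδ, ← hRx] at hy₂
    nlinarith
  have hδ2 : 1 ≤ δ ^ 2 * (16 * x) := by
    have : δ ^ 2 * (16 * x) = y ^ 2 := by rw [hyδ, ← hRx]; ring
    rw [this]; nlinarith
  have hx32 : x ^ ((3:ℝ)/2) = R ^ 3 := by
    rw [hR, Real.sqrt_eq_rpow, ← Real.rpow_natCast, ← Real.rpow_mul hx.le]; norm_num
  have hz : 14 * (R ^ 2 * δ) ≤ 487 * (a ^ ((1 : ℝ) / 8) * x ^ ((11 : ℝ) / 16) * L ^ ((3 : ℝ) / 8)) := by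
    have h1 : R ^ 2 * δ = 18.4 * (a ^ ((1 : ℝ) / 8) * x ^ ((11 : ℝ) / 16) * L ^ ((3 : ℝ) / 8)) := by
      have : x ^ (11/16:ℝ) = R ^ (-5/8:ℝ) * R ^ 2 := by
        rw [hR, Real.sqrt_eq_rpow, ← Real.rpow_natCast, ← Real.rpow_mul hx.le, ← Real.rpow_mul hx.le, ← Real.rpow_add hx]; norm_num
      rw [hδe, this]; ring
    have : 0 < a ^ ((1 : ℝ) / 8) * x ^ ((11 : ℝ) / 16) * L ^ ((3 : ℝ) / 8) := by positivity
    rw [h1]; linarith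
  have hd2 : 0 < δ ^ 2 := by positivity
  rw [hx32, abs_le]
  constructor
  · have hc : δ < R - δ := by linarith only [hδR, hR0]
    have A := limit_bound ha hδ0 hc.le (main_E ha hx3 hL hδ0 hδ2 hc (U := 7/6 * R) (by linarith only [hδR, hR0, hδ0]))
    have B := E_bound (c := R - δ) ha hx3 hL5 hδe (by linarith only [hδR, hR0]) (by linarith only [hR0, hδ0]) hα₀
    have D := sandwich_lo ha hR0.le hδ0
    have Z := zt_lo hδ0 hδR
    rw [zt_eq] at A
    rw [show R - δ + δ = R by ring, show R - δ - δ = R - 2 * δ by ring] at A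
    exact fin_lo hd2 A B D Z hz
  · have hc : δ < R + δ := by linarith only [hR0]
    have A := limit_bound ha hδ0 hc.le (main_E ha hx3 hL hδ0 hδ2 hc (U := 7/6 * R) (by linarith only [hδR, hR0]))
    have B := E_bound (c := R + δ) ha hx3 hL5 hδe (by linarith only [hR0, hδ0]) (by linarith only [hδR]) hα₀
    have D := sandwich_up ha hR0.le hδ0
    have Z := zt_up hδ0 hδR
    rw [zt_eq] at A
    rw [show R + δ + δ = R + 2 * δ by ring, show R + δ - δ = R by ring] at A
    exact fin_up hd2 A B D Z hz

end EllAux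
end M18sec

/-- **Effective estimate for the lattice point discrepancy of ellipsoids of rotation.**
For positive reals `a, x` with `𝓛 = log(100x) + |log a|` such that
`y = 73.6·a^{1/8}·x^{3/16}·𝓛^{3/8}` satisfies `1 ≤ y ≤ x/3`, the lattice point discrepancy
`P(x) = #{m ∈ ℤ³ : (m₁²+m₂²)/a + a²m₃² ≤ x} − (4π/3)x^{3/2}` of the ellipsoid of rotation
`(u₁²+u₂²)/a + a²u₃² ≤ x` satisfies, with `α₀ = max(a, 1/√a)`,
`|P(x)| ≤ 1237·a^{1/8}·x^{11/16}·𝓛^{3/8} + 12·a^{−69/64}·x^{81/128}·𝓛^{145/64}`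
`+ (a^{1/4}(134𝓛^{5/2} + 543𝓛^{1/4}) + 20𝓛^{5/2}/a^{1/4})·x^{5/8}`
`+ 12·a^{−39/64}·x^{75/128}·𝓛^{139/64} + (268𝓛/a + 159α₀³ + 2000)·x^{1/2} + α₀³(4.4𝓛 + 104.5)`. -/
theorem lattice_discrepancy_ellipsoid_of_rotation (a x : ℝ) (ha : 0 < a) (hx : 0 < x)
    (L : ℝ) (hL : L = Real.log (100 * x) + |Real.log a|)
    (y : ℝ) (hy : y = 73.6 * a ^ ((1 : ℝ) / 8) * x ^ ((3 : ℝ) / 16) * L ^ ((3 : ℝ) / 8))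
    (hy₁ : 1 ≤ y) (hy₂ : y ≤ x / 3)
    (P : ℝ)
    (hP : P = (Set.ncard {m : ℤ × ℤ × ℤ |
          (((m.1 : ℝ) ^ 2 + (m.2.1 : ℝ) ^ 2) / a + a ^ 2 * (m.2.2 : ℝ) ^ 2) ≤ x} : ℝ)
        - (4 * π / 3) * x ^ ((3 : ℝ) / 2))
    (α₀ : ℝ) (hα₀ : α₀ = max a (1 / Real.sqrt a)) :
    |P| ≤ 1237 * a ^ ((1 : ℝ) / 8) * x ^ ((11 : ℝ) / 16) * L ^ ((3 : ℝ) / 8)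
        + 12 * a ^ (-(69 : ℝ) / 64) * x ^ ((81 : ℝ) / 128) * L ^ ((145 : ℝ) / 64)
        + (a ^ ((1 : ℝ) / 4) * (134 * L ^ ((5 : ℝ) / 2) + 543 * L ^ ((1 : ℝ) / 4))
            + 20 * L ^ ((5 : ℝ) / 2) / a ^ ((1 : ℝ) / 4)) * x ^ ((5 : ℝ) / 8)
        + 12 * a ^ (-(39 : ℝ) / 64) * x ^ ((75 : ℝ) / 128) * L ^ ((139 : ℝ) / 64)
        + (268 * L / a + 159 * α₀ ^ 3 + 2000) * x ^ ((1 : ℝ) / 2)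
        + α₀ ^ 3 * (4.4 * L + 104.5) := by 
  rw [hP, EllAux.count_eq hx.le]
  exact EllAux.main a x ha hx L hL y hy hy₁ hy₂ α₀ hα₀
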